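/- Let 1 ≤ q < p ≤ ∞, k ∈ ℕ, and α, β ≥ 0. Then there exist constants c₁, c₂ > 0, depending only on k, q, p, α, β, such that for every n ∈ ℕ: (i) if k ≥ 2 and (k, q, p) ≠ (2, 1, ∞), then c₁·n^{−2/q + 2/p} ≤ E(M^k ∩ B_p^{α,β}, P_n)_{w_{α,β}, q} ≤ c₂·n^{−2/q + 2/p}; (ii) if k = 2, q = 1, p = ∞ and α = β = 0, then c₁·n^{−2} ≤ E(M² ∩ B_∞^{0,0}, P_n)_{w_{0,0}, 1} ≤ c₂·n^{−2}; (iii) if k = 1 and p ≠ 2q, then c₁·n^{−min{2/q − 2/p, 1/q}} ≤ E(M¹ ∩ B_p^{α,β}, P_n)_{w_{α,β}, q} ≤ c₂·n^{−min{2/q − 2/p, 1/q}}. -/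

import Mathlib

open MeasureTheory Set Filter
open scoped ENNReal

noncomputable section

/-- The Jacobi weight `w_{α,β}(x) = (1+x)^α (1-x)^β`. -/
def jacobi (α β : ℝ) (x : ℝ) : ℝ := (1 + x) ^ α * (1 - x) ^ β

/-- `φ(x) = √(1-x²)`. -/
def phiW (x : ℝ) : ℝ := Real.sqrt (1 - x ^ 2)

/-- The `L^p` norm of `g` on the interval `[a,b]` (essential sup when `p = ∞`). -/
def LpOn (g : ℝ → ℝ) (p : ℝ≥0∞) (a b : ℝ) : ℝ≥0∞ :=
  eLpNorm g p (volume.restrict (Icc a b))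

/-- The `k`-th symmetric difference `Δ_h^k(f,x)` relative to `[-1,1]`. -/
def symmDelta (k : ℕ) (h : ℝ) (f : ℝ → ℝ) (x : ℝ) : ℝ :=
  if (x - k * h / 2 ∈ Icc (-1 : ℝ) 1 ∧ x + k * h / 2 ∈ Icc (-1 : ℝ) 1) then
    ∑ i ∈ Finset.range (k + 1), ((k.choose i : ℝ) * (-1 : ℝ) ^ (k - i) * f (x - k * h / 2 + i * h))
  else 0

/-- Main-part weighted modulus `Ω_φ^k(f,δ)_{w,p}`. -/
def OmegaMain (k : ℕ) (f : ℝ → ℝ) (δ : ℝ) (wt : ℝ → ℝ) (p : ℝ≥0∞) : ℝ≥0∞ :=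
  ⨆ h ∈ Ioc (0 : ℝ) δ,
    LpOn (fun x => wt x * symmDelta k (h * phiW x) f x) p
      (-1 + 2 * (k : ℝ) ^ 2 * h ^ 2) (1 - 2 * (k : ℝ) ^ 2 * h ^ 2)

/-- Forward part `Ω→_φ^k(f,δ)_{w,p}`. -/
def OmegaFwd (k : ℕ) (f : ℝ → ℝ) (δ : ℝ) (wt : ℝ → ℝ) (p : ℝ≥0∞) : ℝ≥0∞ :=
  ⨆ h ∈ Ioc (0 : ℝ) (2 * (k : ℝ) ^ 2 * δ ^ 2),
    LpOn (fun x => wt x * symmDelta k h f (x + k * h / 2)) p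
      (-1) (-1 + 2 * (k : ℝ) ^ 2 * δ ^ 2)

/-- Backward part `Ω←_φ^k(f,δ)_{w,p}`. -/
def OmegaBwd (k : ℕ) (f : ℝ → ℝ) (δ : ℝ) (wt : ℝ → ℝ) (p : ℝ≥0∞) : ℝ≥0∞ :=
  ⨆ h ∈ Ioc (0 : ℝ) (2 * (k : ℝ) ^ 2 * δ ^ 2),
    LpOn (fun x => wt x * symmDelta k h f (x - k * h / 2)) p
      (1 - 2 * (k : ℝ) ^ 2 * δ ^ 2) 1

/-- Weighted Ditzian–Totik modulus `ω_φ^k(f,δ)_{w,p}`. -/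
def omegaDT (k : ℕ) (f : ℝ → ℝ) (δ : ℝ) (wt : ℝ → ℝ) (p : ℝ≥0∞) : ℝ≥0∞ :=
  OmegaMain k f δ wt p + OmegaFwd k f δ wt p + OmegaBwd k f δ wt p

/-- `f` is `k`-monotone on `(-1,1)`: all `k`-th divided differences over `k+1` distinct
points of `(-1,1)` are nonnegative. -/
def kMonotoneOn (k : ℕ) (f : ℝ → ℝ) : Prop :=
  ∀ x : Fin (k + 1) → ℝ, Function.Injective x → (∀ i, x i ∈ Ioo (-1 : ℝ) 1) →
    0 ≤ ∑ i, f (x i) / ∏ j ∈ Finset.univ.erase i, (x i - x j)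

/-- `M^k`, the class of `k`-monotone functions on `(-1,1)`. -/
def MSet (k : ℕ) : Set (ℝ → ℝ) := {f | kMonotoneOn k f}

/-- `M_+^k`, the `k`-monotone functions on `(-1,1)` vanishing on `(-1,0]`. -/
def MPlus (k : ℕ) : Set (ℝ → ℝ) :=
  {f | kMonotoneOn k f ∧ ∀ x : ℝ, -1 < x → x ≤ 0 → f x = 0}

/-- `J_p = (-1/p, ∞)` for finite `p`, `[0,∞)` for `p = ∞`. -/
def Jset (p : ℝ≥0∞) : Set ℝ := if p = ∞ then Ici 0 else Ioi (-1 / p.toReal)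

/-- `W_p^{α,β}`. -/
def WSet (p : ℝ≥0∞) (α β : ℝ) : Set (ℝ → ℝ) :=
  {f | Measurable f ∧ LpOn (fun x => jacobi α β x * f x) p (-1) 1 ≠ ⊤}

/-- `B_p^{α,β}`, the unit sphere of `W_p^{α,β}`. -/
def BSet (p : ℝ≥0∞) (α β : ℝ) : Set (ℝ → ℝ) :=
  {f | Measurable f ∧ LpOn (fun x => jacobi α β x * f x) p (-1) 1 = 1}

/-- Best weighted approximation `E_n(f)_{w,q}` by polynomials of degree at most `n`. -/
def En (n : ℕ) (f : ℝ → ℝ) (wt : ℝ → ℝ) (q : ℝ≥0∞) : ℝ≥0∞ :=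
  ⨅ P ∈ {P : Polynomial ℝ | P.natDegree ≤ n},
    LpOn (fun x => wt x * (f x - P.eval x)) q (-1) 1

/-- `E(X, P_n)_{w,q}`. -/
def EClass (X : Set (ℝ → ℝ)) (n : ℕ) (wt : ℝ → ℝ) (q : ℝ≥0∞) : ℝ≥0∞ :=
  ⨆ f ∈ X, En n f wt q


lemma mink {X Y : Type*} [MeasurableSpace X] [MeasurableSpace Y] (μ : Measure X) (ν : Measure Y)
    [SFinite μ] [SFinite ν] (Q : ℝ) (hQ : 1 ≤ Q) (e : X → Y → ℝ≥0∞)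
    (he : Measurable (Function.uncurry e)) (l : Y → ℝ≥0∞) (hl : Measurable l)
    (hl0 : ∀ y, l y ≠ 0) (hlt : ∀ y, l y ≠ ∞)
    (h : ∀ᵐ y ∂ν, ∫⁻ x, (e x y) ^ Q ∂μ ≤ (l y) ^ Q) :
    ∫⁻ x, (∫⁻ y, e x y ∂ν) ^ Q ∂μ ≤ (∫⁻ y, l y ∂ν) ^ Q := by
  have hex : ∀ x, Measurable (e x) := fun x => he.of_uncurry_left
  rcases hQ.eq_or_lt with rfl | hQ1
  · simp only [ENNReal.rpow_one] at *
    rw [lintegral_lintegral_swap he.aemeasurable]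
    exact lintegral_mono_ae h
  set Q' := Q.conjExponent with hQ'
  have hc : Q.HolderConjugate Q' := Real.HolderConjugate.conjExponent hQ1
  have hQ0 : 0 < Q := by linarith
  have hQ'0 : 0 < Q' := hc.symm.pos
  have hQQ : Q * (1 / Q') = Q - 1 := by
    have := hc.inv_add_inv_eq_one
    have h2 : 1 / Q' = 1 - Q⁻¹ := by rw [one_div]; linarith
    rw [h2]; field_simp
  have key : ∀ x, (∫⁻ y, e x y ∂ν) ^ Q ≤
      (∫⁻ y, (e x y) ^ Q * (l y) ^ (1 - Q) ∂ν) * (∫⁻ y, l y ∂ν) ^ (Q - 1) := by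
    intro x
    have h1 : ∫⁻ y, e x y ∂ν = ∫⁻ y, ((fun y => e x y * (l y) ^ (-(1 / Q'))) *
        (fun y => (l y) ^ (1 / Q'))) y ∂ν := by
      apply lintegral_congr
      intro y
      simp only [Pi.mul_apply]
      rw [mul_assoc, ← ENNReal.rpow_add _ _ (hl0 y) (hlt y)]
      simp
    rw [h1]
    calc _ ≤ ((∫⁻ y, (e x y * (l y) ^ (-(1 / Q'))) ^ Q ∂ν) ^ (1 / Q) *
          (∫⁻ y, ((l y) ^ (1 / Q')) ^ Q' ∂ν) ^ (1 / Q')) ^ Q := by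
          apply ENNReal.rpow_le_rpow _ hQ0.le
          exact ENNReal.lintegral_mul_le_Lp_mul_Lq ν hc
            ((hex x).mul (hl.pow_const _)).aemeasurable (hl.pow_const _).aemeasurable
      _ = _ := by
          rw [ENNReal.mul_rpow_of_nonneg _ _ hQ0.le, ← ENNReal.rpow_mul, ← ENNReal.rpow_mul,
            one_div_mul_cancel hQ0.ne', ENNReal.rpow_one, mul_comm (1 / Q') Q, hQQ]
          congr 1
          · apply lintegral_congr
            intro y
            rw [ENNReal.mul_rpow_of_nonneg _ _ hQ0.le, ← ENNReal.rpow_mul]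
            congr 2
            linarith
          · congr 1
            apply lintegral_congr
            intro y
            rw [← ENNReal.rpow_mul, one_div_mul_cancel hQ'0.ne', ENNReal.rpow_one]
  have hm : Measurable (Function.uncurry fun x y => (e x y) ^ Q * (l y) ^ (1 - Q)) :=
    (he.pow_const Q).mul ((hl.comp measurable_snd).pow_const _)
  calc _ ≤ ∫⁻ x, (∫⁻ y, (e x y) ^ Q * (l y) ^ (1 - Q) ∂ν) * (∫⁻ y, l y ∂ν) ^ (Q - 1) ∂μ :=
        lintegral_mono key
    _ = (∫⁻ x, (∫⁻ y, (e x y) ^ Q * (l y) ^ (1 - Q) ∂ν) ∂μ) * (∫⁻ y, l y ∂ν) ^ (Q - 1) :=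
        lintegral_mul_const _ hm.lintegral_prod_right'
    _ = (∫⁻ y, (∫⁻ x, (e x y) ^ Q * (l y) ^ (1 - Q) ∂μ) ∂ν) * (∫⁻ y, l y ∂ν) ^ (Q - 1) := by
        rw [lintegral_lintegral_swap hm.aemeasurable]
    _ ≤ (∫⁻ y, l y ∂ν) * (∫⁻ y, l y ∂ν) ^ (Q - 1) := by
        refine mul_le_mul' (lintegral_mono_ae ?_) le_rfl
        filter_upwards [h] with y hy
        rw [lintegral_mul_const _ ((he.of_uncurry_right).pow_const _)]
        calc _ ≤ (l y) ^ Q * (l y) ^ (1 - Q) := by gcongr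
          _ = l y := by
            rw [← ENNReal.rpow_add _ _ (hl0 y) (hlt y)]; simp
    _ = _ := by
        conv_lhs => enter [1]; rw [← ENNReal.rpow_one (∫⁻ y, l y ∂ν)]
        rw [← ENNReal.rpow_add_of_nonneg _ _ zero_le_one (by linarith)]
        congr 1; ring

open Polynomial in
lemma fejer_poly (m : ℕ) : ∃ R : ℝ[X], R.natDegree ≤ m ∧
    ∀ s : ℝ, (1 - Real.cos s) * R.eval (Real.cos s) = 1 - Real.cos (m * s) := by
  have hd : (X - C (1:ℝ)) ∣ (Chebyshev.T ℝ m - 1) := by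
    rw [dvd_iff_isRoot]; simp
  obtain ⟨R, hR⟩ := hd
  refine ⟨R, ?_, fun s => ?_⟩
  · by_cases h0 : R = 0
    · simp [h0]
    have h1 : ((X - C (1:ℝ)) * R).natDegree = 1 + R.natDegree := by
      rw [natDegree_mul (X_sub_C_ne_zero 1) h0, natDegree_X_sub_C]
    have h2 : (Chebyshev.T ℝ m - 1).natDegree ≤ m := by
      refine (natDegree_sub_le _ _).trans ?_
      simp
    rw [← hR] at h1
    omega
  · have := congrArg (eval (Real.cos s)) hR
    simp only [eval_sub, eval_mul, eval_X, eval_C, Chebyshev.T_real_cos, eval_one] at this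
    push_cast at this
    linarith

lemma sym_cos_cont (j : ℕ) : Continuous (fun τ : ℝ => ∫ s in (-τ)..τ, Real.cos (j * s)) := by
  have h : ∀ a b : ℝ, IntervalIntegrable (fun s : ℝ => Real.cos (j * s)) volume a b :=
    fun a b => (by fun_prop : Continuous (fun s : ℝ => Real.cos (j * s))).intervalIntegrable a b
  have h2 : (fun τ : ℝ => ∫ s in (-τ)..τ, Real.cos (j * s)) =
      fun τ => (∫ s in (0:ℝ)..τ, Real.cos (j * s)) - ∫ s in (0:ℝ)..(-τ), Real.cos (j * s) := by
    ext τ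
    rw [intervalIntegral.integral_interval_sub_left (h _ _) (h _ _)]
  rw [h2]
  have h3 := intervalIntegral.continuous_primitive h 0
  exact h3.sub (h3.comp continuous_neg)

lemma sym_sin_zero (j : ℕ) (τ : ℝ) : ∫ s in (-τ)..τ, Real.sin (j * s) = 0 := by
  have := intervalIntegral.integral_comp_neg (a := -τ) (b := τ) (fun s : ℝ => Real.sin (j * s))
  simp only [mul_neg, Real.sin_neg, neg_neg, intervalIntegral.integral_neg] at this
  linarith

open Polynomial in
lemma conv_poly (N : ℕ) : ∀ R : ℝ[X], R.natDegree ≤ N → ∃ c : ℕ → ℝ → ℝ, (∀ j, Continuous (c j)) ∧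
    ∀ τ θ : ℝ, ∫ s in (-τ)..τ, R.eval (Real.cos (θ - s)) =
      ∑ j ∈ Finset.range (N + 1), c j τ * (Real.cos θ) ^ j := by
  have hT : ∀ n N : ℕ, n ≤ N → ∃ c : ℕ → ℝ → ℝ, (∀ j, Continuous (c j)) ∧
    ∀ τ θ : ℝ, ∫ s in (-τ)..τ, (Chebyshev.T ℝ n).eval (Real.cos (θ - s)) =
      ∑ j ∈ Finset.range (N + 1), c j τ * (Real.cos θ) ^ j := by
    intro n N hn
    refine ⟨fun j τ => (∫ s in (-τ)..τ, Real.cos (n * s)) * (Chebyshev.T ℝ n).coeff j,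
      fun j => (sym_cos_cont n).mul continuous_const, fun τ θ => ?_⟩
    have h1 : ∀ s : ℝ, (Chebyshev.T ℝ n).eval (Real.cos (θ - s)) =
        Real.cos (n * θ) * Real.cos (n * s) + Real.sin (n * θ) * Real.sin (n * s) := by
      intro s
      rw [Chebyshev.T_real_cos, ← Real.cos_sub]; push_cast; ring_nf
    simp_rw [h1]
    rw [intervalIntegral.integral_add, intervalIntegral.integral_const_mul,
      intervalIntegral.integral_const_mul, sym_sin_zero]
    · have h2 := eval_eq_sum_range' (p := Chebyshev.T ℝ n) (n := N + 1)
        (by simp; omega) (Real.cos θ)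
      rw [Chebyshev.T_real_cos] at h2
      push_cast at h2
      rw [h2, mul_zero, add_zero, Finset.sum_mul]
      exact Finset.sum_congr rfl fun j _ => by ring
    · exact (by fun_prop : Continuous _).intervalIntegrable _ _
    · exact (by fun_prop : Continuous _).intervalIntegrable _ _
  suffices H : ∀ n ≤ N, ∀ R : ℝ[X], R.natDegree ≤ n → ∃ c : ℕ → ℝ → ℝ, (∀ j, Continuous (c j)) ∧
    ∀ τ θ : ℝ, ∫ s in (-τ)..τ, R.eval (Real.cos (θ - s)) =
      ∑ j ∈ Finset.range (N + 1), c j τ * (Real.cos θ) ^ j from H N le_rfl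
  have comb : ∀ (R A B : ℝ[X]) (a : ℝ), R = C a * A + B →
      (∃ c : ℕ → ℝ → ℝ, (∀ j, Continuous (c j)) ∧
    ∀ τ θ : ℝ, ∫ s in (-τ)..τ, A.eval (Real.cos (θ - s)) =
      ∑ j ∈ Finset.range (N + 1), c j τ * (Real.cos θ) ^ j) →
      (∃ c : ℕ → ℝ → ℝ, (∀ j, Continuous (c j)) ∧
    ∀ τ θ : ℝ, ∫ s in (-τ)..τ, B.eval (Real.cos (θ - s)) =
      ∑ j ∈ Finset.range (N + 1), c j τ * (Real.cos θ) ^ j) →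
      (∃ c : ℕ → ℝ → ℝ, (∀ j, Continuous (c j)) ∧
    ∀ τ θ : ℝ, ∫ s in (-τ)..τ, R.eval (Real.cos (θ - s)) =
      ∑ j ∈ Finset.range (N + 1), c j τ * (Real.cos θ) ^ j) := by
    rintro R A B a rfl ⟨c, hc, h⟩ ⟨c', hc', h'⟩
    refine ⟨fun j τ => a * c j τ + c' j τ, fun j => (continuous_const.mul (hc j)).add (hc' j),
      fun τ θ => ?_⟩
    simp only [eval_add, eval_mul, eval_C]
    rw [intervalIntegral.integral_add, intervalIntegral.integral_const_mul, h, h', Finset.mul_sum,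
      ← Finset.sum_add_distrib]
    · exact Finset.sum_congr rfl fun j _ => by ring
    · exact (by fun_prop : Continuous _).intervalIntegrable _ _
    · exact (by fun_prop : Continuous _).intervalIntegrable _ _
  intro n
  induction n with
  | zero =>
    intro _ R hR
    have : R = C (R.coeff 0) * Chebyshev.T ℝ (0:ℕ) + 0 := by
      simp; exact eq_C_of_natDegree_le_zero hR
    exact comb R _ _ _ this (hT 0 N (by omega)) ⟨fun _ _ => 0, fun _ => continuous_const, by simp⟩
  | succ n ih =>
    intro hn R hR
    have hlc : (Chebyshev.T ℝ (n+1:ℕ)).coeff (n+1) ≠ 0 := by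
      have h0 : (Chebyshev.T ℝ (n+1:ℕ)).natDegree = n + 1 := by
        rw [Chebyshev.natDegree_T]; rfl
      have h1 : Chebyshev.T ℝ (n+1:ℕ) ≠ 0 := by
        intro h; rw [h] at h0; simp at h0
      have := leadingCoeff_ne_zero.mpr h1
      rwa [leadingCoeff, h0] at this
    set a := R.coeff (n+1) / (Chebyshev.T ℝ (n+1:ℕ)).coeff (n+1) with ha
    refine comb R (Chebyshev.T ℝ (n+1:ℕ)) (R - C a * Chebyshev.T ℝ (n+1:ℕ)) a (by ring)
      (hT (n+1) N hn) (ih (by omega) _ ?_)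
    rw [natDegree_le_iff_coeff_eq_zero]
    intro i hi
    rcases eq_or_lt_of_le (Nat.succ_le_of_lt hi) with h | h
    · rw [Nat.succ_eq_add_one] at h
      rw [← h, coeff_sub, coeff_C_mul, ha]
      field_simp; ring
    · rw [coeff_sub, coeff_C_mul, coeff_eq_zero_of_natDegree_lt (by omega),
        coeff_eq_zero_of_natDegree_lt (p := Chebyshev.T ℝ (n+1:ℕ))]
      · simp
      · rw [Chebyshev.natDegree_T, Int.natAbs_natCast]; exact h

lemma fejer_upper (m : ℕ) (R : Polynomial ℝ)
    (hR : ∀ s : ℝ, (1 - Real.cos s) * R.eval (Real.cos s) = 1 - Real.cos (m * s))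
    (s : ℝ) (hs : 0 < s) (hsp : s ≤ Real.pi) :
    |R.eval (Real.cos s)| ≤ Real.pi ^ 2 / s ^ 2 := by
  have h1 := Real.cos_le_one_sub_mul_cos_sq (x := s) (by rw [abs_of_pos hs]; exact hsp)
  have h2 := hR s
  have hp := Real.pi_pos
  have h3 : 0 < 2 / Real.pi ^ 2 * s ^ 2 := by positivity
  have h4 : |R.eval (Real.cos s)| * (1 - Real.cos s) ≤ 2 := by
    have : |R.eval (Real.cos s)| * (1 - Real.cos s) = |(1 - Real.cos s) * R.eval (Real.cos s)| := by
      rw [abs_mul, abs_of_nonneg (by linarith [Real.cos_le_one s] : 0 ≤ 1 - Real.cos s), mul_comm]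
    rw [this, h2, abs_le]
    constructor <;> linarith [Real.cos_le_one (m * s), Real.neg_one_le_cos (m * s)]
  have h5 : |R.eval (Real.cos s)| * (2 / Real.pi ^ 2 * s ^ 2) ≤ 2 :=
    le_trans (mul_le_mul_of_nonneg_left (by linarith) (abs_nonneg _)) h4
  rw [le_div_iff₀ (by positivity)]
  have : |R.eval (Real.cos s)| * (2 / Real.pi ^ 2 * s ^ 2) =
    2 * (|R.eval (Real.cos s)| * s ^ 2) / Real.pi ^ 2 := by ring
  rw [this, div_le_iff₀ (by positivity)] at h5
  linarith

lemma fejer_lower (m : ℕ) (hm : 1 ≤ m) (R : Polynomial ℝ)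
    (hR : ∀ s : ℝ, (1 - Real.cos s) * R.eval (Real.cos s) = 1 - Real.cos (m * s))
    (s : ℝ) (hs : 0 < s) (hsp : s ≤ 1 / m) :
    4 / Real.pi ^ 2 * m ^ 2 ≤ R.eval (Real.cos s) := by
  have hm0 : (0:ℝ) < m := by exact_mod_cast hm
  have hms : m * s ≤ 1 := by rw [le_div_iff₀ hm0] at hsp; linarith
  have h1 := Real.cos_le_one_sub_mul_cos_sq (x := m * s)
    (by rw [abs_of_pos (by positivity)]; linarith [Real.pi_gt_three])
  have h2 := Real.one_sub_sq_div_two_le_cos (x := s)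
  have h3 := hR s
  have hs1 : s ≤ 1 := hsp.trans (by rw [div_le_one hm0]; exact_mod_cast hm)
  have h1' := Real.cos_le_one_sub_mul_cos_sq (x := s)
    (by rw [abs_of_pos (by positivity)]; linarith [Real.pi_gt_three])
  have hp := Real.pi_pos
  have h5 : 0 < 2 / Real.pi ^ 2 * s ^ 2 := by positivity
  by_contra! hc
  have h6 : (1 - Real.cos s) * R.eval (Real.cos s) < (1 - Real.cos s) * (4 / Real.pi ^ 2 * m ^ 2) :=
    mul_lt_mul_of_pos_left hc (by linarith)
  have h7 : (1 - Real.cos s) * (4 / Real.pi ^ 2 * m ^ 2) ≤ (s ^ 2 / 2) * (4 / Real.pi ^ 2 * m ^ 2) :=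
    mul_le_mul_of_nonneg_right (by linarith) (by positivity)
  have h8 : (s ^ 2 / 2) * (4 / Real.pi ^ 2 * m ^ 2) = 2 / Real.pi ^ 2 * (m * s) ^ 2 := by ring
  linarith

lemma inv_pow_integral (j : ℕ) (d : ℝ) (hd : 0 < d) (hdp : d ≤ Real.pi) :
    ∫ s in d..Real.pi, (1 / s ^ (j + 2)) ≤ 1 / d ^ (j + 1) := by
  have hp := Real.pi_pos
  have h0 : ∀ s ∈ uIcc d Real.pi, 0 < s := by
    intro s hs; rw [uIcc_of_le hdp] at hs; linarith [hs.1]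
  have h1 : ∫ s in d..Real.pi, (1 / s ^ (j + 2)) ≤ ∫ s in d..Real.pi, (1 / d ^ j) * (1 / s ^ 2) := by
    apply intervalIntegral.integral_mono_on hdp
    · apply ContinuousOn.intervalIntegrable
      exact continuousOn_const.div (by fun_prop) fun s hs => (pow_pos (h0 s hs) _).ne'
    · apply ContinuousOn.intervalIntegrable
      exact continuousOn_const.mul
        (continuousOn_const.div (by fun_prop) fun s hs => (pow_pos (h0 s hs) _).ne')
    · intro s hs
      have hs0 : 0 < s := by linarith [hs.1]
      rw [pow_add]
      have : d ^ j ≤ s ^ j := pow_le_pow_left₀ hd.le hs.1 j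
      rw [one_div_mul_one_div]
      apply one_div_le_one_div_of_le (by positivity)
      gcongr
  refine h1.trans ?_
  rw [intervalIntegral.integral_const_mul]
  have h2 : ∫ s in d..Real.pi, (1 / s ^ 2) = (-Real.pi⁻¹) - (-d⁻¹) := by
    apply intervalIntegral.integral_eq_sub_of_hasDerivAt (f := fun s => - s⁻¹)
    · intro s hs
      have := (hasDerivAt_inv (h0 s hs).ne').neg
      rw [neg_neg, ← one_div] at this
      exact this
    · apply ContinuousOn.intervalIntegrable
      exact continuousOn_const.div (by fun_prop) fun s hs => (pow_pos (h0 s hs) _).ne'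
  rw [h2]
  have h3 : (-Real.pi⁻¹) - (-d⁻¹) ≤ 1 / d := by
    have : 0 < Real.pi⁻¹ := by positivity
    rw [one_div]; linarith
  calc 1 / d ^ j * (-Real.pi⁻¹ - -d⁻¹) ≤ 1 / d ^ j * (1 / d) := by gcongr
    _ = _ := by rw [pow_succ]; field_simp

lemma kernel_tail (L m : ℕ) (R : Polynomial ℝ)
    (hR : ∀ s : ℝ, (1 - Real.cos s) * R.eval (Real.cos s) = 1 - Real.cos (m * s))
    (d : ℝ) (hd : 0 < d) (hdp : d ≤ Real.pi) :
    ∫ s in d..(2 * Real.pi - d), (R.eval (Real.cos s)) ^ (2 * L + 2) ≤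
      2 * Real.pi ^ (4 * L + 4) / d ^ (4 * L + 3) := by
  have hp := Real.pi_pos
  have hK : Continuous fun s : ℝ => (R.eval (Real.cos s)) ^ (2 * L + 2) := by fun_prop
  have hi : ∀ a b : ℝ, IntervalIntegrable (fun s : ℝ => (R.eval (Real.cos s)) ^ (2 * L + 2)) volume a b :=
    fun a b => hK.intervalIntegrable a b
  have h1 : ∫ s in d..Real.pi, (R.eval (Real.cos s)) ^ (2 * L + 2) ≤
      Real.pi ^ (4 * L + 4) / d ^ (4 * L + 3) := by
    calc _ ≤ ∫ s in d..Real.pi, Real.pi ^ (4 * L + 4) * (1 / s ^ (4 * L + 2 + 2)) := by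
          apply intervalIntegral.integral_mono_on hdp (hi _ _)
          · apply ContinuousOn.intervalIntegrable
            refine continuousOn_const.mul
              (continuousOn_const.div (by fun_prop) fun s hs => ?_)
            rw [uIcc_of_le hdp] at hs
            have : 0 < s := by linarith [hs.1]
            positivity
          · intro s hs
            have hs0 : 0 < s := by linarith [hs.1]
            have h2 := fejer_upper m R hR s hs0 hs.2
            have h3 : (R.eval (Real.cos s)) ^ (2 * L + 2) = |R.eval (Real.cos s)| ^ (2 * L + 2) := by
              rw [Even.pow_abs ⟨L + 1, by ring⟩]
            rw [h3]
            calc _ ≤ (Real.pi ^ 2 / s ^ 2) ^ (2 * L + 2) :=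
                  pow_le_pow_left₀ (abs_nonneg _) h2 _
              _ = _ := by rw [div_pow, ← pow_mul, ← pow_mul, mul_one_div]; ring_nf
      _ ≤ _ := by
          rw [intervalIntegral.integral_const_mul]
          have := inv_pow_integral (4 * L + 2) d hd hdp
          calc _ ≤ Real.pi ^ (4 * L + 4) * (1 / d ^ (4 * L + 2 + 1)) := by gcongr
            _ = _ := by rw [mul_one_div]
  have h2 : ∫ s in Real.pi..(2 * Real.pi - d), (R.eval (Real.cos s)) ^ (2 * L + 2) =
      ∫ s in d..Real.pi, (R.eval (Real.cos s)) ^ (2 * L + 2) := by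
    have := intervalIntegral.integral_comp_sub_left (a := d) (b := Real.pi)
      (fun s => (R.eval (Real.cos s)) ^ (2 * L + 2)) (2 * Real.pi)
    simp only [Real.cos_two_pi_sub] at this
    rw [this]; congr 1; ring
  rw [← intervalIntegral.integral_add_adjacent_intervals (hi d Real.pi) (hi _ _), h2]
  calc _ ≤ _ := add_le_add h1 h1
    _ = _ := by ring

lemma kernel_total (L m : ℕ) (hm : 1 ≤ m) (R : Polynomial ℝ)
    (hR : ∀ s : ℝ, (1 - Real.cos s) * R.eval (Real.cos s) = 1 - Real.cos (m * s)) :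
    (4 / Real.pi ^ 2) ^ (2 * L + 2) * m ^ (4 * L + 3) ≤
    ∫ s in (-Real.pi)..Real.pi, (R.eval (Real.cos s)) ^ (2 * L + 2) := by
  have hp := Real.pi_pos
  have hm0 : (0:ℝ) < m := by exact_mod_cast hm
  have hm1 : 1 / (m:ℝ) ≤ 1 := by rw [div_le_one hm0]; exact_mod_cast hm
  have hm2 : 0 < 1 / (m:ℝ) := by positivity
  have hK : Continuous fun s : ℝ => (R.eval (Real.cos s)) ^ (2 * L + 2) := by fun_prop
  have hn : ∀ s : ℝ, 0 ≤ (R.eval (Real.cos s)) ^ (2 * L + 2) := fun s =>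
    Even.pow_nonneg ⟨L + 1, by ring⟩ _
  calc _ = ∫ s in (0:ℝ)..(1 / m), (4 / Real.pi ^ 2 * m ^ 2) ^ (2 * L + 2) := by
        rw [intervalIntegral.integral_const, mul_pow, smul_eq_mul, sub_zero, ← pow_mul]
        have : (m:ℝ) ^ (2 * (2 * L + 2)) = m ^ (4 * L + 3) * m := by rw [← pow_succ]; ring_nf
        rw [this]; field_simp
    _ ≤ ∫ s in (0:ℝ)..(1 / m), (R.eval (Real.cos s)) ^ (2 * L + 2) := by
        apply intervalIntegral.integral_mono_on_of_le_Ioo hm2.le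
          intervalIntegrable_const (hK.intervalIntegrable _ _)
        intro s hs
        exact pow_le_pow_left₀ (by positivity) (fejer_lower m hm R hR s hs.1 hs.2.le) _
    _ ≤ _ := by
        apply intervalIntegral.integral_mono_interval (by linarith) hm2.le
          (by linarith [Real.pi_gt_three]) (Eventually.of_forall hn) (hK.intervalIntegrable _ _)

lemma step_trig (K : ℝ → ℝ) (hK : Continuous K) (hn : ∀ s, 0 ≤ K s)
    (hper : Function.Periodic K (2 * Real.pi)) (τ θ : ℝ) (hτ : τ ∈ Icc 0 Real.pi)
    (hθ : θ ∈ Icc 0 Real.pi) :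
    |(if θ ≤ τ then 1 else 0) * (∫ s in (-Real.pi)..Real.pi, K s) - ∫ s in (-τ)..τ, K (θ - s)| ≤
      ∫ s in |θ - τ|..(2 * Real.pi - |θ - τ|), K s := by
  have hi : ∀ a b : ℝ, IntervalIntegrable K volume a b := fun a b => hK.intervalIntegrable a b
  have hnn := Eventually.of_forall (f := ae (volume.restrict (Ioc |θ - τ| (2 * Real.pi - |θ - τ|)))) hn
  have h1 : ∫ s in (-τ)..τ, K (θ - s) = ∫ s in (θ - τ)..(θ + τ), K s := by
    rw [intervalIntegral.integral_comp_sub_left]; congr 1; ring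
  rw [h1]
  have h2 : ∫ s in (-Real.pi)..Real.pi, K s = ∫ s in (θ - τ)..(θ - τ + 2 * Real.pi), K s := by
    rw [← hper.intervalIntegral_add_eq (-Real.pi) (θ - τ)]; congr 1; ring
  split_ifs with h
  · rw [h2, one_mul, intervalIntegral.integral_interval_sub_left (hi _ _) (hi _ _),
      abs_of_nonneg (intervalIntegral.integral_nonneg (by linarith [hτ.2]) fun s _ => hn s)]
    rw [abs_of_nonpos (by linarith : θ - τ ≤ 0)] at *
    apply intervalIntegral.integral_mono_interval _ _ _ hnn (hi _ _)
    · linarith [hθ.1]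
    · linarith [hτ.2]
    · linarith
  · push Not at h
    rw [zero_mul, zero_sub, abs_neg,
      abs_of_nonneg (intervalIntegral.integral_nonneg (by linarith [hτ.1]) fun s _ => hn s)]
    rw [abs_of_pos (by linarith : 0 < θ - τ)] at *
    apply intervalIntegral.integral_mono_interval _ _ _ hnn (hi _ _)
    · linarith
    · linarith [hτ.1]
    · linarith [hθ.2]

lemma step_approx (L : ℕ) : ∃ C > (0:ℝ), ∀ m : ℕ, 1 ≤ m → ∃ c : ℕ → ℝ → ℝ,
    (∀ j, Continuous (c j)) ∧ ∀ t ∈ Icc (-1:ℝ) 1, ∀ x ∈ Icc (-1:ℝ) 1,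
    |(if t ≤ x then 1 else 0) - ∑ j ∈ Finset.range ((2 * L + 2) * m + 1), c j t * x ^ j| *
      (1 + |x - t| / (√(1 - t ^ 2) / m + 1 / (m:ℝ) ^ 2)) ^ L ≤ C := by
  have hp := Real.pi_pos
  set c0 : ℝ := (4 / Real.pi ^ 2) ^ (2 * L + 2) with hc0
  have hc0p : 0 < c0 := by positivity
  set A : ℝ := 2 * Real.pi ^ (4 * L + 4) / c0 with hA
  have hAp : 0 < A := by positivity
  refine ⟨2 ^ (4 * L + 3) * (1 + A), by positivity, fun m hm => ?_⟩
  have hm0 : (0:ℝ) < m := by exact_mod_cast hm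
  obtain ⟨R, hRd, hR⟩ := fejer_poly m
  set K : ℝ → ℝ := fun s => (R.eval (Real.cos s)) ^ (2 * L + 2) with hKdef
  have hK : Continuous K := by fun_prop
  have hn : ∀ s, 0 ≤ K s := fun s => Even.pow_nonneg ⟨L + 1, by ring⟩ _
  have hper : Function.Periodic K (2 * Real.pi) := by
    intro s; simp only [hKdef, Real.cos_add_two_pi]
  set I := ∫ s in (-Real.pi)..Real.pi, K s with hI
  have hI1 : c0 * m ^ (4 * L + 3) ≤ I := kernel_total L m hm R hR
  have hI0 : 0 < I := lt_of_lt_of_le (by positivity) hI1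
  obtain ⟨c, hc, hcs⟩ := conv_poly ((2 * L + 2) * m) (R ^ (2 * L + 2))
    ((Polynomial.natDegree_pow_le).trans (Nat.mul_le_mul_left _ hRd))
  refine ⟨fun j t => c j (Real.arccos t) / I, fun j => ((hc j).comp Real.continuous_arccos).div_const _,
    fun t ht x hx => ?_⟩
  set τ := Real.arccos t with hτ
  set θ := Real.arccos x with hθ
  have htτ : Real.cos τ = t := Real.cos_arccos ht.1 ht.2
  have hxθ : Real.cos θ = x := Real.cos_arccos hx.1 hx.2
  have hτI : τ ∈ Icc 0 Real.pi := ⟨Real.arccos_nonneg _, Real.arccos_le_pi _⟩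
  have hθI : θ ∈ Icc 0 Real.pi := ⟨Real.arccos_nonneg _, Real.arccos_le_pi _⟩
  have hiff : t ≤ x ↔ θ ≤ τ := by
    rw [← htτ, ← hxθ]
    exact Real.strictAntiOn_cos.le_iff_ge hτI hθI
  set d := |θ - τ| with hd
  have hd0 : 0 ≤ d := abs_nonneg _
  have hdp : d ≤ Real.pi := by
    rw [hd, abs_le]; constructor <;> linarith [hτI.1, hτI.2, hθI.1, hθI.2]
  have hst := step_trig K hK hn hper τ θ hτI hθI
  have hsum : ∑ j ∈ Finset.range ((2 * L + 2) * m + 1), c j τ / I * x ^ j =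
      (∫ s in (-τ)..τ, K (θ - s)) / I := by
    have := hcs τ θ
    simp only [Polynomial.eval_pow] at this
    rw [hKdef]
    simp only []
    rw [this, Finset.sum_div, hxθ]
    exact Finset.sum_congr rfl fun j _ => by ring
  simp only [] at hsum ⊢
  rw [hsum]
  simp only [hiff]
  set err := |(if θ ≤ τ then (1:ℝ) else 0) - (∫ s in (-τ)..τ, K (θ - s)) / I| with herr
  have herrI : err * I ≤ ∫ s in d..(2 * Real.pi - d), K s := by
    rw [herr, ← abs_of_pos hI0, ← abs_mul, abs_of_pos hI0, sub_mul, div_mul_cancel₀ _ hI0.ne']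
    exact hst
  have herr0 : 0 ≤ err := abs_nonneg _
  have herr1 : err ≤ 1 := by
    have h1 : ∫ s in d..(2 * Real.pi - d), K s ≤ I := by
      have h2 : I = ∫ s in (0:ℝ)..(2 * Real.pi), K s := by
        have := hper.intervalIntegral_add_eq (-Real.pi) 0
        rw [zero_add] at this
        rw [← this, hI]; congr 1; ring
      rw [h2]
      apply intervalIntegral.integral_mono_interval hd0 (by linarith) (by linarith)
        (Eventually.of_forall hn) (hK.intervalIntegrable _ _)
    have := herrI.trans h1
    exact le_of_mul_le_mul_right (by linarith) hI0
  have hmain : err * (1 + m * d) ^ (4 * L + 3) ≤ 2 ^ (4 * L + 3) * (1 + A) := by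
    rcases le_or_gt ((m:ℝ) * d) 1 with h | h
    · calc _ ≤ 1 * (2:ℝ) ^ (4 * L + 3) := by
            apply mul_le_mul herr1 _ (by positivity) zero_le_one
            apply pow_le_pow_left₀ (by positivity); linarith
        _ ≤ _ := by
            have : (0:ℝ) < 2 ^ (4 * L + 3) := by positivity
            nlinarith
    · have hdpos : 0 < d := by
        by_contra! hcon
        have : d = 0 := le_antisymm hcon hd0
        rw [this] at h; simp at h; linarith
      have h1 := kernel_tail L m R hR d hdpos hdp
      have h2 : err * (c0 * m ^ (4 * L + 3)) ≤ 2 * Real.pi ^ (4 * L + 4) / d ^ (4 * L + 3) :=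
        (mul_le_mul_of_nonneg_left hI1 herr0).trans (herrI.trans h1)
      rw [le_div_iff₀ (by positivity)] at h2
      have h3 : err * (m * d) ^ (4 * L + 3) ≤ A := by
        rw [hA, le_div_iff₀ hc0p, mul_pow]; linarith
      calc _ ≤ err * (2 * (m * d)) ^ (4 * L + 3) := by
            apply mul_le_mul_of_nonneg_left _ herr0
            apply pow_le_pow_left₀ (by positivity); linarith
        _ = 2 ^ (4 * L + 3) * (err * (m * d) ^ (4 * L + 3)) := by rw [mul_pow]; ring
        _ ≤ _ := by gcongr; linarith
  refine le_trans ?_ hmain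
  apply mul_le_mul_of_nonneg_left _ herr0
  set ρ := √(1 - t ^ 2) / m + 1 / (m:ℝ) ^ 2 with hρ
  have hρ0 : 0 < ρ := by positivity
  have hsin : √(1 - t ^ 2) = Real.sin τ := by rw [hτ, Real.sin_arccos]
  have hsin0 : 0 ≤ Real.sin τ := Real.sin_nonneg_of_nonneg_of_le_pi hτI.1 hτI.2
  have hxt : |x - t| ≤ Real.sin τ * d + d ^ 2 / 2 := by
    have h1 : x - t = Real.cos τ * (Real.cos (θ - τ) - 1) - Real.sin τ * Real.sin (θ - τ) := by
      rw [← hxθ]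
      conv_lhs => rw [show θ = τ + (θ - τ) by ring, Real.cos_add, ← htτ]
      ring
    rw [h1]
    refine (abs_sub _ _).trans ?_
    rw [abs_mul, abs_mul, abs_of_nonneg hsin0]
    have h2 : |Real.sin (θ - τ)| ≤ d := Real.abs_sin_le_abs
    have h3 : |Real.cos (θ - τ) - 1| ≤ d ^ 2 / 2 := by
      rw [abs_sub_comm, abs_of_nonneg (by linarith [Real.cos_le_one (θ - τ)]), hd, sq_abs]
      linarith [Real.one_sub_sq_div_two_le_cos (x := θ - τ)]
    have h4 := Real.abs_cos_le_one τ
    have := mul_le_mul_of_nonneg_left h2 hsin0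
    have h5 : |Real.cos τ| * |Real.cos (θ - τ) - 1| ≤ 1 * (d ^ 2 / 2) :=
      mul_le_mul h4 h3 (abs_nonneg _) zero_le_one
    linarith
  have hq : |x - t| / ρ ≤ m * d + (m * d) ^ 2 / 2 := by
    rw [div_le_iff₀ hρ0]
    refine hxt.trans ?_
    rw [hρ, hsin]
    have e1 : Real.sin τ * d = (m * d) * (Real.sin τ / m) := by field_simp
    have e2 : d ^ 2 / 2 = ((m * d) ^ 2 / 2) * (1 / (m:ℝ) ^ 2) := by field_simp
    rw [e1, e2]
    have p1 : 0 ≤ Real.sin τ / m := by positivity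
    have p2 : 0 ≤ 1 / (m:ℝ) ^ 2 := by positivity
    have p3 : 0 ≤ (m:ℝ) * d := by positivity
    nlinarith [mul_nonneg p3 p2, mul_nonneg (sq_nonneg ((m:ℝ) * d)) p1]
  have hmd : 0 ≤ (m:ℝ) * d := by positivity
  calc (1 + |x - t| / ρ) ^ L ≤ ((1 + m * d) ^ 2) ^ L := by
        apply pow_le_pow_left₀ (by positivity); nlinarith
    _ = (1 + m * d) ^ (2 * L) := by rw [← pow_mul]
    _ ≤ _ := pow_le_pow_right₀ (by linarith) (by omega)

open Polynomial in
lemma cheb_ind (N : ℕ) (p : ℝ[X] → Prop) (h0 : p 0) (hT : ∀ j ≤ N, p (Chebyshev.T ℝ (j:ℕ)))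
    (hl : ∀ (a : ℝ) (A B : ℝ[X]), p A → p B → p (C a * A + B)) :
    ∀ R : ℝ[X], R.natDegree ≤ N → p R := by
  suffices H : ∀ n ≤ N, ∀ R : ℝ[X], R.natDegree ≤ n → p R from H N le_rfl
  intro n
  induction n with
  | zero =>
    intro _ R hR
    have : R = C (R.coeff 0) * Chebyshev.T ℝ (0:ℕ) + 0 := by
      simp; exact eq_C_of_natDegree_le_zero hR
    rw [this]
    exact hl _ _ _ (hT 0 (by omega)) h0
  | succ n ih =>
    intro hn R hR
    have hlc : (Chebyshev.T ℝ (n+1:ℕ)).coeff (n+1) ≠ 0 := by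
      have h0 : (Chebyshev.T ℝ (n+1:ℕ)).natDegree = n + 1 := by
        rw [Chebyshev.natDegree_T]; rfl
      have h1 : Chebyshev.T ℝ (n+1:ℕ) ≠ 0 := by
        intro h; rw [h] at h0; simp at h0
      have := leadingCoeff_ne_zero.mpr h1
      rwa [leadingCoeff, h0] at this
    set a := R.coeff (n+1) / (Chebyshev.T ℝ (n+1:ℕ)).coeff (n+1) with ha
    have e : R = C a * Chebyshev.T ℝ (n+1:ℕ) + (R - C a * Chebyshev.T ℝ (n+1:ℕ)) := by ring
    rw [e]
    refine hl _ _ _ (hT (n+1) hn) (ih (by omega) _ ?_)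
    rw [natDegree_le_iff_coeff_eq_zero]
    intro i hi
    rcases eq_or_lt_of_le (Nat.succ_le_of_lt hi) with h | h
    · rw [Nat.succ_eq_add_one] at h
      rw [← h, coeff_sub, coeff_C_mul, ha]
      field_simp; ring
    · rw [coeff_sub, coeff_C_mul, coeff_eq_zero_of_natDegree_lt (by omega),
        coeff_eq_zero_of_natDegree_lt (p := Chebyshev.T ℝ (n+1:ℕ))]
      · simp
      · rw [Chebyshev.natDegree_T, Int.natAbs_natCast]; exact h

def DirK (m : ℕ) (s : ℝ) : ℝ := 1 + 2 * ∑ l ∈ Finset.range m, Real.cos ((l + 1 : ℕ) * s)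

def FejK (m : ℕ) (s : ℝ) : ℝ := ∑ i ∈ Finset.range m, DirK i s

lemma DirK_cont (m : ℕ) : Continuous (DirK m) := by unfold DirK; fun_prop
lemma FejK_cont (m : ℕ) : Continuous (FejK m) := by
  unfold FejK; exact continuous_finsetSum _ fun i _ => DirK_cont i

lemma FejK_sq (m : ℕ) (s : ℝ) : FejK m s = (∑ i ∈ Finset.range m, Real.cos (i * s)) ^ 2 +
    (∑ i ∈ Finset.range m, Real.sin (i * s)) ^ 2 := by
  induction m with
  | zero => simp [FejK]
  | succ m ih =>
    rw [FejK, Finset.sum_range_succ]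
    change FejK m s + _ = _
    rw [ih, Finset.sum_range_succ, Finset.sum_range_succ]
    have h : ∑ l ∈ Finset.range m, Real.cos ((l + 1 : ℕ) * s) =
        (∑ i ∈ Finset.range m, Real.cos (i * s)) * Real.cos (m * s) +
        (∑ i ∈ Finset.range m, Real.sin (i * s)) * Real.sin (m * s) := by
      rw [← Finset.sum_range_reflect, Finset.sum_mul, Finset.sum_mul, ← Finset.sum_add_distrib]
      refine Finset.sum_congr rfl fun i hi => ?_
      have hi := Finset.mem_range.mp hi
      have : ((m - 1 - i + 1 : ℕ) : ℝ) = m - i := by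
        rw [eq_sub_iff_add_eq]; norm_cast; omega
      rw [this, sub_mul, Real.cos_sub]; ring
    rw [DirK, h]
    nlinarith [Real.sin_sq_add_cos_sq ((m:ℝ) * s)]

lemma FejK_nonneg (m : ℕ) (s : ℝ) : 0 ≤ FejK m s := by rw [FejK_sq]; positivity

lemma FejK_le (m : ℕ) (s : ℝ) : FejK m s ≤ (m:ℝ)^2 := by
  rw [FejK]
  have : ∀ i ∈ Finset.range m, DirK i s ≤ (2 * (i:ℝ) + 1) := by
    intro i _
    have : ∑ l ∈ Finset.range i, Real.cos ((l + 1 : ℕ) * s) ≤ ∑ l ∈ Finset.range i, (1:ℝ) :=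
      Finset.sum_le_sum fun l _ => Real.cos_le_one _
    simp at this
    rw [DirK]; push_cast; linarith
  refine (Finset.sum_le_sum this).trans (le_of_eq ?_)
  clear this
  induction m with
  | zero => simp
  | succ m ih => rw [Finset.sum_range_succ, ih]; push_cast; ring

lemma int_cos_nat (j : ℕ) (hj : 1 ≤ j) : ∫ s in (-Real.pi)..Real.pi, Real.cos (j * s) = 0 := by
  have : (j:ℝ) ≠ 0 := by positivity
  rw [intervalIntegral.integral_comp_mul_left (fun x => Real.cos x) this, integral_cos]
  simp [Real.sin_nat_mul_pi]

lemma int_cos_mul (l j : ℕ) (hj : 1 ≤ j) :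
    ∫ s in (-Real.pi)..Real.pi, Real.cos (l * s) * Real.cos (j * s) = if l = j then Real.pi else 0 := by
  have h : ∀ s : ℝ, Real.cos (l * s) * Real.cos (j * s) =
      (1/2) * Real.cos ((l + j : ℕ) * s) + (1/2) * Real.cos (((Int.natAbs (l - j) : ℕ) : ℝ) * s) := by
    intro s
    have h2 : Real.cos (((Int.natAbs (l - j) : ℕ) : ℝ) * s) = Real.cos (l * s - j * s) := by
      have : ((Int.natAbs (l - j) : ℕ) : ℝ) = |(l:ℝ) - j| := by
        rw [Nat.cast_natAbs]; push_cast; rfl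
      rw [this]
      rcases abs_choice ((l:ℝ) - j) with h | h <;> rw [h]
      · ring_nf
      · rw [← Real.cos_neg]; ring_nf
    rw [h2]; push_cast; rw [add_mul, Real.cos_add, Real.cos_sub]; ring
  simp_rw [h]
  rw [intervalIntegral.integral_add, intervalIntegral.integral_const_mul,
    intervalIntegral.integral_const_mul, int_cos_nat _ (by omega)]
  · split_ifs with hlj
    · subst hlj; simp; ring
    · rw [int_cos_nat _ (by omega)]; simp
  · exact (by fun_prop : Continuous _).intervalIntegrable _ _
  · exact (by fun_prop : Continuous _).intervalIntegrable _ _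

lemma int_cos_DirK (l i : ℕ) : ∫ s in (-Real.pi)..Real.pi, Real.cos (l * s) * DirK i s =
    if l ≤ i then 2 * Real.pi else 0 := by
  unfold DirK
  have h : ∀ s : ℝ, Real.cos (l * s) * (1 + 2 * ∑ j ∈ Finset.range i, Real.cos ((j + 1 : ℕ) * s)) =
    Real.cos (l * s) + 2 * ∑ j ∈ Finset.range i, Real.cos (l * s) * Real.cos ((j + 1 : ℕ) * s) := by
    intro s; rw [← Finset.mul_sum]; ring
  simp_rw [h]
  rw [intervalIntegral.integral_add, intervalIntegral.integral_const_mul,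
    intervalIntegral.integral_finsetSum]
  · simp_rw [fun x : ℕ => int_cos_mul l (x+1) (Nat.succ_le_succ (Nat.zero_le _))]
    rcases Nat.eq_zero_or_pos l with rfl | hl
    · simp; ring
    · rw [int_cos_nat l hl]
      obtain ⟨l', rfl⟩ : ∃ l', l = l' + 1 := ⟨l - 1, by omega⟩
      simp only [Nat.succ_eq_add_one, Nat.add_right_cancel_iff, Finset.sum_ite_eq, Finset.mem_range, Nat.succ_le_iff]
      split_ifs <;> ring
  · intro j _
    exact (by fun_prop : Continuous _).intervalIntegrable _ _
  · exact (by fun_prop : Continuous _).intervalIntegrable _ _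
  · exact (by fun_prop : Continuous _).intervalIntegrable _ _

lemma int_cos_FejK (l m : ℕ) (h : l ≤ m) : ∫ s in (-Real.pi)..Real.pi, Real.cos (l * s) * FejK m s =
    2 * Real.pi * (m - l) := by
  unfold FejK
  simp_rw [Finset.mul_sum]
  rw [intervalIntegral.integral_finsetSum]
  · simp_rw [int_cos_DirK]
    induction m, h using Nat.le_induction with
    | base => 
      rw [Finset.sum_eq_zero]; · simp
      intro i hi
      rw [if_neg]; simpa using hi
    | succ m hm ih => rw [Finset.sum_range_succ, ih, if_pos hm]; push_cast; ring
  · intro j _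
    exact ((by fun_prop : Continuous fun s : ℝ => Real.cos (l * s)).mul (DirK_cont j)).intervalIntegrable _ _

open Polynomial in
lemma vp (n : ℕ) (hn : 1 ≤ n) : ∃ V : ℝ → ℝ, Continuous V ∧ (∀ s, V (-s) = V s) ∧
    (∀ s, |V s| ≤ n) ∧ (∫ s in (-Real.pi)..Real.pi, |V s|) ≤ 3 ∧
    ∀ R : ℝ[X], R.natDegree ≤ n → ∫ s in (-Real.pi)..Real.pi, R.eval (Real.cos s) * V s = R.eval 1 := by
  have hn0 : (0:ℝ) < n := by positivity
  have hpi := Real.pi_gt_three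
  set V : ℝ → ℝ := fun s => (2 * Real.pi * n)⁻¹ * (FejK (2*n) s - FejK n s) with hV
  have hVc : Continuous V := continuous_const.mul ((FejK_cont _).sub (FejK_cont _))
  refine ⟨V, hVc, ?_, ?_, ?_, ?_⟩
  · intro s; simp [hV, FejK, DirK]
  · intro s
    have h1 := FejK_nonneg (2*n) s
    have h2 := FejK_nonneg n s
    have h3 := FejK_le (2*n) s
    have h4 := FejK_le n s
    push_cast at h3
    rw [hV]; dsimp only
    rw [abs_mul, abs_of_pos (by positivity), inv_mul_le_iff₀ (by positivity), abs_le]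
    constructor <;> nlinarith [mul_pos hn0 hn0]
  · have hb : ∀ s, |V s| ≤ (2 * Real.pi * n)⁻¹ * (FejK (2*n) s + FejK n s) := by
      intro s
      rw [hV]; dsimp only
      rw [abs_mul, abs_of_pos (by positivity)]
      have h1 := FejK_nonneg (2*n) s
      have h2 := FejK_nonneg n s
      gcongr
      rw [abs_le]; constructor <;> linarith
    have hi : ∀ m, ∫ s in (-Real.pi)..Real.pi, FejK m s = 2 * Real.pi * m := by
      intro m; have := int_cos_FejK 0 m (by omega); simpa using this
    calc _ ≤ ∫ s in (-Real.pi)..Real.pi, (2 * Real.pi * n)⁻¹ * (FejK (2*n) s + FejK n s) := by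
          apply intervalIntegral.integral_mono_on (by linarith)
          · exact hVc.abs.intervalIntegrable _ _
          · exact (continuous_const.mul ((FejK_cont _).add (FejK_cont _))).intervalIntegrable _ _
          · intro s _; exact hb s
      _ = 3 := by
          rw [intervalIntegral.integral_const_mul, intervalIntegral.integral_add
            ((FejK_cont _).intervalIntegrable _ _) ((FejK_cont _).intervalIntegrable _ _), hi, hi]
          push_cast; field_simp; ring
      _ ≤ 3 := le_rfl
  · apply cheb_ind n
    · simp
    · intro j hj
      simp_rw [Chebyshev.T_real_cos]
      have : ∀ s : ℝ, Real.cos (((j:ℕ):ℤ) * s) * V s = (2 * Real.pi * n)⁻¹ *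
        (Real.cos (j * s) * FejK (2*n) s - Real.cos (j * s) * FejK n s) := by
        intro s; rw [hV]; push_cast; ring
      simp_rw [this]
      have hcj : ∀ m, Continuous fun s : ℝ => Real.cos (j * s) * FejK m s := fun m =>
        (by fun_prop : Continuous fun s : ℝ => Real.cos (j * s)).mul (FejK_cont m)
      rw [intervalIntegral.integral_const_mul, intervalIntegral.integral_sub
        ((hcj _).intervalIntegrable _ _) ((hcj _).intervalIntegrable _ _),
        int_cos_FejK _ _ (by omega), int_cos_FejK _ _ hj, Chebyshev.T_eval_one]
      push_cast; field_simp; ring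
    · intro a A B hA hB
      simp only [eval_add, eval_mul, eval_C, add_mul]
      rw [intervalIntegral.integral_add, hB]
      · simp_rw [mul_assoc]
        rw [intervalIntegral.integral_const_mul, hA]
      · exact (by fun_prop : Continuous _).intervalIntegrable _ _
      · exact (by fun_prop : Continuous _).intervalIntegrable _ _

lemma op_norm (q : ℝ≥0∞) (hq : 1 ≤ q) (hqt : q ≠ ∞) (μ : Measure ℝ) [SFinite μ] (V : ℝ → ℝ)
    (hV : Continuous V) (hV3 : (∫ s in (-Real.pi)..Real.pi, |V s|) ≤ 3)
    (e : ℝ → ℝ → ℝ) (he : Measurable (Function.uncurry e)) (c : ℝ) (hc : 0 < c)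
    (h : ∀ s, eLpNorm (fun x => e x s) q μ ≤ ENNReal.ofReal c)
    (G : ℝ → ℝ) (hG : ∀ᵐ x ∂μ, G x = ∫ s in (-Real.pi)..Real.pi, e x s * V s) :
    eLpNorm G q μ ≤ ENNReal.ofReal (3 * c) := by
  have hq0 : q ≠ 0 := (lt_of_lt_of_le one_pos hq).ne'
  have hQ1 : 1 ≤ q.toReal := by
    rw [← ENNReal.toReal_one]; exact ENNReal.toReal_mono hqt hq
  have hQ0 : 0 < q.toReal := by linarith
  set Q := q.toReal with hQd
  set ν := (volume.restrict (Ioc (-Real.pi) Real.pi)).withDensity (fun s => ‖V s‖ₑ) with hν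
  have hVm : Measurable (fun s => ‖V s‖ₑ) := hV.measurable.enorm
  have hpi := Real.pi_pos
  have htot : ∫⁻ s in Ioc (-Real.pi) Real.pi, ‖V s‖ₑ ≤ 3 := by
    rw [intervalIntegral.integral_of_le (by linarith)] at hV3
    have h1 := ofReal_integral_eq_lintegral_ofReal (μ := volume.restrict (Ioc (-Real.pi) Real.pi))
      (f := fun s => |V s|) ((hV.abs.integrableOn_Icc).mono_set Ioc_subset_Icc_self)
      (Eventually.of_forall fun s => abs_nonneg _)
    have h2 : ∀ s, ‖V s‖ₑ = ENNReal.ofReal |V s| := fun s => Real.enorm_eq_ofReal_abs _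
    simp_rw [h2]
    rw [← h1]
    calc _ ≤ ENNReal.ofReal 3 := ENNReal.ofReal_le_ofReal hV3
      _ = 3 := by norm_num
  have : IsFiniteMeasure ν := by
    apply isFiniteMeasure_withDensity
    exact (lt_of_le_of_lt htot (by norm_num)).ne
  have hem : Measurable (Function.uncurry fun x s => ‖e x s‖ₑ) := he.enorm
  have key := mink μ ν Q hQ1 (fun x s => ‖e x s‖ₑ) hem (fun _ => ENNReal.ofReal c)
    measurable_const (fun _ => by simpa using hc) (fun _ => by simp) (by
      refine Eventually.of_forall fun s => ?_
      have := h s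
      rw [eLpNorm_eq_lintegral_rpow_enorm_toReal hq0 hqt] at this
      rwa [one_div, ENNReal.rpow_inv_le_iff hQ0] at this)
  rw [eLpNorm_eq_lintegral_rpow_enorm_toReal hq0 hqt, one_div, ENNReal.rpow_inv_le_iff hQ0]
  calc _ ≤ ∫⁻ x, (∫⁻ s, ‖e x s‖ₑ ∂ν) ^ Q ∂μ := by
        apply lintegral_mono_ae
        filter_upwards [hG] with x hx
        apply ENNReal.rpow_le_rpow _ hQ0.le
        rw [hx, intervalIntegral.integral_of_le (by linarith)]
        refine (enorm_integral_le_lintegral_enorm _).trans (le_of_eq ?_)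
        rw [hν, lintegral_withDensity_eq_lintegral_mul _ hVm hem.of_uncurry_left]
        apply lintegral_congr
        intro s
        rw [enorm_mul, mul_comm]; rfl
    _ ≤ _ := key
    _ ≤ _ := by
        apply ENNReal.rpow_le_rpow _ hQ0.le
        rw [lintegral_const, hν, withDensity_apply _ MeasurableSet.univ, Measure.restrict_univ]
        calc _ ≤ ENNReal.ofReal c * 3 := by gcongr
          _ = _ := by rw [mul_comm, ENNReal.ofReal_mul (by norm_num)]; norm_num

lemma jacobi_meas (α β : ℝ) : Measurable (jacobi α β) := by unfold jacobi; fun_prop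

lemma jacobi_nonneg (α β : ℝ) {x : ℝ} (hx : x ∈ Icc (-1:ℝ) 1) : 0 ≤ jacobi α β x := by
  have h1 : 0 ≤ 1 + x := by linarith [hx.1]
  have h2 : 0 ≤ 1 - x := by linarith [hx.2]
  unfold jacobi; positivity

lemma kMon_smul (k : ℕ) (f : ℝ → ℝ) (c : ℝ) (hc : 0 ≤ c) (hf : kMonotoneOn k f) :
    kMonotoneOn k (fun x => c * f x) := by
  intro x hx hx'
  have := hf x hx hx'
  simp_rw [mul_div_assoc]
  rw [← Finset.mul_sum]; positivity

lemma eclass_lower (k : ℕ) (p q : ℝ≥0∞) (α β : ℝ) (n : ℕ) (f : ℝ → ℝ) (hf : Measurable f)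
    (hk : kMonotoneOn k f) (A c : ℝ) (hA : 0 < A) (hc : 0 < c)
    (h1 : LpOn (fun x => jacobi α β x * f x) p (-1) 1 ≤ ENNReal.ofReal A)
    (h0 : LpOn (fun x => jacobi α β x * f x) p (-1) 1 ≠ 0)
    (h2 : ∀ P : Polynomial ℝ, P.natDegree ≤ n → ENNReal.ofReal (c * A) ≤
      LpOn (fun x => jacobi α β x * (f x - P.eval x)) q (-1) 1) :
    ENNReal.ofReal c ≤ EClass (MSet k ∩ BSet p α β) n (jacobi α β) q := by
  set B := (LpOn (fun x => jacobi α β x * f x) p (-1) 1).toReal with hB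
  have hBt : LpOn (fun x => jacobi α β x * f x) p (-1) 1 ≠ ∞ := (h1.trans_lt ENNReal.ofReal_lt_top).ne
  have hB0 : 0 < B := ENNReal.toReal_pos h0 hBt
  have hBA : B ≤ A := ENNReal.toReal_le_of_le_ofReal hA.le h1
  have hfB : (fun x => B⁻¹ * f x) ∈ MSet k ∩ BSet p α β := by
    refine ⟨kMon_smul k f _ (by positivity) hk, hf.const_mul _, ?_⟩
    have : (fun x => jacobi α β x * (B⁻¹ * f x)) = B⁻¹ • (fun x => jacobi α β x * f x) := by
      ext x; simp; ring
    rw [this, LpOn, eLpNorm_const_smul]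
    change _ * LpOn (fun x => jacobi α β x * f x) p (-1) 1 = 1
    rw [← ENNReal.ofReal_toReal hBt, ← hB, Real.enorm_eq_ofReal_abs, abs_of_pos (by positivity),
      ← ENNReal.ofReal_mul (by positivity), inv_mul_cancel₀ hB0.ne', ENNReal.ofReal_one]
  refine le_trans ?_ (le_iSup₂ (f := fun f (_ : f ∈ MSet k ∩ BSet p α β) => En n f (jacobi α β) q) _ hfB)
  refine le_iInf₂ fun P hP => ?_
  have h3 := h2 (Polynomial.C B * P) ((Polynomial.natDegree_C_mul_le _ _).trans hP)
  have : (fun x => jacobi α β x * (B⁻¹ * f x - P.eval x)) =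
      B⁻¹ • (fun x => jacobi α β x * (f x - (Polynomial.C B * P).eval x)) := by
    ext x; simp; field_simp
  rw [this, LpOn, eLpNorm_const_smul]
  calc ENNReal.ofReal c ≤ ENNReal.ofReal (B⁻¹ * (c * A)) := by
        apply ENNReal.ofReal_le_ofReal
        rw [inv_mul_eq_div, le_div_iff₀ hB0]; gcongr
    _ = ‖B⁻¹‖ₑ * ENNReal.ofReal (c * A) := by
        rw [ENNReal.ofReal_mul (by positivity), Real.enorm_eq_ofReal_abs, abs_of_pos (by positivity)]
    _ ≤ _ := by gcongr; exact h3

/-- divided differences of powers are nonnegative -/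
lemma dd_pow (k : ℕ) (x : Fin (k+1) → ℝ) (hx : Function.Injective x) (h0 : ∀ i, 0 ≤ x i) (N : ℕ) :
    0 ≤ ∑ i, (x i)^N / ∏ j ∈ Finset.univ.erase i, (x i - x j) := by
  induction k generalizing N with
  | zero => simp; exact pow_nonneg (h0 _) _
  | succ k ihk =>
    induction N with
    | zero =>
      have hs := Lagrange.sum_basis (F := ℝ) (s := (Finset.univ : Finset (Fin (k+1+1)))) (v := x)
        hx.injOn Finset.univ_nonempty
      have := congrArg (fun P => Polynomial.coeff P (k+1)) hs
      simp only [Polynomial.finsetSum_coeff, Polynomial.coeff_one] at this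
      rw [if_neg (by omega)] at this
      refine le_of_eq ?_
      rw [← this]
      refine Finset.sum_congr rfl fun i _ => ?_
      have h1 : (Lagrange.basis Finset.univ x i).natDegree = k + 1 := by
        have := Lagrange.degree_basis (F := ℝ) (s := (Finset.univ : Finset (Fin (k+1+1)))) (v := x)
          hx.injOn (Finset.mem_univ i)
        rw [Polynomial.natDegree_eq_of_degree_eq_some this]; simp
      have h2 : (Lagrange.basis Finset.univ x i).coeff (k+1) =
          (Lagrange.basis Finset.univ x i).leadingCoeff := by rw [Polynomial.leadingCoeff, h1]
      rw [h2, Lagrange.basis, Polynomial.leadingCoeff_prod]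
      simp only [Lagrange.basisDivisor]
      rw [pow_zero, one_div, ← Finset.prod_inv_distrib]
      refine Finset.prod_congr rfl fun j _ => ?_
      rw [Polynomial.leadingCoeff_mul, Polynomial.leadingCoeff_C, Polynomial.leadingCoeff_X_sub_C, mul_one]
    | succ N ihN =>
      have hsplit : ∑ i, (x i)^(N+1) / ∏ j ∈ Finset.univ.erase i, (x i - x j) =
          x 0 * ∑ i, (x i)^N / ∏ j ∈ Finset.univ.erase i, (x i - x j) +
          ∑ i, (x i - x 0) * (x i)^N / ∏ j ∈ Finset.univ.erase i, (x i - x j) := by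
        rw [Finset.mul_sum, ← Finset.sum_add_distrib]
        refine Finset.sum_congr rfl fun i _ => by ring
      rw [hsplit]
      apply add_nonneg (mul_nonneg (h0 0) ihN)
      rw [Fin.sum_univ_succ]
      simp only [sub_self, zero_mul, zero_div, zero_add]
      have := ihk (fun i => x i.succ) (hx.comp (Fin.succ_injective _)) (fun i => h0 _) N
      refine this.trans (le_of_eq (Finset.sum_congr rfl fun i _ => ?_))
      have hne : x i.succ - x 0 ≠ 0 := sub_ne_zero.mpr fun h => (Fin.succ_ne_zero i) (hx h)
      have hu : (Finset.univ.erase i.succ : Finset (Fin (k+1+1))) =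
          insert 0 ((Finset.univ.erase i).map (Fin.succEmb (k+1))) := by
        ext j
        refine Fin.cases ?_ (fun j => ?_) j
        · simp [Ne.symm (Fin.succ_ne_zero i)]
        · simp [Fin.succ_ne_zero]
      rw [hu, Finset.prod_insert (by simp [Fin.succ_ne_zero]), Finset.prod_map, mul_div_mul_left _ _ hne]
      rfl

lemma kMon_pow (k N : ℕ) : kMonotoneOn k (fun x => (1+x)^N) := by
  intro x hx hx'
  have := dd_pow k (fun i => 1 + x i) (fun i j h => hx (by simpa using h))
    (fun i => by have := (hx' i).1; linarith) N
  simpa using this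

lemma lint_affine (F : ℝ → ℝ≥0∞) (hF : Measurable F) (s t : ℝ) (hs : 0 < s) :
    ∫⁻ x, F (s * x + t) = ENNReal.ofReal s⁻¹ * ∫⁻ x, F x := by
  have h1 : ∫⁻ x, F (s * x + t) = ∫⁻ y, F (y + t) ∂(Measure.map (s * ·) volume) := by
    rw [lintegral_map (by fun_prop) (by fun_prop)]
  rw [h1, Real.map_volume_mul_left hs.ne', lintegral_smul_measure, lintegral_add_right_eq_self,
    abs_of_pos (by positivity)]
  rfl

lemma dil_norm (q : ℝ≥0∞) (hq : 1 ≤ q) (hqt : q ≠ ∞) (α β : ℝ) (hα : 0 ≤ α) (hβ : 0 ≤ β)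
    (h : ℝ → ℝ) (hh : Measurable h) (s : ℝ) (hs : s ∈ Icc (1/2:ℝ) 1) :
    eLpNorm (fun x => jacobi α β x * h (s * (1 + x) - 1)) q (volume.restrict (Icc (-1) 1)) ≤
    ENNReal.ofReal (2 * 2 ^ α) *
      eLpNorm (fun x => jacobi α β x * h x) q (volume.restrict (Icc (-1) 1)) := by
  have hq0 : q ≠ 0 := (lt_of_lt_of_le one_pos hq).ne'
  have hQ1 : 1 ≤ q.toReal := by
    rw [← ENNReal.toReal_one]; exact ENNReal.toReal_mono hqt hq
  have hQ0 : 0 < q.toReal := by linarith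
  have hs0 : 0 < s := by linarith [hs.1]
  set F : ℝ → ℝ≥0∞ := (Icc (-1:ℝ) 1).indicator (fun x => ‖jacobi α β x * h x‖ₑ ^ q.toReal) with hF
  have hFm : Measurable F := by
    apply Measurable.indicator _ measurableSet_Icc
    exact (((jacobi_meas α β).mul hh).enorm).pow_const _
  have hb : ∀ x ∈ Icc (-1:ℝ) 1, ‖jacobi α β x * h (s * (1 + x) - 1)‖ₑ ^ q.toReal ≤
      ENNReal.ofReal (2^α) ^ q.toReal * F (s * x + (s - 1)) := by
    intro x hx
    have hy : s * x + (s - 1) ∈ Icc (-1:ℝ) 1 := by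
      constructor <;> nlinarith [hx.1, hx.2, hs.1, hs.2]
    have e : s * (1 + x) - 1 = s * x + (s - 1) := by ring
    rw [hF, indicator_of_mem hy, ← ENNReal.mul_rpow_of_nonneg _ _ hQ0.le, e]
    apply ENNReal.rpow_le_rpow _ hQ0.le
    rw [enorm_mul, enorm_mul, ← mul_assoc]
    gcongr
    rw [Real.enorm_eq_ofReal_abs, Real.enorm_eq_ofReal_abs, ← ENNReal.ofReal_mul (by positivity),
      abs_of_nonneg (jacobi_nonneg _ _ hx), abs_of_nonneg (jacobi_nonneg _ _ hy)]
    apply ENNReal.ofReal_le_ofReal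
    unfold jacobi
    have h1 : (1 + x)^α ≤ 2^α * (1 + (s * x + (s - 1)))^α := by
      rw [← Real.mul_rpow (by norm_num) (by nlinarith [hx.1])]
      apply Real.rpow_le_rpow (by linarith [hx.1]) _ hα
      nlinarith [hx.1, hs.1]
    have h2 : (1 - x)^β ≤ (1 - (s * x + (s - 1)))^β := by
      apply Real.rpow_le_rpow (by linarith [hx.2]) _ hβ
      nlinarith [hx.1, hs.2]
    rw [← mul_assoc]
    have : 0 ≤ (1 - x)^β := Real.rpow_nonneg (by linarith [hx.2]) _
    have h3 : 0 ≤ (1 + x)^α := Real.rpow_nonneg (by linarith [hx.1]) _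
    exact mul_le_mul h1 h2 this (h3.trans h1)
  rw [eLpNorm_eq_lintegral_rpow_enorm_toReal hq0 hqt, one_div, ENNReal.rpow_inv_le_iff hQ0,
    ENNReal.mul_rpow_of_nonneg _ _ hQ0.le, eLpNorm_eq_lintegral_rpow_enorm_toReal hq0 hqt, one_div,
    ENNReal.rpow_inv_rpow hQ0.ne']
  calc _ ≤ ∫⁻ x in Icc (-1:ℝ) 1, ENNReal.ofReal (2^α) ^ q.toReal * F (s * x + (s - 1)) :=
        setLIntegral_mono' measurableSet_Icc hb
    _ ≤ ∫⁻ x, ENNReal.ofReal (2^α) ^ q.toReal * F (s * x + (s - 1)) :=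
        setLIntegral_le_lintegral _ _
    _ = ENNReal.ofReal (2^α) ^ q.toReal * (ENNReal.ofReal s⁻¹ * ∫⁻ x, F x) := by
        rw [lintegral_const_mul _ (by fun_prop), lint_affine F hFm s _ hs0]
    _ ≤ ENNReal.ofReal (2 * 2^α) ^ q.toReal * ∫⁻ x, F x := by
        rw [← mul_assoc]
        gcongr
        rw [ENNReal.ofReal_mul (by norm_num), ENNReal.mul_rpow_of_nonneg _ _ hQ0.le, mul_comm]
        gcongr
        calc ENNReal.ofReal s⁻¹ ≤ ENNReal.ofReal 2 := by
              apply ENNReal.ofReal_le_ofReal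
              rw [inv_le_comm₀ hs0 (by norm_num)]; linarith [hs.1]
          _ = (ENNReal.ofReal 2) ^ (1:ℝ) := by simp
          _ ≤ _ := ENNReal.rpow_le_rpow_of_exponent_le (by norm_num) hQ1
    _ = _ := by rw [hF, lintegral_indicator measurableSet_Icc]

lemma theta_bound (n : ℕ) (hn : 1 ≤ n) (V : ℝ → ℝ) (hV : Continuous V) (hb : ∀ s, |V s| ≤ n) :
    |∫ s in (-Real.pi)..Real.pi, (1 - (1 - Real.cos s)/4)^(256*n^2) * V s| ≤ 1/2 := by
  have hpi := Real.pi_pos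
  have hpi4 : Real.pi < 3.15 := Real.pi_lt_d2
  have hn0 : (0:ℝ) < n := by positivity
  set b : ℝ := 128 * n^2 / Real.pi^2 with hbd
  have hb0 : 0 < b := by positivity
  have h1 : ∀ s ∈ Ioc (-Real.pi) Real.pi, ‖(1 - (1 - Real.cos s)/4)^(256*n^2) * V s‖ ≤
      n * Real.exp (-b * s^2) := by
    intro s hs
    have hc := Real.cos_le_one_sub_mul_cos_sq (x := s) (abs_le.mpr ⟨hs.1.le, hs.2⟩)
    have hc1 := Real.neg_one_le_cos s
    have hpos : 0 ≤ 1 - (1 - Real.cos s)/4 := by linarith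
    rw [Real.norm_eq_abs, abs_mul, abs_of_nonneg (pow_nonneg hpos _), mul_comm]
    apply mul_le_mul (hb s) _ (pow_nonneg hpos _) hn0.le
    have h2 : 1 - (1 - Real.cos s)/4 ≤ Real.exp (-(1 - Real.cos s)/4) := by
      have := Real.add_one_le_exp (-(1 - Real.cos s)/4); linarith
    calc _ ≤ Real.exp (-(1 - Real.cos s)/4) ^ (256*n^2) := pow_le_pow_left₀ hpos h2 _
      _ = Real.exp ((256*n^2 : ℕ) * (-(1 - Real.cos s)/4)) := by rw [← Real.exp_nat_mul]
      _ ≤ _ := by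
        apply Real.exp_le_exp.mpr
        push_cast
        have : b * s^2 = 64 * n^2 * (2 / Real.pi^2 * s^2) := by rw [hbd]; ring
        have h5 : (0:ℝ) ≤ 64 * n^2 := by positivity
        nlinarith [mul_le_mul_of_nonneg_left hc h5]
  rw [intervalIntegral.integral_of_le (by linarith), ← Real.norm_eq_abs]
  have hint : Integrable (fun s : ℝ => (n:ℝ) * Real.exp (-b * s^2)) :=
    (integrable_exp_neg_mul_sq hb0).const_mul _
  calc _ ≤ ∫ s in Ioc (-Real.pi) Real.pi, n * Real.exp (-b * s^2) := by
        apply norm_integral_le_of_norm_le hint.integrableOn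
        exact (ae_restrict_mem measurableSet_Ioc).mono h1
    _ ≤ ∫ s, n * Real.exp (-b * s^2) :=
        setIntegral_le_integral hint (Eventually.of_forall fun s => by positivity)
    _ = n * √(Real.pi / b) := by rw [integral_const_mul, integral_gaussian]
    _ ≤ 1/2 := by
        have : Real.pi / b ≤ (1/(2*n))^2 := by
          rw [hbd]
          rw [div_div_eq_mul_div, div_pow, div_le_div_iff₀ (by positivity) (by positivity)]
          have : Real.pi^3 ≤ 32 := by
            have : Real.pi^3 ≤ 3.15^3 := pow_le_pow_left₀ hpi.le hpi4.le 3
            norm_num at this ⊢; linarith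
          nlinarith [sq_nonneg (n:ℝ), mul_le_mul_of_nonneg_left this (sq_nonneg (n:ℝ))]
        have h3 : √(Real.pi / b) ≤ 1/(2*n) := (Real.sqrt_le_left (by positivity)).mpr this
        calc _ ≤ (n:ℝ) * (1/(2*n)) := by gcongr
          _ = 1/2 := by field_simp

open Polynomial in
lemma low1_op (q : ℝ≥0∞) (hq : 1 ≤ q) (hqt : q ≠ ∞) (α β : ℝ) (hα : 0 ≤ α) (hβ : 0 ≤ β)
    (n : ℕ) (hn : 1 ≤ n) (P : ℝ[X]) (hP : P.natDegree ≤ n) (c : ℝ) (hc : 0 < c)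
    (h : LpOn (fun x => jacobi α β x * ((1+x)^(256*n^2) - P.eval x)) q (-1) 1 ≤ ENNReal.ofReal c) :
    LpOn (fun x => jacobi α β x * (1+x)^(256*n^2)) q (-1) 1 ≤
      ENNReal.ofReal (2 * (c + 3 * (2 * 2^α * c))) := by
  obtain ⟨V, hV, hVs, hVb, hV3, hVr⟩ := vp n hn
  set N := 256*n^2 with hN
  set th := ∫ s in (-Real.pi)..Real.pi, (1 - (1 - Real.cos s)/4)^N * V s with hth
  have hth2 : |th| ≤ 1/2 := theta_bound n hn V hV hVb
  set H : ℝ → ℝ := fun x => (1+x)^N - P.eval x with hH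
  have hHc : Continuous H := by rw [hH]; fun_prop
  set e : ℝ → ℝ → ℝ := fun x s => jacobi α β x * H ((1 - (1 - Real.cos s)/4) * (1+x) - 1) with he
  have hem : Measurable (Function.uncurry e) := by
    have h1 : Measurable fun z : ℝ × ℝ => jacobi α β z.1 := (jacobi_meas α β).comp measurable_fst
    have h2 : Measurable fun z : ℝ × ℝ => H ((1 - (1 - Real.cos z.2)/4) * (1+z.1) - 1) :=
      (hHc.comp (by fun_prop)).measurable
    exact h1.mul h2
  set G : ℝ → ℝ := fun x => jacobi α β x * (th * (1+x)^N - P.eval x) with hG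
  have hGn : eLpNorm G q (volume.restrict (Icc (-1) 1)) ≤ ENNReal.ofReal (3 * (2 * 2^α * c)) := by
    apply op_norm q hq hqt _ V hV hV3 e hem _ (by positivity)
    · intro s
      have hs : 1 - (1 - Real.cos s)/4 ∈ Icc (1/2:ℝ) 1 := by
        constructor <;> linarith [Real.neg_one_le_cos s, Real.cos_le_one s]
      refine (dil_norm q hq hqt α β hα hβ H hHc.measurable _ hs).trans ?_
      rw [ENNReal.ofReal_mul (p := 2 * 2^α) (by positivity)]
      exact mul_le_mul_right h _
    · refine Eventually.of_forall fun x => ?_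
      rw [hG, he]
      simp only [hH]
      have h1 := hVr (P.comp (C ((1+x)/4) * X + C (3*(1+x)/4 - 1))) (by
        refine natDegree_comp_le.trans ?_
        calc _ ≤ P.natDegree * 1 := by
              gcongr; exact natDegree_linear_le
          _ ≤ n := by omega)
      have h2 : ∀ s : ℝ, jacobi α β x * ((1 + ((1 - (1 - Real.cos s)/4) * (1+x) - 1))^N -
          P.eval ((1 - (1 - Real.cos s)/4) * (1+x) - 1)) * V s =
          (jacobi α β x * (1+x)^N) * ((1 - (1 - Real.cos s)/4)^N * V s) - jacobi α β x *
          ((P.comp (C ((1+x)/4) * X + C (3*(1+x)/4 - 1))).eval (Real.cos s) * V s) := by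
        intro s
        have e1 : (1 + ((1 - (1 - Real.cos s)/4) * (1+x) - 1)) = (1+x) * (1 - (1 - Real.cos s)/4) := by
          ring
        have e2 : (P.comp (C ((1+x)/4) * X + C (3*(1+x)/4 - 1))).eval (Real.cos s) =
          P.eval ((1 - (1 - Real.cos s)/4) * (1+x) - 1) := by
          simp only [eval_comp, eval_add, eval_mul, eval_C, eval_X]; congr 1; ring
        rw [e1, e2, mul_pow]; ring
      simp_rw [h2]
      rw [intervalIntegral.integral_sub, intervalIntegral.integral_const_mul,
        intervalIntegral.integral_const_mul, h1, ← hth]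
      · simp only [eval_comp, eval_add, eval_mul, eval_C, eval_X]
        have : (1 + x) / 4 * 1 + (3 * (1 + x) / 4 - 1) = x := by ring
        rw [this]; ring
      · exact (by fun_prop : Continuous _).intervalIntegrable _ _
      · exact (by fun_prop : Continuous _).intervalIntegrable _ _
  have hth1 : 1/2 ≤ 1 - th := by linarith [(abs_le.mp hth2).2]
  have hjm := jacobi_meas α β
  have e3 : (fun x => jacobi α β x * (1+x)^N) = (1 - th)⁻¹ •
      ((fun x => jacobi α β x * ((1+x)^N - P.eval x)) - G) := by
    ext x
    simp only [Pi.smul_apply, Pi.sub_apply, smul_eq_mul, hG]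
    rw [inv_mul_eq_div, eq_div_iff (by linarith)]; ring
  rw [LpOn, e3, eLpNorm_const_smul]
  have hPm : Measurable fun x => P.eval x := P.continuous.measurable
  calc _ ≤ ENNReal.ofReal 2 * (ENNReal.ofReal c + ENNReal.ofReal (3 * (2 * 2^α * c))) := by
        gcongr
        · rw [Real.enorm_eq_ofReal_abs, abs_of_pos (inv_pos.mpr (by linarith))]
          apply ENNReal.ofReal_le_ofReal
          rw [inv_le_comm₀ (by linarith) (by norm_num)]; linarith
        · refine (eLpNorm_sub_le ?_ ?_ hq).trans (add_le_add h hGn)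
          · exact (Measurable.aestronglyMeasurable (by fun_prop))
          · exact (Measurable.aestronglyMeasurable (by fun_prop))
    _ = _ := by
        rw [← ENNReal.ofReal_add (by positivity) (by positivity), ← ENNReal.ofReal_mul (by norm_num)]

lemma eLp_lower_const (q : ℝ≥0∞) (hq : 1 ≤ q) (hqt : q ≠ ∞) (a b c : ℝ) (hab : a ≤ b) (hc : 0 ≤ c)
    (S : Set ℝ) (hS : Icc a b ⊆ S) (g : ℝ → ℝ) (hg : ∀ x ∈ Icc a b, c ≤ |g x|) :
    ENNReal.ofReal (c * (b - a) ^ (1 / q.toReal)) ≤ eLpNorm g q (volume.restrict S) := by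
  have hq0 : q ≠ 0 := (lt_of_lt_of_le one_pos hq).ne'
  have h1 : eLpNorm (fun _ : ℝ => c) q (volume.restrict (Icc a b)) ≤
      eLpNorm g q (volume.restrict (Icc a b)) := by
    apply eLpNorm_mono_ae
    refine (ae_restrict_mem measurableSet_Icc).mono fun x hx => ?_
    rw [Real.norm_eq_abs, Real.norm_eq_abs, abs_of_nonneg hc]; exact hg x hx
  rw [eLpNorm_const' _ hq0 hqt, Measure.restrict_apply_univ, Real.volume_Icc,
    Real.enorm_eq_ofReal_abs, abs_of_nonneg hc,
    ENNReal.ofReal_rpow_of_nonneg (by linarith) (by positivity), ← ENNReal.ofReal_mul hc] at h1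
  exact h1.trans (eLpNorm_mono_measure _ (Measure.restrict_mono hS le_rfl))

lemma eLp_upper_const (q : ℝ≥0∞) (hq : 1 ≤ q) (hqt : q ≠ ∞) (a b c : ℝ) (hab : a ≤ b) (hc : 0 ≤ c)
    (g : ℝ → ℝ) (hg : ∀ x ∈ Icc a b, |g x| ≤ c) :
    eLpNorm g q (volume.restrict (Icc a b)) ≤ ENNReal.ofReal (c * (b - a) ^ (1 / q.toReal)) := by
  have hq0 : q ≠ 0 := (lt_of_lt_of_le one_pos hq).ne'
  have h1 : eLpNorm g q (volume.restrict (Icc a b)) ≤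
      eLpNorm (fun _ : ℝ => c) q (volume.restrict (Icc a b)) := by
    apply eLpNorm_mono_ae
    refine (ae_restrict_mem measurableSet_Icc).mono fun x hx => ?_
    rw [Real.norm_eq_abs, Real.norm_eq_abs, abs_of_nonneg hc]; exact hg x hx
  rwa [eLpNorm_const' _ hq0 hqt, Measure.restrict_apply_univ, Real.volume_Icc,
    Real.enorm_eq_ofReal_abs, abs_of_nonneg hc,
    ENNReal.ofReal_rpow_of_nonneg (by linarith) (by positivity), ← ENNReal.ofReal_mul hc] at h1

lemma rpow_le_exp (β : ℝ) (hβ : 0 ≤ β) (z : ℝ) (hz : 0 ≤ z) :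
    z ^ β ≤ (4 * (β + 1)) ^ β * Real.exp (z / 4) := by
  have h1 : z ≤ 4 * (β + 1) * Real.exp (z / (4 * (β + 1))) := by
    have := Real.add_one_le_exp (z / (4 * (β + 1)))
    calc z = 4 * (β + 1) * (z / (4 * (β + 1))) := by field_simp
      _ ≤ _ := by gcongr; linarith
  calc z ^ β ≤ (4 * (β + 1) * Real.exp (z / (4 * (β + 1)))) ^ β := Real.rpow_le_rpow hz h1 hβ
    _ = (4 * (β + 1)) ^ β * Real.exp (z / (4 * (β + 1)) * β) := by
        rw [Real.mul_rpow (by positivity) (by positivity), ← Real.exp_mul]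
    _ ≤ _ := by
        gcongr
        rw [div_mul_eq_mul_div, div_le_div_iff₀ (by positivity) (by norm_num)]; nlinarith

lemma exp_norm (p : ℝ≥0∞) (hp : 1 ≤ p) (N : ℕ) (hN : 1 ≤ N) :
    eLpNorm (fun x => Real.exp (-(N * (1 - x) / 4))) p (volume.restrict (Icc (-1:ℝ) 1)) ≤
      ENNReal.ofReal (4 * (N:ℝ) ^ (-(1 / p.toReal))) := by
  have hN0 : (0:ℝ) < N := by positivity
  by_cases hpt : p = ∞
  · subst hpt
    have : eLpNorm (fun x => Real.exp (-(N * (1 - x) / 4))) ∞ (volume.restrict (Icc (-1:ℝ) 1)) ≤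
        ENNReal.ofReal 1 := by
      rw [eLpNorm_exponent_top]
      apply eLpNormEssSup_le_of_ae_bound
      refine (ae_restrict_mem measurableSet_Icc).mono fun x hx => ?_
      rw [Real.norm_eq_abs, Real.abs_exp]
      apply Real.exp_le_one_iff.mpr
      have := hx.2
      have : 0 ≤ N * (1 - x) := mul_nonneg hN0.le (by linarith)
      linarith
    refine this.trans (ENNReal.ofReal_le_ofReal ?_)
    simp
  have hp0 : p ≠ 0 := (lt_of_lt_of_le one_pos hp).ne'
  have hP1 : 1 ≤ p.toReal := by
    rw [← ENNReal.toReal_one]; exact ENNReal.toReal_mono hpt hp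
  set Pr := p.toReal with hPr
  have hP0 : 0 < Pr := by linarith
  rw [eLpNorm_eq_lintegral_rpow_enorm_toReal hp0 hpt]
  have h1 : ∫⁻ x in Icc (-1:ℝ) 1, ‖Real.exp (-(N * (1 - x) / 4))‖ₑ ^ Pr ≤ ENNReal.ofReal (4 / N) := by
    have e1 : ∀ x : ℝ, ‖Real.exp (-(N * (1 - x) / 4))‖ₑ ^ Pr =
        ENNReal.ofReal (Real.exp (N * Pr / 4 * x - N * Pr / 4)) := by
      intro x
      rw [Real.enorm_eq_ofReal_abs, Real.abs_exp,
        ENNReal.ofReal_rpow_of_nonneg (Real.exp_pos _).le hP0.le, ← Real.exp_mul]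
      congr 2; ring
    simp_rw [e1]
    rw [← ofReal_integral_eq_lintegral_ofReal
      (Continuous.integrableOn_Icc (by fun_prop))
      (Eventually.of_forall fun x => (Real.exp_pos _).le)]
    apply ENNReal.ofReal_le_ofReal
    rw [integral_Icc_eq_integral_Ioc, ← intervalIntegral.integral_of_le (by norm_num),
      intervalIntegral.integral_comp_mul_sub (fun x => Real.exp x) (by positivity), integral_exp]
    simp only [smul_eq_mul, mul_one, sub_self, Real.exp_zero]
    have := Real.exp_pos (↑N * Pr / 4 * -1 - ↑N * Pr / 4)
    calc _ ≤ (N * Pr / 4)⁻¹ * 1 := by gcongr; linarith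
      _ ≤ 4 / N := by
        rw [mul_one, inv_div]
        gcongr; nlinarith
  calc _ ≤ (ENNReal.ofReal (4 / N)) ^ (1 / Pr) := by gcongr
    _ = ENNReal.ofReal ((4 / N) ^ (1 / Pr)) :=
        ENNReal.ofReal_rpow_of_nonneg (by positivity) (by positivity)
    _ ≤ _ := by
        apply ENNReal.ofReal_le_ofReal
        rw [Real.div_rpow (by norm_num) hN0.le, Real.rpow_neg hN0.le, ← div_eq_mul_inv]
        gcongr
        calc (4:ℝ) ^ (1/Pr) ≤ 4 ^ (1:ℝ) := by
              apply Real.rpow_le_rpow_of_exponent_le (by norm_num)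
              rw [div_le_one hP0]; exact hP1
          _ = 4 := by simp

lemma low1_up (p : ℝ≥0∞) (hp : 1 ≤ p) (α β : ℝ) (hα : 0 ≤ α) (hβ : 0 ≤ β) (N : ℕ) (hN : 1 ≤ N) :
    LpOn (fun x => jacobi α β x * (1+x)^N) p (-1) 1 ≤
      ENNReal.ofReal (2^α * (4 * (β + 1))^β * (2^N * (N:ℝ)^(-β)) * (4 * (N:ℝ) ^ (-(1 / p.toReal)))) := by
  have hN0 : (0:ℝ) < N := by positivity
  set K : ℝ := 2^α * (4 * (β + 1))^β * (2^N * (N:ℝ)^(-β)) with hK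
  have hK0 : 0 ≤ K := by positivity
  have hb : ∀ x ∈ Icc (-1:ℝ) 1, ‖jacobi α β x * (1+x)^N‖ ≤ ‖K * Real.exp (-(N * (1 - x) / 4))‖ := by
    intro x hx
    have h1x : 0 ≤ 1 + x := by linarith [hx.1]
    have h2x : 0 ≤ 1 - x := by linarith [hx.2]
    have hj := jacobi_nonneg α β hx
    rw [Real.norm_eq_abs, Real.norm_eq_abs, abs_of_nonneg (by positivity), abs_of_nonneg (by positivity)]
    have a1 : (1 + x)^α ≤ 2^α := Real.rpow_le_rpow h1x (by linarith [hx.2]) hα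
    have a2 : (1 - x)^β ≤ (N:ℝ)^(-β) * ((4 * (β + 1)) ^ β * Real.exp (N * (1 - x) / 4)) := by
      have := rpow_le_exp β hβ (N * (1 - x)) (by positivity)
      rw [Real.mul_rpow hN0.le h2x] at this
      calc (1 - x)^β = (N:ℝ)^(-β) * ((N:ℝ)^β * (1 - x)^β) := by
            rw [← mul_assoc, ← Real.rpow_add hN0]; simp
        _ ≤ _ := by gcongr
    have a3 : (1 + x)^N ≤ 2^N * Real.exp (-(N * (1 - x) / 2)) := by
      have : (1 + x)/2 ≤ Real.exp (-((1 - x) / 2)) := by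
        have := Real.add_one_le_exp (-((1 - x) / 2)); linarith
      calc (1 + x)^N = 2^N * ((1+x)/2)^N := by rw [← mul_pow]; congr 1; ring
        _ ≤ 2^N * Real.exp (-((1 - x) / 2))^N := by gcongr
        _ = _ := by rw [← Real.exp_nat_mul]; congr 2; ring
    unfold jacobi
    calc _ ≤ 2^α * ((N:ℝ)^(-β) * ((4 * (β + 1)) ^ β * Real.exp (N * (1 - x) / 4))) *
          (2^N * Real.exp (-(N * (1 - x) / 2))) := by gcongr
      _ = K * (Real.exp (N * (1 - x) / 4) * Real.exp (-(N * (1 - x) / 2))) := by rw [hK]; ring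
      _ = _ := by rw [← Real.exp_add]; congr 2; ring
  calc _ ≤ eLpNorm (fun x => K * Real.exp (-(N * (1 - x) / 4))) p (volume.restrict (Icc (-1:ℝ) 1)) :=
        eLpNorm_mono_ae ((ae_restrict_mem measurableSet_Icc).mono hb)
    _ = ENNReal.ofReal K * eLpNorm (fun x => Real.exp (-(N * (1 - x) / 4))) p
          (volume.restrict (Icc (-1:ℝ) 1)) := by
        have : (fun x : ℝ => K * Real.exp (-(N * (1 - x) / 4))) =
          K • (fun x : ℝ => Real.exp (-(N * (1 - x) / 4))) := rfl
        rw [this, eLpNorm_const_smul, Real.enorm_eq_ofReal_abs, abs_of_nonneg hK0]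
    _ ≤ ENNReal.ofReal K * ENNReal.ofReal (4 * (N:ℝ) ^ (-(1 / p.toReal))) := by
        gcongr; exact exp_norm p hp N hN
    _ = _ := by rw [← ENNReal.ofReal_mul hK0]

lemma low1_dn (q : ℝ≥0∞) (hq : 1 ≤ q) (hqt : q ≠ ∞) (α β : ℝ) (hα : 0 ≤ α) (hβ : 0 ≤ β)
    (N : ℕ) (hN : 1 ≤ N) :
    ENNReal.ofReal ((2^N * (N:ℝ)^(-β)) * (1/2 * (1/2)^β) * ((1/2) * (N:ℝ) ^ (-(1 / q.toReal)))) ≤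
      LpOn (fun x => jacobi α β x * (1+x)^N) q (-1) 1 := by
  have hN0 : (0:ℝ) < N := by positivity
  have hN1 : (1:ℝ) ≤ N := by exact_mod_cast hN
  have hiN : 1 / (N:ℝ) ≤ 1 := by rw [div_le_one hN0]; exact hN1
  have hiN0 : 0 < 1 / (N:ℝ) := by positivity
  have hQ1 : 1 ≤ q.toReal := by
    rw [← ENNReal.toReal_one]; exact ENNReal.toReal_mono hqt hq
  have hQ0 : 0 < q.toReal := by linarith
  refine le_trans ?_ (eLp_lower_const q hq hqt (1 - 1/N) (1 - 1/(2*N))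
    ((2^N * (N:ℝ)^(-β)) * (1/2 * (1/2)^β)) ?_ (by positivity) (Icc (-1) 1) ?_
    (fun x => jacobi α β x * (1+x)^N) ?_)
  · apply ENNReal.ofReal_le_ofReal
    gcongr
    have e : (1 - 1/(2*(N:ℝ))) - (1 - 1/N) = (1/2) / N := by field_simp; ring
    rw [e, Real.div_rpow (by norm_num) hN0.le, Real.rpow_neg hN0.le, ← div_eq_mul_inv]
    gcongr
    calc (1/2:ℝ) = (1/2)^(1:ℝ) := by simp
      _ ≤ _ := by
        apply Real.rpow_le_rpow_of_exponent_ge (by norm_num) (by norm_num)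
        rw [div_le_one hQ0]; exact hQ1
  · gcongr; linarith
  · intro x hx
    have : 0 < 1 / (2 * (N:ℝ)) := by positivity
    exact ⟨by linarith [hx.1], by linarith [hx.2]⟩
  · intro x hx
    have : 0 < 1 / (2 * (N:ℝ)) := by positivity
    have hx' : x ∈ Icc (-1:ℝ) 1 := ⟨by linarith [hx.1], by linarith [hx.2]⟩
    have hj := jacobi_nonneg α β hx'
    have h1x : 0 ≤ 1 + x := by linarith [hx'.1]
    have h2x : 0 ≤ 1 - x := by linarith [hx'.2]
    rw [abs_of_nonneg (by positivity)]
    have a1 : 1 ≤ (1 + x)^α := Real.one_le_rpow (by linarith [hx.1]) hα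
    have a2 : (1/2)^β * (N:ℝ)^(-β) ≤ (1 - x)^β := by
      rw [Real.rpow_neg hN0.le, ← Real.inv_rpow hN0.le, ← Real.mul_rpow (by norm_num) (by positivity)]
      apply Real.rpow_le_rpow (by positivity) _ hβ
      have : 1/2 * (N:ℝ)⁻¹ = 1/(2*N) := by field_simp
      rw [this]; linarith [hx.2]
    have a3 : 2^N * (1/2) ≤ (1 + x)^N := by
      have h3 := one_add_mul_le_pow (a := (x-1)/2) (by linarith [hx'.1]) N
      have e : (1 + x)^N = 2^N * (1 + (x-1)/2)^N := by rw [← mul_pow]; congr 1; ring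
      rw [e]
      gcongr
      refine le_trans ?_ h3
      have : (N:ℝ) * (1 - x) ≤ 1 := by
        have := mul_le_mul_of_nonneg_left (show 1 - x ≤ 1/N by linarith [hx.1]) hN0.le
        rwa [mul_one_div_cancel hN0.ne'] at this
      linarith
    unfold jacobi
    calc _ = (1 * ((1/2)^β * (N:ℝ)^(-β))) * (2^N * (1/2)) := by ring
      _ ≤ _ := by gcongr

lemma lower1 (k : ℕ) (q p : ℝ≥0∞) (hq : 1 ≤ q) (hqp : q < p) (α β : ℝ) (hα : 0 ≤ α) (hβ : 0 ≤ β) :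
    ∃ c > (0:ℝ), ∀ n : ℕ, 1 ≤ n → ENNReal.ofReal (c * (n : ℝ) ^ (-(2 / q.toReal - 2 / p.toReal))) ≤
          EClass (MSet k ∩ BSet p α β) n (jacobi α β) q := by
  have hqt : q ≠ ∞ := hqp.ne_top
  set A1 : ℝ := 2^α * (4 * (β + 1))^β with hA1
  set B1 : ℝ := (1/2 * (1/2)^β) * (1/2) with hB1
  have hA10 : 0 < A1 := by positivity
  have hB10 : 0 < B1 := by positivity
  set D : ℝ := 2 * (1 + 3 * (2 * 2^α)) with hD
  have hD0 : 0 < D := by positivity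
  set r := 1 / p.toReal with hr
  set s := 1 / q.toReal with hs
  refine ⟨B1 / (8 * D * A1) * (256:ℝ)^(-(s - r)), by positivity, fun n hn => ?_⟩
  have hn0 : (0:ℝ) < n := by positivity
  set N := 256 * n^2 with hN
  have hN1 : 1 ≤ N := by have : 0 < n^2 := by positivity
                         omega
  have hN0 : (0:ℝ) < N := by positivity
  set K : ℝ := 2^N * (N:ℝ)^(-β) with hK
  have hK0 : 0 < K := by positivity
  have hpow : (n : ℝ) ^ (-(2 / q.toReal - 2 / p.toReal)) * (256:ℝ)^(-(s - r)) = (N:ℝ)^(-(s-r)) := by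
    have : (N:ℝ) = (n:ℝ)^(2:ℝ) * 256 := by rw [hN]; push_cast; norm_cast; ring
    rw [this, Real.mul_rpow (by positivity) (by norm_num), ← Real.rpow_mul hn0.le]
    congr 2; rw [hs, hr]; ring
  have hc : B1 / (8 * D * A1) * (256:ℝ)^(-(s - r)) * (n : ℝ) ^ (-(2 / q.toReal - 2 / p.toReal)) =
      B1 / (8 * D * A1) * (N:ℝ)^(-(s-r)) := by rw [← hpow]; ring
  rw [hc]
  have hdn := low1_dn q hq hqt α β hα hβ N hN1
  apply eclass_lower k p q α β n (fun x => (1+x)^N) (by fun_prop) (kMon_pow k N)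
    (A1 * K * (4 * (N:ℝ)^(-r))) _ (by positivity) (by positivity)
    (low1_up p (hq.trans hqp.le) α β hα hβ N hN1)
  · have h1 := low1_dn q hq hqt α β hα hβ N hN1
    intro h0
    rw [LpOn, eLpNorm_eq_zero_iff (by
      have := jacobi_meas α β
      exact Measurable.aestronglyMeasurable (by fun_prop))
      (lt_of_lt_of_le one_pos (hq.trans hqp.le)).ne'] at h0
    rw [LpOn, eLpNorm_congr_ae h0] at h1
    rw [eLpNorm_zero, nonpos_iff_eq_zero, ENNReal.ofReal_eq_zero] at h1
    have : 0 < (2^N * (N:ℝ)^(-β)) * (1/2 * (1/2)^β) * ((1/2) * (N:ℝ) ^ (-(1 / q.toReal))) := by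
      positivity
    linarith
  · intro P hP
    by_contra hlt
    push Not at hlt
    set c := B1 / (8 * D * A1) * (N:ℝ)^(-(s-r)) * (A1 * K * (4 * (N:ℝ)^(-r))) with hcd
    have hcc : c = B1 * K * (N:ℝ)^(-s) / (2 * D) := by
      have : (N:ℝ)^(-s) = (N:ℝ)^(-(s-r)) * (N:ℝ)^(-r) := by
        rw [← Real.rpow_add hN0]; congr 1; ring
      rw [hcd, this]; field_simp; ring
    have hc0 : 0 < c := by rw [hcc]; positivity
    have h2 := low1_op q hq hqt α β hα hβ n hn P hP c hc0 hlt.le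
    have h3 := hdn.trans h2
    rw [ENNReal.ofReal_le_ofReal_iff (by positivity)] at h3
    have e1 : 2 * (c + 3 * (2 * 2^α * c)) = D * c := by rw [hD]; ring
    have e2 : D * c = B1 * K * (N:ℝ)^(-s) / 2 := by rw [hcc]; field_simp
    have e3 : (2^N * (N:ℝ)^(-β)) * (1/2 * (1/2)^β) * ((1/2) * (N:ℝ) ^ (-(1 / q.toReal))) =
      B1 * K * (N:ℝ)^(-s) := by rw [hB1, hK, hs]; ring
    rw [e1, e2, e3] at h3
    have : 0 < B1 * K * (N:ℝ)^(-s) := by positivity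
    linarith

def stepF (x : ℝ) : ℝ := if 0 ≤ x then 1 else 0

lemma stepF_meas : Measurable stepF :=
  Measurable.ite measurableSet_Ici measurable_const measurable_const

lemma stepF_abs (x : ℝ) : |stepF x| ≤ 1 := by unfold stepF; split_ifs <;> simp

lemma stepF_kMon : kMonotoneOn 1 stepF := by
  intro x hx _
  have e0 : (Finset.univ.erase (0 : Fin 2)) = {1} := by decide
  have e1 : (Finset.univ.erase (1 : Fin 2)) = {0} := by decide
  rw [Fin.sum_univ_two]
  change 0 ≤ stepF (x 0) / (∏ j ∈ Finset.univ.erase (0 : Fin 2), (x 0 - x j)) +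
    stepF (x 1) / (∏ j ∈ Finset.univ.erase (1 : Fin 2), (x 1 - x j))
  rw [e0, e1, Finset.prod_singleton, Finset.prod_singleton]
  have hne : x 0 ≠ x 1 := fun h => by simpa using hx h
  have hne' : x 0 - x 1 ≠ 0 := sub_ne_zero.mpr hne
  have : stepF (x 0) / (x 0 - x 1) + stepF (x 1) / (x 1 - x 0) =
      (stepF (x 0) - stepF (x 1)) / (x 0 - x 1) := by
    rw [← neg_sub (x 0) (x 1), div_neg]; ring
  rw [this]
  unfold stepF
  rcases lt_or_gt_of_ne hne with h | h
  · apply div_nonneg_of_nonpos _ (by linarith)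
    split_ifs <;> linarith
  · apply div_nonneg _ (by linarith)
    split_ifs <;> linarith

open Polynomial in
lemma vp_sin (n : ℕ) (V : ℝ → ℝ) (hV : Continuous V) (hVs : ∀ s, V (-s) = V s)
    (hVr : ∀ R : ℝ[X], R.natDegree ≤ n → ∫ s in (-Real.pi)..Real.pi, R.eval (Real.cos s) * V s = R.eval 1)
    (R : ℝ[X]) (hR : R.natDegree ≤ n) :
    ∫ s in (-Real.pi)..Real.pi, R.eval (Real.sin s) * V s = R.eval 0 := by
  have hm : ∀ j ≤ n, ∫ s in (-Real.pi)..Real.pi, (Real.sin s)^j * V s = (0:ℝ)^j := by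
    intro j hj
    rcases Nat.even_or_odd' j with ⟨i, rfl | rfl⟩
    · have := hVr ((1 - X^2)^i) (by
        refine natDegree_pow_le.trans ?_
        have : (1 - X^2 : ℝ[X]).natDegree ≤ 2 := by compute_degree
        nlinarith)
      simp only [eval_pow, eval_sub, eval_one, eval_X] at this
      rw [pow_mul]
      norm_num at this ⊢
      rw [← this]
      congr 1; ext s
      rw [pow_mul, Real.sin_sq]
    · have := intervalIntegral.integral_comp_neg (a := -Real.pi) (b := Real.pi)
        (fun s : ℝ => (Real.sin s)^(2*i+1) * V s)
      have ho : Odd (2*i+1) := ⟨i, rfl⟩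
      simp only [Real.sin_neg, hVs, neg_neg, ho.neg_pow, neg_mul, intervalIntegral.integral_neg] at this
      simp
      linarith
  simp_rw [eval_eq_sum_range' (Nat.lt_succ_of_le hR), Finset.sum_mul]
  rw [intervalIntegral.integral_finsetSum]
  · refine Finset.sum_congr rfl fun j hj => ?_
    simp_rw [mul_assoc]
    rw [intervalIntegral.integral_const_mul, hm j (Nat.lt_succ_iff.mp (Finset.mem_range.mp hj))]
  · intro j _
    exact (by fun_prop : Continuous _).intervalIntegrable _ _

lemma stepF_int (V : ℝ → ℝ) (hV : Continuous V) (x a b : ℝ) :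
    IntervalIntegrable (fun s => stepF (x + Real.sin s / 2) * V s) volume a b := by
  apply IntervalIntegrable.mono_fun' (g := fun s => |V s|) (hV.abs.intervalIntegrable _ _)
  · apply Measurable.aestronglyMeasurable
    exact (stepF_meas.comp (by fun_prop)).mul hV.measurable
  · refine Eventually.of_forall fun s => ?_
    dsimp only
    rw [Real.norm_eq_abs, abs_mul]
    exact mul_le_of_le_one_left (abs_nonneg _) (stepF_abs _)

lemma stepF_op (n : ℕ) (V : ℝ → ℝ) (hV : Continuous V) (hVs : ∀ s, V (-s) = V s)
    (hVb : ∀ s, |V s| ≤ n) (hV1 : ∫ s in (-Real.pi)..Real.pi, V s = 1) (x : ℝ) (hx : 0 < x) (hx8 : x ≤ 1/8) :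
    |(∫ s in (-Real.pi)..Real.pi, stepF (x + Real.sin s / 2) * V s) - 1/2| ≤ 4 * Real.pi * n * x := by
  have hpi := Real.pi_pos
  have hI := stepF_int V hV x
  have hhalf : ∫ s in (0:ℝ)..Real.pi, V s = 1/2 := by
    have h1 := intervalIntegral.integral_comp_neg (a := 0) (b := Real.pi) V
    simp only [hVs, neg_zero] at h1
    have h2 := intervalIntegral.integral_add_adjacent_intervals (hV.intervalIntegrable (-Real.pi) 0)
      (hV.intervalIntegrable (μ := volume) 0 Real.pi)
    linarith
  have h2 : ∫ s in (0:ℝ)..Real.pi, stepF (x + Real.sin s / 2) * V s = 1/2 := by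
    rw [← hhalf]
    apply intervalIntegral.integral_congr
    intro s hs
    rw [uIcc_of_le hpi.le] at hs
    have := Real.sin_nonneg_of_mem_Icc hs
    simp only [stepF]
    rw [if_pos (by linarith), one_mul]
  have hb : ∀ a b : ℝ, ∀ s ∈ uIoc a b, ‖stepF (x + Real.sin s / 2) * V s‖ ≤ n := by
    intro a b s _
    rw [Real.norm_eq_abs, abs_mul]
    exact (mul_le_of_le_one_left (abs_nonneg _) (stepF_abs _)).trans (hVb s)
  set y := 2 * Real.pi * x with hy
  have hy0 : 0 < y := by positivity
  have hy4 : y ≤ Real.pi / 4 := by rw [hy]; nlinarith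
  have hmid : ∫ s in (-Real.pi + y)..(-y), stepF (x + Real.sin s / 2) * V s = 0 := by
    have : ∫ s in (-Real.pi + y)..(-y), stepF (x + Real.sin s / 2) * V s =
        ∫ s in (-Real.pi + y)..(-y), (0:ℝ) := by
      apply intervalIntegral.integral_congr
      intro s hs
      rw [uIcc_of_le (by linarith)] at hs
      have h4 : 2 / Real.pi * y = 4 * x := by rw [hy]; field_simp; ring
      have hsin : 4 * x ≤ Real.sin (-s) := by
        rw [← h4]
        rcases le_total (-s) (Real.pi/2) with h | h
        · refine le_trans ?_ (Real.mul_le_sin (by linarith [hs.2]) h)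
          gcongr; linarith [hs.2]
        · rw [← Real.sin_pi_sub]
          refine le_trans ?_ (Real.mul_le_sin (by linarith [hs.1]) (by linarith))
          gcongr; linarith [hs.1]
      rw [Real.sin_neg] at hsin
      simp only [stepF]
      rw [if_neg (by linarith), zero_mul]
    rw [this]; simp
  have hl := intervalIntegral.norm_integral_le_of_norm_le_const (hb (-Real.pi) (-Real.pi + y))
  have hr := intervalIntegral.norm_integral_le_of_norm_le_const (hb (-y) 0)
  rw [← intervalIntegral.integral_add_adjacent_intervals (hI (-Real.pi) 0) (hI 0 Real.pi),
    ← intervalIntegral.integral_add_adjacent_intervals (hI (-Real.pi) (-y)) (hI (-y) 0),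
    ← intervalIntegral.integral_add_adjacent_intervals (hI (-Real.pi) (-Real.pi + y)) (hI _ (-y)),
    hmid, h2]
  have e1 : |-Real.pi + y - -Real.pi| = y := by rw [abs_of_nonneg] <;> linarith
  have e2 : |0 - -y| = y := by rw [abs_of_nonneg] <;> linarith
  rw [e1, Real.norm_eq_abs] at hl
  rw [e2, Real.norm_eq_abs] at hr
  have e3 : 4 * Real.pi * n * x = n * y + n * y := by rw [hy]; ring
  rw [e3, add_zero, add_sub_cancel_right]
  exact (abs_add_le _ _).trans (add_le_add hl hr)

lemma jacobi_lower (α β : ℝ) (hα : 0 ≤ α) (hβ : 0 ≤ β) (x : ℝ) (hx : x ∈ Icc (-(3/4):ℝ) (3/4)) :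
    (1/4)^α * (1/4)^β ≤ jacobi α β x := by
  unfold jacobi
  have h1x : 0 ≤ 1 + x := by linarith [hx.1]
  have h2x : 0 ≤ 1 - x := by linarith [hx.2]
  gcongr <;> linarith [hx.1, hx.2]

lemma jacobi_upper (α β : ℝ) (hα : 0 ≤ α) (hβ : 0 ≤ β) (x : ℝ) (hx : x ∈ Icc (-1:ℝ) 1) :
    jacobi α β x ≤ 2^α * 2^β := by
  unfold jacobi
  have h1x : 0 ≤ 1 + x := by linarith [hx.1]
  have h2x : 0 ≤ 1 - x := by linarith [hx.2]
  gcongr <;> linarith [hx.1, hx.2]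

open Polynomial in
lemma low2_op (q : ℝ≥0∞) (hq : 1 ≤ q) (hqt : q ≠ ∞) (α β : ℝ) (hα : 0 ≤ α) (hβ : 0 ≤ β)
    (n : ℕ) (hn : 1 ≤ n) (P : ℝ[X]) (hP : P.natDegree ≤ n) (c : ℝ) (hc : 0 < c)
    (h : LpOn (fun x => jacobi α β x * (stepF x - P.eval x)) q (-1) 1 ≤ ENNReal.ofReal c) :
    1/4 * (1/(128*(n:ℝ)))^(1/q.toReal) ≤ 4 * (c / ((1/4)^α * (1/4)^β)) := by
  obtain ⟨V, hV, hVs, hVb, hV3, hVr⟩ := vp n hn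
  have hn0 : (0:ℝ) < n := by positivity
  have hn1 : (1:ℝ) ≤ n := by exact_mod_cast hn
  have hq0 : q ≠ 0 := (lt_of_lt_of_le one_pos hq).ne'
  have hQ0 : 0 < q.toReal := ENNReal.toReal_pos hq0 hqt
  set w0 : ℝ := (1/4)^α * (1/4)^β with hw0
  have hw00 : 0 < w0 := by positivity
  set H : ℝ → ℝ := fun x => stepF x - P.eval x with hH
  have hHm : Measurable H := stepF_meas.sub P.continuous.measurable
  have hHn : eLpNorm H q (volume.restrict (Icc (-(3/4)) (3/4))) ≤ ENNReal.ofReal (c / w0) := by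
    have h1 : eLpNorm (w0 • H) q (volume.restrict (Icc (-(3/4)) (3/4))) ≤ ENNReal.ofReal c := by
      refine le_trans ?_ h
      calc _ ≤ eLpNorm (fun x => jacobi α β x * (stepF x - P.eval x)) q
            (volume.restrict (Icc (-(3/4)) (3/4))) := by
            apply eLpNorm_mono_ae
            refine (ae_restrict_mem measurableSet_Icc).mono fun x hx => ?_
            have := jacobi_lower α β hα hβ x hx
            rw [Pi.smul_apply, smul_eq_mul, norm_mul w0 (H x), norm_mul (jacobi α β x) _]
            refine mul_le_mul_of_nonneg_right (a := ‖H x‖) ?_ (norm_nonneg (H x))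
            rw [Real.norm_eq_abs, Real.norm_eq_abs, abs_of_pos hw00]
            exact this.trans (le_abs_self _)
        _ ≤ _ := eLpNorm_mono_measure _ (Measure.restrict_mono (Icc_subset_Icc (by norm_num)
            (by norm_num)) le_rfl)
    rw [eLpNorm_const_smul, Real.enorm_eq_ofReal_abs, abs_of_pos hw00] at h1
    rw [ENNReal.ofReal_div_of_pos hw00, ENNReal.le_div_iff_mul_le (by left; simpa using hw00)
      (by left; simp), mul_comm]
    exact h1
  set d : ℝ := 1/(64*n) with hd
  have hd0 : 0 < d := by positivity
  have hd1 : d ≤ 1/64 := by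
    rw [hd]; apply one_div_le_one_div_of_le (by norm_num); linarith
  set μ := volume.restrict (Icc (d/2) d) with hμ
  set e : ℝ → ℝ → ℝ := fun x s => H (x + Real.sin s / 2) with he
  have hem : Measurable (Function.uncurry e) := hHm.comp (by fun_prop)
  set AF : ℝ → ℝ := fun x => ∫ s in (-Real.pi)..Real.pi, stepF (x + Real.sin s / 2) * V s with hAF
  set G : ℝ → ℝ := fun x => AF x - P.eval x with hG
  have hGn : eLpNorm G q μ ≤ ENNReal.ofReal (3 * (c / w0)) := by
    apply op_norm q hq hqt _ V hV hV3 e hem _ (by positivity)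
    · intro s
      refine le_trans ?_ hHn
      rw [eLpNorm_eq_lintegral_rpow_enorm_toReal hq0 hqt, eLpNorm_eq_lintegral_rpow_enorm_toReal hq0 hqt]
      gcongr ?_ ^ _
      rw [← lintegral_indicator measurableSet_Icc, ← lintegral_indicator measurableSet_Icc,
        ← lintegral_add_right_eq_self ((Icc (-(3/4):ℝ) (3/4)).indicator _) (Real.sin s / 2)]
      apply lintegral_mono
      intro x
      beta_reduce
      by_cases hx : x ∈ Icc (d/2) d
      · rw [indicator_of_mem hx, indicator_of_mem]
        have := Real.neg_one_le_sin s
        have := Real.sin_le_one s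
        constructor <;> linarith [hx.1, hx.2]
      · rw [indicator_of_notMem hx]; exact zero_le
    · refine Eventually.of_forall fun x => ?_
      rw [hG, he]
      simp only [hH, sub_mul]
      rw [intervalIntegral.integral_sub (stepF_int V hV x _ _)
        ((by fun_prop : Continuous _).intervalIntegrable _ _)]
      congr 1
      have := vp_sin n V hV hVs hVr (P.comp (C (1/2) * X + C x)) (by
        refine natDegree_comp_le.trans ?_
        calc _ ≤ P.natDegree * 1 := by
              gcongr; exact natDegree_linear_le
          _ ≤ n := by omega)
      simp only [eval_comp, eval_add, eval_mul, eval_C, eval_X, mul_zero, zero_add] at this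
      rw [← this]
      congr 1; ext s; congr 2; ring
  have hV1 : ∫ s in (-Real.pi)..Real.pi, V s = 1 := by
    have := hVr 1 (by simp); simpa using this
  have hAm : AEStronglyMeasurable AF μ := by
    have : StronglyMeasurable (Function.uncurry fun x s => stepF (x + Real.sin s / 2) * V s) := by
      apply Measurable.stronglyMeasurable
      exact (stepF_meas.comp (by fun_prop)).mul (hV.measurable.comp measurable_snd)
    have h2 : AF = fun x => ∫ s in Ioc (-Real.pi) Real.pi, stepF (x + Real.sin s / 2) * V s := by
      ext x; rw [hAF]; exact intervalIntegral.integral_of_le (by linarith [Real.pi_pos])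
    rw [h2]
    exact this.integral_prod_right.aestronglyMeasurable
  have h1 := eLp_lower_const q hq hqt (d/2) d (1/4) (by linarith) (by norm_num) (Icc (d/2) d) le_rfl
    (H - G) (by
      intro x hx
      have h2 := stepF_op n V hV hVs hVb hV1 x (by linarith [hx.1]) (by linarith [hx.2])
      have h3 : 4 * Real.pi * n * x ≤ 1/4 := by
        have hpi : Real.pi ≤ 4 := Real.pi_le_four
        calc 4 * Real.pi * n * x ≤ 4 * 4 * n * d := by
              gcongr
              · linarith [hx.1]
              · exact hx.2
          _ = 1/4 := by rw [hd]; field_simp; norm_num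
      have h4 : (H - G) x = 1 - AF x := by
        simp only [Pi.sub_apply, hH, hG, stepF]
        rw [if_pos (by linarith [hx.1])]; ring
      rw [h4]
      change |AF x - 1/2| ≤ _ at h2
      have := (abs_le.mp (h2.trans h3)).2
      exact le_trans (by linarith) (le_abs_self _))
  have h5 : eLpNorm (H - G) q μ ≤ ENNReal.ofReal (c / w0) + ENNReal.ofReal (3 * (c / w0)) := by
    refine (eLpNorm_sub_le hHm.aestronglyMeasurable (hAm.sub P.continuous.aestronglyMeasurable) hq).trans
      (add_le_add ?_ hGn)
    exact (eLpNorm_mono_measure _ (Measure.restrict_mono (Icc_subset_Icc (by linarith)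
            (by linarith)) le_rfl)).trans hHn
  have h6 := h1.trans h5
  rw [← ENNReal.ofReal_add (by positivity) (by positivity),
    ENNReal.ofReal_le_ofReal_iff (by positivity)] at h6
  have e1 : d - d/2 = 1/(128*n) := by rw [hd]; field_simp; norm_num
  rw [e1] at h6
  linarith

lemma lower2 (q p : ℝ≥0∞) (hq : 1 ≤ q) (hqp : q < p) (α β : ℝ) (hα : 0 ≤ α) (hβ : 0 ≤ β) :
    ∃ c > (0:ℝ), ∀ n : ℕ, 1 ≤ n → ENNReal.ofReal (c * (n : ℝ) ^ (-(1 / q.toReal))) ≤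
          EClass (MSet 1 ∩ BSet p α β) n (jacobi α β) q := by
  have hqt : q ≠ ∞ := hqp.ne_top
  have hp1 := hq.trans hqp.le
  have hp0 : p ≠ 0 := (lt_of_lt_of_le one_pos hp1).ne'
  set w0 : ℝ := (1/4)^α * (1/4)^β with hw0
  have hw00 : 0 < w0 := by positivity
  set A : ℝ := 2 * (2^α * 2^β) with hA
  have hA0 : 0 < A := by positivity
  set C0 : ℝ := w0 / 32 * (1/128)^(1/q.toReal) with hC0
  have hC00 : 0 < C0 := by positivity
  have hjm := jacobi_meas α β
  have hsm := stepF_meas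
  refine ⟨C0 / A, by positivity, fun n hn => ?_⟩
  have hn0 : (0:ℝ) < n := by positivity
  apply eclass_lower 1 p q α β n stepF stepF_meas stepF_kMon A _ hA0 (by positivity)
  · refine (eLpNorm_le_of_ae_bound (C := 2^α * 2^β) ?_).trans ?_
    · refine (ae_restrict_mem measurableSet_Icc).mono fun x hx => ?_
      rw [norm_mul, Real.norm_eq_abs, Real.norm_eq_abs, abs_of_nonneg (jacobi_nonneg α β hx)]
      calc _ ≤ 2^α * 2^β * 1 := mul_le_mul (jacobi_upper α β hα hβ x hx) (stepF_abs x)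
            (abs_nonneg _) (by positivity)
        _ = _ := mul_one _
    · rw [Measure.restrict_apply_univ, Real.volume_Icc, hA, ENNReal.ofReal_mul (p := 2) (by norm_num)]
      refine mul_le_mul_left ?_ _
      have : (1:ℝ) - -1 = 2 := by norm_num
      rw [this]
      calc _ ≤ (ENNReal.ofReal 2) ^ (1:ℝ) := by
            apply ENNReal.rpow_le_rpow_of_exponent_le (by norm_num)
            by_cases hpt : p = ∞
            · simp [hpt]
            · apply inv_le_one_of_one_le₀
              rw [← ENNReal.toReal_one]; exact ENNReal.toReal_mono hpt hp1
        _ = _ := by simp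
  · intro h0
    rw [LpOn, eLpNorm_eq_zero_iff (Measurable.aestronglyMeasurable (by fun_prop)) hp0] at h0
    have h1 := eLp_lower_const q hq hqt 0 (1/2) w0 (by norm_num) hw00.le (Icc (-1) 1)
      (Icc_subset_Icc (by norm_num) (by norm_num)) (fun x => jacobi α β x * stepF x) (by
        intro x hx
        have := jacobi_lower α β hα hβ x ⟨by linarith [hx.1], by linarith [hx.2]⟩
        rw [stepF, if_pos hx.1, mul_one]
        exact this.trans (le_abs_self _))
    rw [eLpNorm_congr_ae h0, eLpNorm_zero, nonpos_iff_eq_zero, ENNReal.ofReal_eq_zero] at h1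
    have : 0 < w0 * ((1/2:ℝ) - 0)^(1/q.toReal) := by
      have : (0:ℝ) < 1/2 - 0 := by norm_num
      positivity
    linarith
  · intro P hP
    by_contra hlt
    push Not at hlt
    have e : C0 / A * (n:ℝ)^(-(1/q.toReal)) * A = C0 * (n:ℝ)^(-(1/q.toReal)) := by field_simp
    rw [e] at hlt
    have hc : 0 < C0 * (n:ℝ)^(-(1/q.toReal)) := by positivity
    have := low2_op q hq hqt α β hα hβ n hn P hP _ hc hlt.le
    rw [← hw0] at this
    have e2 : (1/(128*(n:ℝ)))^(1/q.toReal) = (1/128)^(1/q.toReal) * (n:ℝ)^(-(1/q.toReal)) := by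
      rw [Real.rpow_neg hn0.le, ← Real.inv_rpow hn0.le, ← Real.mul_rpow (by norm_num) (by positivity)]
      congr 1; field_simp
    have e3 : 4 * (C0 * (n:ℝ)^(-(1/q.toReal)) / w0) =
      1/8 * ((1/128)^(1/q.toReal) * (n:ℝ)^(-(1/q.toReal))) := by
      rw [hC0]; field_simp; norm_num
    rw [e2, e3] at this
    have : 0 < (1/128)^(1/q.toReal) * (n:ℝ)^(-(1/q.toReal)) := by positivity
    linarith

lemma node_prod (i : ℕ) : ∀ k, i ≤ k → ∏ j ∈ (Finset.range (k+1)).erase i, ((i:ℝ) - j)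
    = (-1)^(k-i) * (i.factorial * (k-i).factorial) := by
  intro k hk
  induction k, hk using Nat.le_induction with
  | base =>
    rw [Finset.range_add_one, Finset.erase_insert (by simp)]
    simp only [Nat.sub_self, pow_zero, Nat.factorial_zero, Nat.cast_one, mul_one, one_mul]
    have h : ∀ i : ℕ, ∏ j ∈ Finset.range i, ((i:ℝ) - j) = i.factorial := by
      intro i
      induction i with
      | zero => simp
      | succ i ih =>
        rw [Finset.prod_range_succ', Nat.factorial_succ]
        push_cast
        rw [← ih]
        simp only [add_sub_add_right_eq_sub]
        ring
    exact h i
  | succ k hk ih =>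
    rw [Finset.range_add_one, Finset.erase_insert_of_ne (by omega), Finset.prod_insert (by simp), ih]
    have h1 : k + 1 - i = (k - i) + 1 := by omega
    rw [h1, Nat.factorial_succ]
    have h2 : ((k - i : ℕ):ℝ) = k - i := by push_cast [Nat.cast_sub hk]; ring
    push_cast
    rw [h2]
    ring

lemma kMon_fwd (k : ℕ) (f : ℝ → ℝ) (hf : kMonotoneOn k f) (x η : ℝ) (hη : 0 < η) (hx : -1 < x)
    (hx2 : x + k * η < 1) :
    0 ≤ ∑ i ∈ Finset.range (k+1), ((-1:ℝ)^(k-i) * (k.choose i)) * f (x + i * η) := by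
  have h := hf (fun i => x + (i:ℕ) * η) (by
    intro i j hij
    simp only [add_right_inj, mul_eq_mul_right_iff, Nat.cast_inj, hη.ne', or_false] at hij
    exact Fin.ext hij) (by
    intro i
    have h1 : ((i:ℕ):ℝ) ≤ k := by exact_mod_cast Nat.lt_succ_iff.1 i.2
    have h0 : (0:ℝ) ≤ ((i:ℕ):ℝ) := by positivity
    constructor
    · show -1 < x + ((i:ℕ):ℝ) * η
      nlinarith
    · show x + ((i:ℕ):ℝ) * η < 1
      nlinarith)
  have key : ∑ i : Fin (k+1), f (x + (i:ℕ) * η) / ∏ j ∈ Finset.univ.erase i, ((x + (i:ℕ) * η) - (x + (j:ℕ) * η))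
      = (η^k * k.factorial)⁻¹ * ∑ i ∈ Finset.range (k+1), ((-1:ℝ)^(k-i) * (k.choose i)) * f (x + i * η) := by
    rw [Finset.mul_sum, ← Fin.sum_univ_eq_sum_range (fun i => (η^k * k.factorial)⁻¹ * (((-1:ℝ)^(k-i) * (k.choose i)) * f (x + i * η)))]
    apply Finset.sum_congr rfl
    intro i _
    have hik : (i:ℕ) ≤ k := Nat.lt_succ_iff.1 i.2
    have e1 : ∏ j ∈ Finset.univ.erase i, ((x + (i:ℕ) * η) - (x + (j:ℕ) * η))
        = η^k * ∏ j ∈ (Finset.range (k+1)).erase i, (((i:ℕ):ℝ) - j) := by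
      have e2 : ∏ j ∈ (Finset.range (k+1)).erase i, (((i:ℕ):ℝ) - j)
          = ∏ j ∈ Finset.univ.erase i, (((i:ℕ):ℝ) - ((j:Fin (k+1)):ℕ)) := by
        refine (Finset.prod_bij (fun (a : Fin (k+1)) _ => (a:ℕ)) ?_ ?_ ?_ ?_).symm
        · intro a ha
          simp only [Finset.mem_erase, Finset.mem_univ, and_true] at ha
          simp only [Finset.mem_erase, Finset.mem_range]
          exact ⟨fun h => ha (Fin.ext h), a.2⟩
        · intro a _ b _ h
          exact Fin.ext h
        · intro b hb
          simp only [Finset.mem_erase, Finset.mem_range] at hb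
          exact ⟨⟨b, hb.2⟩, by simp [Fin.ext_iff, hb.1], rfl⟩
        · intro a _; rfl
      rw [e2]
      have hc : (Finset.univ.erase i).card = k := by simp
      have hpw : η^k = ∏ j ∈ Finset.univ.erase i, η := by rw [Finset.prod_const, hc]
      rw [hpw, ← Finset.prod_mul_distrib]
      apply Finset.prod_congr rfl
      intro j _; ring
    rw [e1, node_prod i k hik, Nat.cast_choose ℝ hik]
    have hs : ((-1:ℝ)^(k-(i:ℕ)))⁻¹ = (-1)^(k-(i:ℕ)) := by
      rw [← inv_pow]; norm_num
    rw [div_eq_mul_inv, mul_inv, mul_inv, hs]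
    have : ((k.factorial:ℕ):ℝ) ≠ 0 := by positivity
    field_simp
  rw [key] at h
  have hp : 0 < (η^k * (k.factorial:ℝ))⁻¹ := by positivity
  exact nonneg_of_mul_nonneg_right h hp

lemma fwd_neg : ∀ (k : ℕ) (g : ℝ → ℝ), ContDiff ℝ (⊤:ℕ∞) g → ∀ x η : ℝ, 0 < η →
    (∀ y ∈ Icc x (x + k * η), iteratedDeriv k g y < 0) → (fwdDiff η)^[k] g x < 0 := by
  intro k
  induction k with
  | zero => intro g hg x η hη h; simpa using h x (by simp)
  | succ k ih =>
    intro g hg x η hη h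
    rw [Function.iterate_succ_apply]
    have hg2 : ContDiff ℝ (⊤:ℕ∞) (fun y => g (y + η)) := hg.comp (by fun_prop)
    apply ih (fwdDiff η g) (hg2.sub hg) x η hη
    intro y hy
    have e : fwdDiff η g = (fun y => g (y + η)) - g := rfl
    rw [e, iteratedDeriv_sub ((hg2.of_le (by exact_mod_cast le_top)).contDiffAt) ((hg.of_le (by exact_mod_cast le_top)).contDiffAt),
      iteratedDeriv_comp_add_const]
    have hd : Differentiable ℝ (iteratedDeriv k g) :=
      hg.differentiable_iteratedDeriv k (by exact_mod_cast (WithTop.coe_lt_top k))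
    have ha : StrictAntiOn (iteratedDeriv k g) (Icc x (x + (k+1:ℕ) * η)) := by
      apply strictAntiOn_of_deriv_neg (convex_Icc _ _) hd.continuous.continuousOn
      intro z hz
      rw [← iteratedDeriv_succ]
      exact h z (interior_subset hz)
    have := ha (a := y) (b := y + η) ⟨hy.1, by push_cast; nlinarith [hy.2]⟩ ⟨by linarith [hy.1], by push_cast; nlinarith [hy.2]⟩ (by linarith)
    simp only
    linarith

lemma deriv_nonneg_of_fwd (k : ℕ) (g : ℝ → ℝ) (hg : ContDiff ℝ (⊤:ℕ∞) g) (b : ℝ)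
    (h : ∀ x η, 0 < η → -b < x → x + k * η < b →
      0 ≤ ∑ i ∈ Finset.range (k+1), ((-1:ℝ)^(k-i) * (k.choose i)) * g (x + i * η)) :
    ∀ x ∈ Ioo (-b) b, 0 ≤ iteratedDeriv k g x := by
  intro x hx
  by_contra hneg
  push Not at hneg
  have hc : Continuous (iteratedDeriv k g) := hg.continuous_iteratedDeriv k (by exact_mod_cast le_top)
  have hev : ∀ᶠ y in nhds x, iteratedDeriv k g y < 0 := hc.continuousAt.eventually (gt_mem_nhds hneg)
  obtain ⟨δ, hδ, hball⟩ := Metric.eventually_nhds_iff.1 hev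
  set η := min δ (b - x) / (2 * (k+1)) with hηd
  have hm : 0 < min δ (b - x) := lt_min hδ (by linarith [hx.2])
  have hη : 0 < η := by positivity
  have hkη : k * η < min δ (b-x) := by
    have : η * (2 * (k+1)) = min δ (b-x) := by rw [hηd]; field_simp
    nlinarith
  have h1 := fwd_neg k g hg x η hη (by
    intro y hy
    apply hball
    rw [Real.dist_eq, abs_of_nonneg (by linarith [hy.1])]
    linarith [hy.2, min_le_left δ (b-x)])
  have h2 := h x η hη hx.1 (by linarith [min_le_right δ (b-x)])
  rw [fwdDiff_iter_eq_sum_shift] at h1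
  have : ∑ i ∈ Finset.range (k+1), ((-1:ℝ)^(k-i) * (k.choose i)) * g (x + i * η)
      = ∑ i ∈ Finset.range (k + 1), ((-1 : ℤ) ^ (k - i) * k.choose i) • g (x + i • η) := by
    apply Finset.sum_congr rfl
    intro i _
    simp
  linarith

lemma mollify (k : ℕ) (f : ℝ → ℝ) (hf : Measurable f) (hkm : kMonotoneOn k f) (q : ℝ≥0∞)
    (hq : 1 ≤ q) (hqt : q ≠ ∞) (b b' : ℝ) (hb : 0 < b) (hbb : b < b') (hb1 : b' < 1)
    (hmem : MemLp f q (volume.restrict (Icc (-b') b'))) (ε : ℝ) (hε : 0 < ε) :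
    ∃ g : ℝ → ℝ, ContDiff ℝ (⊤:ℕ∞) g ∧ (∀ x ∈ Ioo (-b) b, 0 ≤ iteratedDeriv k g x) ∧
      eLpNorm (fun x => f x - g x) q (volume.restrict (Icc (-b) b)) ≤ ENNReal.ofReal ε ∧
      (∀ M, 0 ≤ M → (∀ᵐ x, x ∈ Icc (-1:ℝ) 1 → |f x| ≤ M) → ∀ x, |g x| ≤ M) := by
  set F : ℝ → ℝ := indicator (Icc (-b') b') f with hFd
  have hFm : Measurable F := hf.indicator measurableSet_Icc
  have hFq : MemLp F q volume := (memLp_indicator_iff_restrict measurableSet_Icc).2 hmem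
  have hFi : Integrable F volume := by
    rw [hFd, integrable_indicator_iff measurableSet_Icc]
    exact hmem.integrable hq
  have hε6 : 0 < ε / 6 := by positivity
  obtain ⟨c, hcs, hcn, hcc, hcq⟩ := hFq.exists_hasCompactSupport_eLpNorm_sub_le hqt
    (ε := ENNReal.ofReal (ε/12)) (by simp; linarith)
  have hcu : UniformContinuous c := hcs.uniformContinuous_of_continuous hcc
  obtain ⟨δ, hδ, hδc⟩ := Metric.uniformContinuous_iff.1 hcu (ε/6) hε6
  set R : ℝ := min δ (min 1 (b' - b)) with hRd
  have hR : 0 < R := lt_min hδ (lt_min one_pos (by linarith))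
  have hR1 : R ≤ 1 := (min_le_right _ _).trans (min_le_left _ _)
  have hRb : R ≤ b' - b := (min_le_right _ _).trans (min_le_right _ _)
  let φ : ContDiffBump (0:ℝ) := ⟨R/2, R, by positivity, by linarith⟩
  set V : ℝ → ℝ := φ.normed volume with hVd
  have hVc : Continuous V := φ.continuous_normed
  have hV0 : ∀ s, 0 ≤ V s := φ.nonneg_normed
  have hVi : Integrable V volume := φ.integrable_normed
  have hV1 : ∫ s, V s = 1 := φ.integral_normed
  have hVs : ∀ s, R ≤ |s| → V s = 0 := by
    intro s hs
    by_contra h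
    have : s ∈ Function.support V := h
    rw [hVd, φ.support_normed_eq] at this
    simp only [Metric.mem_ball, dist_zero_right, Real.norm_eq_abs] at this
    exact absurd this (not_lt.2 hs)
  have hVb : ∃ K, ∀ s, ‖V s‖ ≤ K :=
    φ.hasCompactSupport_normed.exists_bound_of_continuous hVc
  obtain ⟨K, hK⟩ := hVb
  have hint : ∀ (H : ℝ → ℝ), Integrable H volume → ∀ x, Integrable (fun s => V s * H (x - s)) volume := by
    intro H hH x
    exact (hH.comp_sub_left x).bdd_mul hVc.aestronglyMeasurable (ae_of_all _ hK)
  set g : ℝ → ℝ := convolution V F (ContinuousLinearMap.lsmul ℝ ℝ) volume with hgd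
  have hg : ∀ x, g x = ∫ s, V s * F (x - s) := fun x => by
    simp [hgd, convolution_def]
  have hgs : ContDiff ℝ (⊤:ℕ∞) g := by
    apply HasCompactSupport.contDiff_convolution_left
    · exact φ.hasCompactSupport_normed
    · exact φ.contDiff_normed
    · exact hFi.locallyIntegrable
  refine ⟨g, hgs, ?_, ?_, ?_⟩
  · apply deriv_nonneg_of_fwd k g hgs b
    intro x η hη hx hx2
    have : ∑ i ∈ Finset.range (k+1), ((-1:ℝ)^(k-i) * (k.choose i)) * g (x + i * η)
        = ∫ s, ∑ i ∈ Finset.range (k+1), ((-1:ℝ)^(k-i) * (k.choose i)) * (V s * F (x + i * η - s)) := by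
      rw [integral_finsetSum]
      · apply Finset.sum_congr rfl
        intro i _
        rw [hg, integral_const_mul]
      · intro i _
        exact (hint F hFi _).const_mul _
    rw [this]
    apply integral_nonneg
    intro s
    show 0 ≤ ∑ i ∈ Finset.range (k+1), ((-1:ℝ)^(k-i) * (k.choose i)) * (V s * F (x + i * η - s))
    by_cases hs : R ≤ |s|
    · simp [hVs s hs]
    push Not at hs
    rw [abs_lt] at hs
    have e : ∑ i ∈ Finset.range (k+1), ((-1:ℝ)^(k-i) * (k.choose i)) * (V s * F (x + i * η - s))
        = V s * ∑ i ∈ Finset.range (k+1), ((-1:ℝ)^(k-i) * (k.choose i)) * f ((x - s) + i * η) := by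
      rw [Finset.mul_sum]
      apply Finset.sum_congr rfl
      intro i hi
      have h1 : (i:ℝ) ≤ k := by exact_mod_cast Nat.lt_succ_iff.1 (Finset.mem_range.1 hi)
      have h2 : (0:ℝ) ≤ i * η := by positivity
      have h3 : (i:ℝ) * η ≤ k * η := by gcongr
      have hmm : x + i * η - s ∈ Icc (-b') b' := ⟨by linarith, by linarith⟩
      rw [hFd, indicator_of_mem hmm]
      rw [show x + i * η - s = x - s + i * η by ring]
      ring
    rw [e]
    exact mul_nonneg (hV0 s) (kMon_fwd k f hkm _ _ hη (by linarith) (by linarith))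
  · -- convergence
    have hci : Integrable c volume := hcc.integrable_of_hasCompactSupport hcs
    set A : ℝ → ℝ := fun x => ∫ s, V s * (F (x - s) - c (x - s)) with hA
    set D : ℝ → ℝ := fun x => ∫ s, V s * c (x - s) with hD
    have hgA : ∀ x, g x = A x + D x := by
      intro x
      rw [hg, hA, hD]
      simp only
      rw [← integral_add]
      · apply integral_congr_ae; apply ae_of_all; intro s; simp only; ring
      · exact hint (F - c) (hFi.sub hci) x
      · exact hint c hci x
    have hDc : ∀ x, |D x - c x| ≤ ε/6 := by
      intro x
      have := φ.dist_normed_convolution_le (μ := volume) (g := c) (x₀ := x) (ε := ε/6) hcc.aestronglyMeasurable (by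
        intro y hy
        apply le_of_lt
        apply hδc
        exact lt_of_lt_of_le (Metric.mem_ball.1 hy) (min_le_left _ _))
      rw [Real.dist_eq] at this
      simpa [convolution_def, hD] using this
    have hAn : eLpNorm A q volume ≤ ENNReal.ofReal (3 * (ε/12)) := by
      refine op_norm q hq hqt volume V hVc ?_ (fun x s => F (x - s) - c (x - s)) ?_ (ε/12) (by positivity) ?_ A ?_
      · rw [intervalIntegral.integral_of_le (by linarith [Real.pi_pos])]
        calc ∫ s in Ioc (-Real.pi) Real.pi, |V s| ≤ ∫ s, |V s| :=
              setIntegral_le_integral hVi.abs (ae_of_all _ fun _ => abs_nonneg _)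
          _ = ∫ s, V s := by simp_rw [abs_of_nonneg (hV0 _)]
          _ ≤ 3 := by rw [hV1]; norm_num
      · have := (hFm.sub hcc.measurable).comp (measurable_fst.sub measurable_snd : Measurable fun z : ℝ × ℝ => z.1 - z.2)
        exact this
      · intro s
        have hmp : MeasurePreserving (fun x : ℝ => x - s) volume volume := measurePreserving_sub_right volume s
        have := eLpNorm_comp_measurePreserving (p := q) (g := F - c) ((hFm.sub hcc.measurable).aestronglyMeasurable) hmp
        calc _ = eLpNorm ((F - c) ∘ fun x => x - s) q volume := rfl
          _ ≤ _ := by rw [this]; exact hcn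
      · apply ae_of_all
        intro x
        rw [intervalIntegral.integral_of_le (by linarith [Real.pi_pos]), hA]
        simp only
        rw [setIntegral_eq_integral_of_forall_compl_eq_zero]
        · apply integral_congr_ae; apply ae_of_all; intro s; simp only; ring
        · intro s hs
          rw [hVs s, mul_zero]
          by_contra h
          push Not at h
          rw [abs_lt] at h
          exact hs ⟨by linarith [Real.pi_gt_three], by linarith [Real.pi_gt_three]⟩
    have hAm : AEStronglyMeasurable A volume := by
      have : A = fun x => g x - D x := by funext x; rw [hgA]; ring
      rw [this]
      apply hgs.continuous.aestronglyMeasurable.sub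
      have : D = convolution V c (ContinuousLinearMap.lsmul ℝ ℝ) volume := by
        funext x; simp [convolution_def, hD]
      rw [this]
      exact (HasCompactSupport.continuous_convolution_left (ContinuousLinearMap.lsmul ℝ ℝ) φ.hasCompactSupport_normed hVc hci.locallyIntegrable).aestronglyMeasurable
    have hDm : AEStronglyMeasurable D volume := by
      have : D = fun x => g x - A x := by funext x; rw [hgA]; ring
      rw [this]
      exact hgs.continuous.aestronglyMeasurable.sub hAm
    have e1 : eLpNorm (fun x => f x - g x) q (volume.restrict (Icc (-b) b))
        = eLpNorm (((F - c) - A) - (D - c)) q (volume.restrict (Icc (-b) b)) := by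
      apply eLpNorm_congr_ae
      rw [EventuallyEq, ae_restrict_iff' measurableSet_Icc]
      apply ae_of_all
      intro x hx
      have hx' : x ∈ Icc (-b') b' := ⟨by linarith [hx.1], by linarith [hx.2]⟩
      simp only [Pi.sub_apply, hgA, hFd, indicator_of_mem hx']
      ring
    rw [e1]
    have hFc : AEStronglyMeasurable (F - c) volume := (hFm.sub hcc.measurable).aestronglyMeasurable
    have hDcm : AEStronglyMeasurable (D - c) volume := hDm.sub hcc.aestronglyMeasurable
    refine (eLpNorm_sub_le ((hFc.sub hAm).restrict) hDcm.restrict hq).trans ?_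
    have b1 : eLpNorm (F - c - A) q (volume.restrict (Icc (-b) b)) ≤ ENNReal.ofReal (ε/12) + ENNReal.ofReal (3*(ε/12)) := by
      refine (eLpNorm_sub_le hFc.restrict hAm.restrict hq).trans ?_
      exact add_le_add ((eLpNorm_mono_measure _ Measure.restrict_le_self).trans hcn)
        ((eLpNorm_mono_measure _ Measure.restrict_le_self).trans hAn)
    have b2 : eLpNorm (D - c) q (volume.restrict (Icc (-b) b)) ≤ ENNReal.ofReal (ε/6 * (b - (-b))^(1/q.toReal)) :=
      eLp_upper_const q hq hqt (-b) b (ε/6) (by linarith) hε6.le _ (fun x _ => hDc x)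
    refine (add_le_add b1 b2).trans ?_
    rw [← ENNReal.ofReal_add (by positivity) (by positivity), ← ENNReal.ofReal_add (by positivity) (by apply mul_nonneg hε6.le; apply Real.rpow_nonneg; linarith)]
    apply ENNReal.ofReal_le_ofReal
    have hq1 : 1 ≤ q.toReal := by
      rw [← ENNReal.toReal_one]; exact ENNReal.toReal_mono hqt hq
    have : (b - (-b))^(1/q.toReal) ≤ 2 := by
      calc (b - (-b))^(1/q.toReal) ≤ (2:ℝ)^(1/q.toReal) := by
            apply Real.rpow_le_rpow (by linarith) (by linarith) (by positivity)
        _ ≤ (2:ℝ)^(1:ℝ) := by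
            apply Real.rpow_le_rpow_of_exponent_le (by norm_num)
            rw [div_le_one (by linarith)]; exact hq1
        _ = 2 := by norm_num
    nlinarith
  · intro M hM hfM x
    have hFM : ∀ᵐ y, |F y| ≤ M := by
      filter_upwards [hfM] with y hy
      rw [hFd]
      by_cases h : y ∈ Icc (-b') b'
      · rw [indicator_of_mem h]; exact hy ⟨by linarith [h.1], by linarith [h.2]⟩
      · rw [indicator_of_notMem h]; simpa using hM
    have hFx : ∀ᵐ s, |F (x - s)| ≤ M :=
      (Measure.measurePreserving_sub_left volume x).quasiMeasurePreserving.ae hFM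
    rw [hg, ← Real.norm_eq_abs]
    calc ‖∫ s, V s * F (x - s)‖ ≤ ∫ s, V s * M := by
          apply norm_integral_le_of_norm_le (hVi.mul_const M)
          filter_upwards [hFx] with s hs
          rw [norm_mul, Real.norm_eq_abs, Real.norm_eq_abs, abs_of_nonneg (hV0 s)]
          exact mul_le_mul_of_nonneg_left hs (hV0 s)
      _ = M := by rw [integral_mul_const, hV1, one_mul]

lemma ibp_iter (k : ℕ) : ∀ (g η : ℝ → ℝ), ContDiff ℝ (⊤:ℕ∞) g → ContDiff ℝ (⊤:ℕ∞) η → HasCompactSupport η →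
    ∫ t, η t * iteratedDeriv k g t = (-1)^k * ∫ t, iteratedDeriv k η t * g t := by
  induction k with
  | zero => intro g η _ _ _; simp
  | succ k ih =>
    intro g η hg hη hs
    have hd : Differentiable ℝ (iteratedDeriv k g) :=
      hg.differentiable_iteratedDeriv k (by exact_mod_cast (WithTop.coe_lt_top k))
    have hηd : Differentiable ℝ η := hη.differentiable (by simp)
    have hη' : ContDiff ℝ (⊤:ℕ∞) (deriv η) := (contDiff_infty_iff_deriv.1 hη).2
    have hs' : HasCompactSupport (deriv η) := hs.deriv
    have hc1 : Continuous (iteratedDeriv (k+1) g) := hg.continuous_iteratedDeriv (k+1) (by exact_mod_cast le_top)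
    have h1 := integral_mul_deriv_eq_deriv_mul_of_integrable (u := η) (v := iteratedDeriv k g) (u' := deriv η)
      (v' := iteratedDeriv (k+1) g) (fun x _ => (hηd x).hasDerivAt)
      (fun x _ => by rw [iteratedDeriv_succ]; exact (hd x).hasDerivAt)
      ((hη.continuous.mul hc1).integrable_of_hasCompactSupport hs.mul_right)
      ((hη'.continuous.mul hd.continuous).integrable_of_hasCompactSupport hs'.mul_right)
      ((hη.continuous.mul hd.continuous).integrable_of_hasCompactSupport hs.mul_right)
    rw [h1, ih g (deriv η) hg hη' hs', ← iteratedDeriv_succ', pow_succ]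
    ring

lemma block_raw (k : ℕ) : ∃ K > (0:ℝ), ∀ g : ℝ → ℝ, ContDiff ℝ (⊤:ℕ∞) g → ∀ c u : ℝ, 0 < u →
    (∀ t ∈ Icc (c - 2*u) (c + 2*u), 0 ≤ iteratedDeriv k g t) →
    ∫ t in (c-u)..(c+u), iteratedDeriv k g t ≤ K * (u^k)⁻¹ * ∫ t in (c-2*u)..(c+2*u), |g t| := by
  let φ : ContDiffBump (0:ℝ) := ⟨1, 2, by norm_num, by norm_num⟩
  have hφ : ContDiff ℝ (⊤:ℕ∞) φ := φ.contDiff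
  have hφk : Continuous (iteratedDeriv k φ) := hφ.continuous_iteratedDeriv k (by exact_mod_cast le_top)
  have hφz : ∀ x : ℝ, 2 ≤ |x| → φ x = 0 := fun x hx => φ.zero_of_le_dist (by simpa using hx)
  have hφ1 : ∀ x : ℝ, |x| ≤ 1 → φ x = 1 := fun x hx => φ.one_of_mem_closedBall (by simpa using hx)
  have hz : ∀ x : ℝ, 2 < |x| → iteratedDeriv k φ x = 0 := by
    intro x hx
    have : (φ : ℝ → ℝ) =ᶠ[nhds x] (fun _ => (0:ℝ)) := by
      have := (isOpen_lt continuous_const continuous_abs).mem_nhds (show x ∈ {y : ℝ | 2 < |y|} from hx)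
      filter_upwards [this] with y hy
      exact hφz y (le_of_lt hy)
    rw [this.iteratedDeriv_eq]
    simp [iteratedDeriv_const]
  obtain ⟨K, hK⟩ := (isCompact_Icc (a := (-2:ℝ)) (b := 2)).exists_bound_of_continuousOn hφk.continuousOn
  have hKall : ∀ x, |iteratedDeriv k φ x| ≤ |K| := by
    intro x
    by_cases h : 2 < |x|
    · rw [hz x h]; simp
    · push Not at h
      exact (hK x (abs_le.1 h)).trans (le_abs_self K)
  refine ⟨|K| + 1, by positivity, ?_⟩
  intro g hg c u hu hpos
  set η : ℝ → ℝ := fun t => φ (u⁻¹ * (t - c)) with hη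
  have hηs : ContDiff ℝ (⊤:ℕ∞) η := hφ.comp (by fun_prop)
  have habs : ∀ t, |u⁻¹ * (t - c)| = |t - c| / u := by
    intro t; rw [abs_mul, abs_of_pos (inv_pos.2 hu)]; field_simp
  have hη0 : ∀ t, t ∉ Icc (c-2*u) (c+2*u) → η t = 0 := by
    intro t ht
    apply hφz
    rw [habs, le_div_iff₀ hu]
    by_contra h
    push Not at h
    rw [abs_lt] at h
    exact ht ⟨by linarith, by linarith⟩
  have hηc : HasCompactSupport η := HasCompactSupport.intro isCompact_Icc hη0
  have hηk : ∀ t, iteratedDeriv k η t = (u⁻¹)^k * iteratedDeriv k φ (u⁻¹ * (t - c)) := by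
    intro t
    have e := congrFun (iteratedDeriv_comp_sub_const (n := k) (f := fun y => φ (u⁻¹ * y)) (s := c)) t
    have e2 := congrFun (iteratedDeriv_comp_const_mul (n := k) (f := φ) (hφ.of_le (by exact_mod_cast le_top)) u⁻¹) (t - c)
    exact e.trans e2
  have hgk : Continuous (iteratedDeriv k g) := hg.continuous_iteratedDeriv k (by exact_mod_cast le_top)
  have hint : Integrable (fun t => η t * iteratedDeriv k g t) volume :=
    (hηs.continuous.mul hgk).integrable_of_hasCompactSupport hηc.mul_right
  have hnn : ∀ t, 0 ≤ η t * iteratedDeriv k g t := by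
    intro t
    by_cases h : t ∈ Icc (c-2*u) (c+2*u)
    · exact mul_nonneg φ.nonneg (hpos t h)
    · rw [hη0 t h, zero_mul]
  have h1 : ∫ t in (c-u)..(c+u), iteratedDeriv k g t ≤ ∫ t, η t * iteratedDeriv k g t := by
    rw [intervalIntegral.integral_of_le (by linarith)]
    calc ∫ t in Ioc (c-u) (c+u), iteratedDeriv k g t = ∫ t in Ioc (c-u) (c+u), η t * iteratedDeriv k g t := by
          apply setIntegral_congr_fun measurableSet_Ioc
          intro t ht
          have : η t = 1 := by
            apply hφ1
            rw [habs, div_le_one hu, abs_le]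
            exact ⟨by linarith [ht.1], by linarith [ht.2]⟩
          simp only [this, one_mul]
      _ ≤ _ := setIntegral_le_integral hint (ae_of_all _ hnn)
  have h2 : ∫ t, η t * iteratedDeriv k g t ≤ |∫ t, iteratedDeriv k η t * g t| := by
    rw [ibp_iter k g η hg hηs hηc]
    refine (le_abs_self _).trans ?_
    rw [abs_mul, abs_pow]; simp
  have h3 : ∫ t, iteratedDeriv k η t * g t = ∫ t in (c-2*u)..(c+2*u), iteratedDeriv k η t * g t := by
    rw [intervalIntegral.integral_of_le (by linarith), ← integral_Icc_eq_integral_Ioc, setIntegral_eq_integral_of_forall_compl_eq_zero]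
    intro t ht
    rw [hηk, hz, mul_zero, zero_mul]
    rw [habs, lt_div_iff₀ hu]
    by_contra h
    push Not at h
    rw [abs_le] at h
    exact ht ⟨by linarith, by linarith⟩
  rw [h3] at h2
  refine h1.trans (h2.trans ?_)
  rw [← intervalIntegral.integral_const_mul, ← Real.norm_eq_abs]
  apply intervalIntegral.norm_integral_le_of_norm_le (by linarith)
  · apply ae_of_all
    intro t _
    rw [norm_mul, Real.norm_eq_abs, Real.norm_eq_abs, hηk, abs_mul, abs_pow, abs_of_pos (inv_pos.2 hu), inv_pow]
    apply mul_le_mul_of_nonneg_right _ (abs_nonneg _)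
    rw [mul_comm]
    apply mul_le_mul_of_nonneg_right _ (by positivity)
    linarith [hKall (u⁻¹ * (t-c))]
  · exact (continuous_const.mul hg.continuous.abs).intervalIntegrable _ _

/-- integral bound from weighted norm -/
def GoodG (k : ℕ) (α β r d : ℝ) (g : ℝ → ℝ) : Prop :=
  ContDiff ℝ (⊤:ℕ∞) g ∧ (∀ t ∈ Icc (-(1 - d/4)) (1 - d/4), 0 ≤ iteratedDeriv k g t) ∧
  ∀ A B W : ℝ, -(1 - d/4) ≤ A → A < B → B ≤ 1 - d/4 → d ≤ B - A → 0 < W →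
    (∀ t ∈ Icc A B, W ≤ jacobi α β t) → ∫ t in A..B, |g t| ≤ 2 * W⁻¹ * (B - A)^(1 - r)

lemma block (k : ℕ) (α β : ℝ) (hα : 0 ≤ α) (hβ : 0 ≤ β) : ∃ C > (0:ℝ), ∀ (r d : ℝ) (g : ℝ → ℝ),
    0 ≤ r → r ≤ 1 → 0 < d → GoodG k α β r d g → ∀ s, d ≤ s → s ≤ 1/2 →
    (∫ t in (1-2*s)..(1-s), iteratedDeriv k g t ≤ C * s^(1 - k - r - β)) ∧
    (∫ t in (-1+s)..(-1+2*s), iteratedDeriv k g t ≤ C * s^(1 - k - r - α)) := by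
  obtain ⟨K, hK, hraw⟩ := block_raw k
  refine ⟨K * 2^k * (4 * (2^α * 2^β)), by positivity, ?_⟩
  intro r d g hr hr1 hd ⟨hg, hnn, hG⟩ s hds hs
  have hs0 : 0 < s := by linarith
  have hfin : ∀ γ : ℝ, K * ((s/2)^k)⁻¹ * (2 * ((2^α*2^β)⁻¹ * s^γ)⁻¹ * (2*s)^(1-r)) ≤ K * 2^k * (4 * (2^α * 2^β)) * s^(1-k-r-γ) := by
    intro γ
    have e1 : s^(1-k-r-γ) = s^(1-r) * (s^k)⁻¹ * (s^γ)⁻¹ := by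
      rw [← Real.rpow_natCast, ← Real.rpow_neg hs0.le, ← Real.rpow_neg hs0.le, ← Real.rpow_add hs0, ← Real.rpow_add hs0]
      congr 1; ring
    have e2 : (2:ℝ)^(1-r) ≤ 2 := by
      calc (2:ℝ)^(1-r) ≤ 2^(1:ℝ) := Real.rpow_le_rpow_of_exponent_le (by norm_num) (by linarith)
        _ = 2 := by norm_num
    rw [e1, Real.mul_rpow (by norm_num) hs0.le, div_pow, mul_inv, inv_inv, inv_div]
    have h0 : 0 < s^γ := Real.rpow_pos_of_pos hs0 _
    have h1 : 0 < s^(1-r) := Real.rpow_pos_of_pos hs0 _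
    have h2 : (0:ℝ) < 2^α*2^β := by positivity
    calc K * (2^k/s^k) * (2 * (2^α*2^β*(s^γ)⁻¹) * (2^(1-r) * s^(1-r)))
        ≤ K * (2^k/s^k) * (2 * (2^α*2^β*(s^γ)⁻¹) * (2 * s^(1-r))) := by gcongr
      _ = _ := by rw [div_eq_mul_inv]; ring
  have hp2 : ∀ γ : ℝ, 0 ≤ γ → ∀ y : ℝ, 1/2 ≤ y → ((2:ℝ)^γ)⁻¹ ≤ y^γ := by
    intro γ hγ y hy
    rw [← Real.inv_rpow (by norm_num)]
    exact Real.rpow_le_rpow (by norm_num) (by linarith) hγ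
  have hp3 : ∀ γ : ℝ, 0 ≤ γ → ∀ y : ℝ, s/2 ≤ y → ((2:ℝ)^γ)⁻¹ * s^γ ≤ y^γ := by
    intro γ hγ y hy
    rw [← Real.inv_rpow (by norm_num), ← Real.mul_rpow (by norm_num) hs0.le]
    exact Real.rpow_le_rpow (by positivity) (by linarith) hγ
  constructor
  · have h := hraw g hg (1 - 3*s/2) (s/2) (by linarith) (fun t ht => hnn t ⟨by linarith [ht.1], by linarith [ht.2]⟩)
    have h2 := hG (1 - 3*s/2 - 2*(s/2)) (1 - 3*s/2 + 2*(s/2)) ((2^α*2^β)⁻¹ * s^β) (by linarith) (by linarith)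
      (by linarith) (by linarith) (by positivity) (by
        intro t ht
        rw [jacobi, mul_inv, mul_assoc]
        exact mul_le_mul (hp2 α hα _ (by linarith [ht.1])) (hp3 β hβ _ (by linarith [ht.2])) (by positivity) (Real.rpow_nonneg (by linarith [ht.1]) _))
    have e : 1 - 3*s/2 + 2*(s/2) - (1 - 3*s/2 - 2*(s/2)) = 2*s := by ring
    rw [e] at h2
    have e1 : 1 - 3*s/2 - s/2 = 1 - 2*s := by ring
    have e2 : 1 - 3*s/2 + s/2 = 1 - s := by ring
    rw [e1, e2] at h
    refine h.trans (le_trans ?_ (hfin β))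
    exact mul_le_mul_of_nonneg_left h2 (by positivity)
  · have h := hraw g hg (-1 + 3*s/2) (s/2) (by linarith) (fun t ht => hnn t ⟨by linarith [ht.1], by linarith [ht.2]⟩)
    have h2 := hG (-1 + 3*s/2 - 2*(s/2)) (-1 + 3*s/2 + 2*(s/2)) ((2^α*2^β)⁻¹ * s^α) (by linarith) (by linarith)
      (by linarith) (by linarith) (by positivity) (by
        intro t ht
        rw [jacobi, mul_inv, mul_right_comm]
        exact mul_le_mul (hp3 α hα _ (by linarith [ht.1])) (hp2 β hβ _ (by linarith [ht.2])) (by positivity) (Real.rpow_nonneg (by linarith [ht.1]) _))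
    have e : -1 + 3*s/2 + 2*(s/2) - (-1 + 3*s/2 - 2*(s/2)) = 2*s := by ring
    rw [e] at h2
    have e1 : -1 + 3*s/2 - s/2 = -1 + s := by ring
    have e2 : -1 + 3*s/2 + s/2 = -1 + 2*s := by ring
    rw [e1, e2] at h
    refine h.trans (le_trans ?_ (hfin α))
    exact mul_le_mul_of_nonneg_left h2 (by positivity)

open Polynomial in
lemma core_poly (κ N : ℕ) (a : ℝ) (c : ℕ → ℝ → ℝ) (hc : ∀ j, Continuous (c j)) (h : ℝ → ℝ) (hh : Continuous h) :
    ∃ P : ℝ[X], P.natDegree ≤ N + κ ∧ ∀ x, P.eval x =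
      ∫ t in (-a)..a, (x - t)^κ * (∑ j ∈ Finset.range (N+1), c j t * x^j) * h t := by
  refine ⟨∑ i ∈ Finset.range (κ+1), ∑ j ∈ Finset.range (N+1),
    C (∫ t in (-a)..a, (-t)^(κ-i) * (κ.choose i) * c j t * h t) * X^(i+j), ?_, ?_⟩
  · apply natDegree_sum_le_of_forall_le
    intro i hi
    apply natDegree_sum_le_of_forall_le
    intro j hj
    refine (natDegree_C_mul_X_pow_le _ _).trans ?_
    have := Finset.mem_range.1 hi
    have := Finset.mem_range.1 hj
    omega
  · intro x
    have hcont : ∀ i j, Continuous (fun t => x^(i+j) * ((-t)^(κ-i) * (κ.choose i) * c j t * h t)) := by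
      intro i j
      have := hc j
      fun_prop
    have e : ∀ t, (x - t)^κ * (∑ j ∈ Finset.range (N+1), c j t * x^j) * h t
        = ∑ i ∈ Finset.range (κ+1), ∑ j ∈ Finset.range (N+1), x^(i+j) * ((-t)^(κ-i) * (κ.choose i) * c j t * h t) := by
      intro t
      rw [sub_eq_add_neg, add_pow, Finset.sum_mul_sum, Finset.sum_mul]
      apply Finset.sum_congr rfl
      intro i _
      rw [Finset.sum_mul]
      apply Finset.sum_congr rfl
      intro j _
      rw [pow_add]; ring
    simp_rw [e]
    rw [intervalIntegral.integral_finsetSum]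
    · simp only [eval_finsetSum, eval_mul, eval_C, eval_pow, eval_X]
      apply Finset.sum_congr rfl
      intro i _
      rw [intervalIntegral.integral_finsetSum]
      · apply Finset.sum_congr rfl
        intro j _
        rw [intervalIntegral.integral_const_mul]
        ring
      · intro j _
        exact (hcont i j).intervalIntegrable _ _
    · intro i _
      exact (continuous_finsetSum _ (fun j _ => hcont i j)).intervalIntegrable _ _

def rho (m : ℕ) (t : ℝ) : ℝ := √(1 - t^2)/m + 1/(m:ℝ)^2

lemma rho_facts (m : ℕ) (hm : 1 ≤ m) (t : ℝ) (ht : t ∈ Icc (-(1 - 1/(m:ℝ)^2)) (1 - 1/(m:ℝ)^2)) :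
    0 < rho m t ∧ rho m t ≤ 3 * (1 - t) ∧ rho m t ≤ 3 * (1 + t) ∧ rho m t ≤ 2 * √(1 - t^2) / m := by
  have hm0 : (0:ℝ) < m := by exact_mod_cast hm
  have hd : 0 < 1/(m:ℝ)^2 := by positivity
  have hd1 : 1/(m:ℝ)^2 = (1/m)^2 := by rw [div_pow, one_pow]
  set y : ℝ := 1/m with hy
  have hy0 : 0 < y := by positivity
  rw [hd1] at ht
  obtain ⟨h1, h2⟩ := ht
  have ht2 : y^2 ≤ 1 - t^2 := by
    by_cases h : 0 ≤ t <;> nlinarith [sq_nonneg y]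
  set s := √(1 - t^2) with hs
  have hs0 : 0 ≤ s := Real.sqrt_nonneg _
  have hss : s^2 = 1 - t^2 := Real.sq_sqrt (by nlinarith [sq_nonneg y])
  have hys : y ≤ s := by
    apply Real.le_sqrt_of_sq_le; exact ht2
  have e : rho m t = s * y + y^2 := by
    rw [rho, hd1, hy]; ring
  rw [e]
  refine ⟨by positivity, ?_, ?_, ?_⟩
  · nlinarith [sq_nonneg (s - 2*y)]
  · nlinarith [sq_nonneg (s - 2*y)]
  · rw [show 2 * s / m = 2 * s * y by rw [hy]; ring]
    nlinarith

lemma core_pt (κ : ℕ) (α β : ℝ) (hα : 0 ≤ α) (hβ : 0 ≤ β) (ρ C0 x t E : ℝ) (hρ : 0 < ρ) (hC0 : 0 ≤ C0)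
    (hx : x ∈ Icc (-1:ℝ) 1) (ht : t ∈ Icc (-1:ℝ) 1) (h1 : ρ ≤ 3 * (1 - t)) (h2 : ρ ≤ 3 * (1 + t)) (hE0 : 0 ≤ E)
    (hE : E * (1 + |x - t|/ρ)^(κ + 2 + ⌈α+β⌉₊) ≤ C0) :
    jacobi α β x * |x - t|^κ * E ≤ 3^(α+β) * C0 * jacobi α β t * ρ^κ * ((1 + |x-t|/ρ)^2)⁻¹ := by
  set z := |x - t|/ρ with hz
  have hz0 : 0 ≤ z := by positivity
  have hzr : |x - t| = z * ρ := by rw [hz]; field_simp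
  have hp : 0 < 1 + z := by linarith
  have hab := abs_le.1 (le_of_eq hzr)
  have hb : (1 - x)^β ≤ 3^β * (1-t)^β * (1+z)^β := by
    rw [← Real.mul_rpow (by norm_num) (by linarith [ht.2]), ← Real.mul_rpow (by linarith [ht.2]) hp.le]
    apply Real.rpow_le_rpow (by linarith [hx.2]) _ hβ
    nlinarith [ht.2]
  have ha : (1 + x)^α ≤ 3^α * (1+t)^α * (1+z)^α := by
    rw [← Real.mul_rpow (by norm_num) (by linarith [ht.1]), ← Real.mul_rpow (by linarith [ht.1]) hp.le]
    apply Real.rpow_le_rpow (by linarith [hx.1]) _ hα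
    nlinarith [ht.1]
  have hjt : 0 ≤ jacobi α β t := jacobi_nonneg α β ht
  have hj : jacobi α β x ≤ 3^(α+β) * jacobi α β t * (1+z)^⌈α+β⌉₊ := by
    calc jacobi α β x ≤ (3^α * (1+t)^α * (1+z)^α) * (3^β * (1-t)^β * (1+z)^β) := by
          rw [jacobi]
          apply mul_le_mul ha hb (Real.rpow_nonneg (by linarith [hx.2]) _)
          have := Real.rpow_nonneg (show 0 ≤ 1 + t by linarith [ht.1]) α
          positivity
      _ = 3^(α+β) * jacobi α β t * (1+z)^(α+β) := by
          rw [jacobi, Real.rpow_add (by norm_num), Real.rpow_add hp]; ring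
      _ ≤ _ := by
          apply mul_le_mul_of_nonneg_left _ (by positivity)
          rw [← Real.rpow_natCast]
          exact Real.rpow_le_rpow_of_exponent_le (by linarith) (Nat.le_ceil _)
  have hE' : E * (1+z)^(κ + ⌈α+β⌉₊) ≤ C0 * ((1+z)^2)⁻¹ := by
    rw [← div_eq_mul_inv, le_div_iff₀ (by positivity)]
    calc E * (1+z)^(κ + ⌈α+β⌉₊) * (1+z)^2 = E * (1+z)^(κ + 2 + ⌈α+β⌉₊) := by rw [mul_assoc, ← pow_add]; congr 2; ring
      _ ≤ C0 := hE
  calc jacobi α β x * |x - t|^κ * E ≤ (3^(α+β) * jacobi α β t * (1+z)^⌈α+β⌉₊) * ((1+z)^κ * ρ^κ) * E := by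
        apply mul_le_mul_of_nonneg_right _ hE0
        apply mul_le_mul hj _ (by positivity) (by positivity)
        rw [hzr, mul_pow]
        gcongr
        linarith
    _ = 3^(α+β) * jacobi α β t * ρ^κ * (E * (1+z)^(κ + ⌈α+β⌉₊)) := by rw [pow_add]; ring
    _ ≤ 3^(α+β) * jacobi α β t * ρ^κ * (C0 * ((1+z)^2)⁻¹) := by
        apply mul_le_mul_of_nonneg_left hE' (by positivity)
    _ = _ := by ring

lemma tail_int : ∃ I > (0:ℝ), ∀ ρ t : ℝ, 0 < ρ → ∫⁻ x, ENNReal.ofReal ((1 + |x - t|/ρ)^2)⁻¹ ≤ ENNReal.ofReal (I * ρ) := by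
  have hfin : ∫⁻ x : ℝ, ENNReal.ofReal ((1 + ‖x‖)^(-(2:ℝ))) < ∞ := finite_integral_one_add_norm (by simp)
  have e : ∀ x : ℝ, ENNReal.ofReal ((1 + |x|)^2)⁻¹ = ENNReal.ofReal ((1 + ‖x‖)^(-(2:ℝ))) := by
    intro x
    rw [Real.rpow_neg (by positivity), Real.norm_eq_abs]
    norm_num
  simp_rw [← e] at hfin
  refine ⟨(∫⁻ x : ℝ, ENNReal.ofReal ((1 + |x|)^2)⁻¹).toReal + 1, by positivity, ?_⟩
  intro ρ t hρ
  have := lint_affine (fun y => ENNReal.ofReal ((1 + |y|)^2)⁻¹) (by fun_prop) (ρ⁻¹) (-t*ρ⁻¹) (by positivity)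
  have e2 : ∀ x, (1 + |x - t|/ρ) = 1 + |ρ⁻¹ * x + -t * ρ⁻¹| := by
    intro x
    rw [show ρ⁻¹ * x + -t * ρ⁻¹ = (x - t)/ρ by field_simp; ring, abs_div, abs_of_pos hρ]
  simp_rw [e2]
  rw [this, inv_inv, ← ENNReal.ofReal_toReal hfin.ne, ← ENNReal.ofReal_mul hρ.le]
  apply ENNReal.ofReal_le_ofReal
  rw [ENNReal.toReal_ofReal (by positivity)]
  nlinarith

def Gf (κ : ℕ) (a : ℝ) (g : ℝ → ℝ) (T : Polynomial ℝ) (x : ℝ) : ℝ :=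
  T.eval x + ∫ t in (-a)..a, (if t ≤ x then (x-t)^κ else 0) * (iteratedDeriv (κ+1) g t / κ.factorial)

lemma core (κ : ℕ) (α β : ℝ) (hα : 0 ≤ α) (hβ : 0 ≤ β) (q : ℝ≥0∞) (hq : 1 ≤ q) (hqt : q ≠ ∞) :
    ∃ C > (0:ℝ), ∃ N0 : ℕ, 1 ≤ N0 ∧ ∀ m : ℕ, 2 ≤ m → ∀ (r : ℝ) (g : ℝ → ℝ) (T : Polynomial ℝ), T.natDegree ≤ κ →
    GoodG (κ+1) α β r (1/(m:ℝ)^2) g → ∃ P : Polynomial ℝ, P.natDegree ≤ N0 * m + κ ∧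
    eLpNorm (fun x => jacobi α β x * (Gf κ (1 - 1/(m:ℝ)^2) g T x - P.eval x)) q (volume.restrict (Icc (-1) 1))
      ≤ ENNReal.ofReal (C * (∫ t in (-(1 - 1/(m:ℝ)^2))..(1 - 1/(m:ℝ)^2),
          jacobi α β t * (rho m t)^(κ + 1/q.toReal) * iteratedDeriv (κ+1) g t) + 2 * (1/(m:ℝ)^2)) := by
  obtain ⟨C0, hC0, hst⟩ := step_approx (κ + 2 + ⌈α+β⌉₊)
  obtain ⟨I, hI, htail⟩ := tail_int
  have hQ1 : 1 ≤ q.toReal := by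
    rw [← ENNReal.toReal_one]; exact ENNReal.toReal_mono hqt hq
  set Q := q.toReal with hQ
  have hQ0 : 0 < Q := by linarith
  set C1 := (3:ℝ)^(α+β) * C0 with hC1
  have hC1p : 0 < C1 := by positivity
  refine ⟨C1 * I^(1/Q), by positivity, 2*(κ + 2 + ⌈α+β⌉₊) + 2, by omega, ?_⟩
  intro m hm r g T hT ⟨hg, hnn, hG⟩
  obtain ⟨c, hcc, hcb⟩ := hst m (by omega)
  set N := (2*(κ + 2 + ⌈α+β⌉₊) + 2) * m with hN
  set d := 1/(m:ℝ)^2 with hd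
  have hm0 : (0:ℝ) < m := by exact_mod_cast (by omega : 0 < m)
  have hd0 : 0 < d := by positivity
  have hd1 : d ≤ 1/4 := by
    have : (2:ℝ) ≤ m := by exact_mod_cast hm
    rw [hd]
    apply one_div_le_one_div_of_le (by norm_num)
    nlinarith
  set a := 1 - d with ha
  set h : ℝ → ℝ := fun t => iteratedDeriv (κ+1) g t with hh
  have hhc : Continuous h := hg.continuous_iteratedDeriv (κ+1) (by exact_mod_cast le_top)
  have hh0 : ∀ t ∈ Icc (-a) a, 0 ≤ h t := fun t ht => hnn t ⟨by linarith [ht.1], by linarith [ht.2]⟩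
  have hκ : (0:ℝ) < κ.factorial := by positivity
  have hκ1 : (1:ℝ) ≤ κ.factorial := by exact_mod_cast Nat.succ_le_of_lt (Nat.factorial_pos κ)
  obtain ⟨P0, hP0d, hP0⟩ := core_poly κ N a c hcc (fun t => h t / κ.factorial) (by fun_prop)
  refine ⟨T + P0, (Polynomial.natDegree_add_le _ _).trans (max_le (by omega) hP0d), ?_⟩
  set St : ℝ → ℝ → ℝ := fun x t => (if t ≤ x then (1:ℝ) else 0) - ∑ j ∈ Finset.range (N+1), c j t * x^j with hSt
  have hStm : Measurable (Function.uncurry St) := by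
    have h1 : Measurable (fun z : ℝ × ℝ => if z.2 ≤ z.1 then (1:ℝ) else 0) :=
      Measurable.ite (measurableSet_le measurable_snd measurable_fst) measurable_const measurable_const
    have h2 : Measurable (fun z : ℝ × ℝ => ∑ j ∈ Finset.range (N+1), c j z.2 * z.1^j) := by
      apply Continuous.measurable
      apply continuous_finsetSum
      intro j _
      have := hcc j
      fun_prop
    exact h1.sub h2
  set e : ℝ → ℝ → ℝ≥0∞ := fun x t => ENNReal.ofReal (jacobi α β x * |x - t|^κ * |St x t| * h t) with he
  have hem : Measurable (Function.uncurry e) := by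
    apply ENNReal.measurable_ofReal.comp
    refine Measurable.mul (Measurable.mul (Measurable.mul ?_ ?_) ?_) ?_
    · exact (jacobi_meas α β).comp measurable_fst
    · have : Continuous (fun z : ℝ × ℝ => |z.1 - z.2|^κ) := by fun_prop
      exact this.measurable
    · exact hStm.abs
    · exact hhc.measurable.comp measurable_snd
  set l0 : ℝ → ℝ := fun t => C1 * I^(1/Q) * (jacobi α β t * (rho m t)^(κ + 1/Q) * h t) with hl0
  have hrm : Measurable (rho m) := by
    apply Continuous.measurable; unfold rho; fun_prop
  have hl0m : Measurable l0 := by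
    apply Measurable.const_mul
    exact ((jacobi_meas α β).mul (hrm.pow_const _)).mul hhc.measurable
  set l : ℝ → ℝ≥0∞ := fun t => ENNReal.ofReal (|l0 t| + d) with hl
  have hmk := mink (volume.restrict (Icc (-1:ℝ) 1)) (volume.restrict (Ioc (-a) a)) Q hQ1 e hem l
    (ENNReal.measurable_ofReal.comp (hl0m.abs.add_const d))
    (fun t => by simp only [hl]; rw [Ne, ENNReal.ofReal_eq_zero, not_le]; positivity)
    (fun t => ENNReal.ofReal_ne_top) (by
      rw [ae_restrict_iff' measurableSet_Ioc]
      apply ae_of_all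
      intro t ht
      have htI : t ∈ Icc (-a) a := ⟨ht.1.le, ht.2⟩
      have ht1 : t ∈ Icc (-1:ℝ) 1 := ⟨by linarith [ht.1], by linarith [ht.2]⟩
      obtain ⟨hρ, hρ1, hρ2, _⟩ := rho_facts m (by omega) t htI
      set ρ := rho m t with hρd
      have hjt : 0 ≤ jacobi α β t := jacobi_nonneg α β ht1
      have hht := hh0 t htI
      set A := C1 * jacobi α β t * ρ^κ * h t with hA
      have hA0 : 0 ≤ A := by positivity
      have hpt : ∀ x ∈ Icc (-1:ℝ) 1, (e x t)^Q ≤ (ENNReal.ofReal A)^Q * ENNReal.ofReal ((1 + |x-t|/ρ)^2)⁻¹ := by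
        intro x hx
        have h1 := core_pt κ α β hα hβ ρ C0 x t |St x t| hρ hC0.le hx ht1 hρ1 hρ2 (abs_nonneg _) (hcb t ht1 x hx)
        have h2 : jacobi α β x * |x - t|^κ * |St x t| * h t ≤ A * ((1 + |x-t|/ρ)^2)⁻¹ := by
          calc _ ≤ (3^(α+β) * C0 * jacobi α β t * ρ^κ * ((1 + |x-t|/ρ)^2)⁻¹) * h t := mul_le_mul_of_nonneg_right h1 hht
            _ = _ := by rw [hA, hC1]; ring
        have hone : 1 ≤ 1 + |x-t|/ρ := by
          have : 0 ≤ |x-t|/ρ := by positivity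
          linarith
        calc (e x t)^Q ≤ (ENNReal.ofReal (A * ((1 + |x-t|/ρ)^2)⁻¹))^Q := by
              apply ENNReal.rpow_le_rpow (ENNReal.ofReal_le_ofReal h2) hQ0.le
          _ = (ENNReal.ofReal A)^Q * (ENNReal.ofReal ((1 + |x-t|/ρ)^2)⁻¹)^Q := by
              rw [ENNReal.ofReal_mul hA0, ENNReal.mul_rpow_of_nonneg _ _ hQ0.le]
          _ ≤ _ := by
              apply mul_le_mul_right
              calc (ENNReal.ofReal ((1 + |x-t|/ρ)^2)⁻¹)^Q ≤ (ENNReal.ofReal ((1 + |x-t|/ρ)^2)⁻¹)^(1:ℝ) := by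
                    apply ENNReal.rpow_le_rpow_of_exponent_ge _ hQ1
                    rw [ENNReal.ofReal_le_one]
                    apply inv_le_one_of_one_le₀
                    exact one_le_pow₀ hone
                _ = _ := ENNReal.rpow_one _
      calc ∫⁻ x in Icc (-1:ℝ) 1, (e x t)^Q
          ≤ ∫⁻ x in Icc (-1:ℝ) 1, (ENNReal.ofReal A)^Q * ENNReal.ofReal ((1 + |x-t|/ρ)^2)⁻¹ :=
            setLIntegral_mono' measurableSet_Icc hpt
        _ ≤ ∫⁻ x, (ENNReal.ofReal A)^Q * ENNReal.ofReal ((1 + |x-t|/ρ)^2)⁻¹ := setLIntegral_le_lintegral _ _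
        _ = (ENNReal.ofReal A)^Q * ∫⁻ x, ENNReal.ofReal ((1 + |x-t|/ρ)^2)⁻¹ := by
            rw [lintegral_const_mul' _ _ (ENNReal.rpow_ne_top_of_nonneg hQ0.le ENNReal.ofReal_ne_top)]
        _ ≤ (ENNReal.ofReal A)^Q * ENNReal.ofReal (I * ρ) := mul_le_mul_right (htail ρ t hρ) _
        _ = (ENNReal.ofReal (l0 t))^Q := by
            rw [ENNReal.ofReal_rpow_of_nonneg hA0 hQ0.le, ← ENNReal.ofReal_mul (by positivity), ENNReal.ofReal_rpow_of_nonneg (by simp only [hl0]; positivity) hQ0.le]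
            congr 1
            have : l0 t = A * (I * ρ)^(1/Q) := by
              simp only [hl0, hA]
              rw [Real.rpow_add hρ, Real.rpow_natCast, Real.mul_rpow hI.le hρ.le]; ring
            rw [this, Real.mul_rpow hA0 (by positivity), ← Real.rpow_mul (by positivity)]
            rw [one_div, inv_mul_cancel₀ hQ0.ne', Real.rpow_one]
        _ ≤ (l t)^Q := by
            apply ENNReal.rpow_le_rpow _ hQ0.le
            apply ENNReal.ofReal_le_ofReal
            linarith [le_abs_self (l0 t)])
  have hq0 : q ≠ 0 := (lt_of_lt_of_le one_pos hq).ne'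
  have hpoint : ∀ x ∈ Icc (-1:ℝ) 1, ‖jacobi α β x * (Gf κ a g T x - (T + P0).eval x)‖ₑ ≤ ∫⁻ t in Ioc (-a) a, e x t := by
    intro x hx
    have hjx := jacobi_nonneg α β hx
    have hmeas1 : IntervalIntegrable (fun t => (if t ≤ x then (x-t)^κ else 0) * (h t / κ.factorial)) volume (-a) a := by
      have h1 : Continuous (fun t => (x-t)^κ * (h t / κ.factorial)) := by fun_prop
      have h2 := (h1.intervalIntegrable (μ := volume) (-a) a).1.indicator (measurableSet_Iic (a := x))
      rw [intervalIntegrable_iff_integrableOn_Ioc_of_le (by linarith)]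
      refine h2.congr (ae_of_all _ ?_)
      intro t
      by_cases htx : t ≤ x
      · simp [indicator, htx]
      · simp [indicator, htx]
    have hmeas2 : IntervalIntegrable (fun t => (x - t)^κ * (∑ j ∈ Finset.range (N+1), c j t * x^j) * (h t / κ.factorial)) volume (-a) a := by
      apply Continuous.intervalIntegrable
      have : Continuous (fun t => ∑ j ∈ Finset.range (N+1), c j t * x^j) := by
        apply continuous_finsetSum; intro j _; have := hcc j; fun_prop
      fun_prop
    have hdiff : Gf κ a g T x - (T + P0).eval x = ∫ t in Ioc (-a) a, (x-t)^κ * St x t * (h t / κ.factorial) := by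
      rw [Gf, Polynomial.eval_add, hP0, add_sub_add_left_eq_sub, ← intervalIntegral.integral_sub hmeas1 hmeas2,
        intervalIntegral.integral_of_le (by linarith)]
      apply setIntegral_congr_fun measurableSet_Ioc
      intro t _
      simp only [hSt, hh]
      split_ifs <;> ring
    rw [hdiff, ← integral_const_mul]
    refine (enorm_integral_le_lintegral_enorm _).trans ?_
    apply setLIntegral_mono' measurableSet_Ioc
    intro t ht
    rw [← ofReal_norm]
    apply ENNReal.ofReal_le_ofReal
    have hht := hh0 t ⟨ht.1.le, ht.2⟩
    rw [norm_mul, norm_mul, norm_mul, Real.norm_of_nonneg hjx, norm_pow, Real.norm_of_nonneg (div_nonneg hht hκ.le), Real.norm_eq_abs, Real.norm_eq_abs]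
    calc jacobi α β x * (|x-t|^κ * |St x t| * (h t / κ.factorial)) ≤ jacobi α β x * (|x-t|^κ * |St x t| * h t) := by
          gcongr
          exact div_le_self hht hκ1
      _ = _ := by ring
  have hfinal : eLpNorm (fun x => jacobi α β x * (Gf κ a g T x - (T+P0).eval x)) q (volume.restrict (Icc (-1) 1))
      ≤ ∫⁻ t in Ioc (-a) a, l t := by
    rw [eLpNorm_eq_lintegral_rpow_enorm_toReal hq0 hqt, one_div, ENNReal.rpow_inv_le_iff hQ0]
    refine le_trans ?_ hmk
    apply setLIntegral_mono' measurableSet_Icc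
    intro x hx
    exact ENNReal.rpow_le_rpow (hpoint x hx) hQ0.le
  refine hfinal.trans ?_
  have hl0i : IntervalIntegrable l0 volume (-a) a := by
    rw [intervalIntegrable_iff_integrableOn_Ioc_of_le (by linarith)]
    obtain ⟨Kh, hKh⟩ := (isCompact_Icc (a := -a) (b := a)).exists_bound_of_continuousOn hhc.continuousOn
    refine Measure.integrableOn_of_bounded (M := C1 * I^(1/Q) * (2^α*2^β * (3*2)^(κ+1/Q) * Kh)) (by simp) hl0m.aestronglyMeasurable ?_
    rw [ae_restrict_iff' measurableSet_Ioc]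
    apply ae_of_all
    intro t ht
    have htI : t ∈ Icc (-a) a := ⟨ht.1.le, ht.2⟩
    have ht1 : t ∈ Icc (-1:ℝ) 1 := ⟨by linarith [ht.1], by linarith [ht.2]⟩
    obtain ⟨hρ, hρ1, hρ2, _⟩ := rho_facts m (by omega) t htI
    simp only [hl0]
    have hj0 := jacobi_nonneg α β ht1
    have hj1 := jacobi_upper α β hα hβ t ht1
    have hCI : 0 ≤ C1 * I^(1/Q) := by positivity
    have hrp : 0 ≤ (rho m t)^(κ+1/Q) := by positivity
    rw [norm_mul, Real.norm_of_nonneg hCI, norm_mul, norm_mul, Real.norm_of_nonneg hj0, Real.norm_of_nonneg hrp]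
    have hk1 := hKh t htI
    have hrr : (rho m t)^(κ+1/Q) ≤ (3*2)^(κ+1/Q) := by
      apply Real.rpow_le_rpow hρ.le _ (by positivity)
      linarith [ht.1]
    gcongr
  have hl0n : ∀ t ∈ Ioc (-a) a, |l0 t| = l0 t := by
    intro t ht
    have htI : t ∈ Icc (-a) a := ⟨ht.1.le, ht.2⟩
    have hj0 := jacobi_nonneg α β (x := t) ⟨by linarith [ht.1], by linarith [ht.2]⟩
    have := (rho_facts m (by omega) t htI).1
    have := hh0 t htI
    apply abs_of_nonneg
    simp only [hl0]
    positivity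
  have e1 : ∫⁻ t in Ioc (-a) a, l t = ENNReal.ofReal (∫ t in Ioc (-a) a, (l0 t + d)) := by
    rw [ofReal_integral_eq_lintegral_ofReal]
    · apply setLIntegral_congr_fun measurableSet_Ioc
      intro t ht
      simp only [hl, hl0n t ht]
    · exact hl0i.1.add (integrable_const d)
    · rw [EventuallyLE, ae_restrict_iff' measurableSet_Ioc]
      apply ae_of_all
      intro t ht
      rw [← hl0n t ht]
      simp only [Pi.zero_apply]
      positivity
  rw [e1]
  apply ENNReal.ofReal_le_ofReal
  rw [integral_add hl0i.1 (integrable_const d), ← intervalIntegral.integral_of_le (by linarith), hl0, intervalIntegral.integral_const_mul]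
  have : ∫ t in Ioc (-a) a, d ≤ 2 * d := by
    simp only [integral_const, smul_eq_mul, measureReal_restrict_apply_univ]
    rw [Real.volume_real_Ioc_of_le (by linarith)]
    nlinarith
  simp only [hh] at this ⊢
  linarith

lemma jacobi_cont (α β : ℝ) (hα : 0 ≤ α) (hβ : 0 ≤ β) : Continuous (jacobi α β) := by
  unfold jacobi
  exact ((Real.continuous_rpow_const hα).comp (continuous_const.add continuous_id)).mul
    ((Real.continuous_rpow_const hβ).comp (continuous_const.sub continuous_id))

lemma rho_cont (m : ℕ) : Continuous (rho m) := by unfold rho; fun_prop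

lemma dyad (e : ℝ) (he : e ≠ 0) : ∃ K > (0:ℝ), ∀ (F : ℝ → ℝ) (A : ℝ) (J : ℕ), Continuous F → 0 ≤ A →
    (∀ j < J, ∫ t in (1 - 2*(1/2)^(j+1))..(1 - (1/2)^(j+1)), F t ≤ A * ((1/2:ℝ)^(j+1))^e) →
    ∫ t in (0:ℝ)..(1 - (1/2)^J), F t ≤ A * K * (1 + ((1/2:ℝ)^J)^e) := by
  set x : ℝ := (1/2:ℝ)^e with hx
  have hx0 : 0 < x := by positivity
  have hx1 : x ≠ 1 := by
    intro h
    have h2 := congrArg Real.log h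
    rw [hx, Real.log_rpow (by norm_num), Real.log_one, mul_eq_zero] at h2
    rcases h2 with h2 | h2
    · exact he h2
    · have : Real.log (1/2) < 0 := Real.log_neg (by norm_num) (by norm_num)
      linarith
  have hpw : ∀ j : ℕ, ((1/2:ℝ)^j)^e = x^j := by
    intro j
    rw [hx, ← Real.rpow_natCast, ← Real.rpow_mul (by norm_num), mul_comm, Real.rpow_mul (by norm_num), Real.rpow_natCast]
  have hax : 0 < |x - 1| := abs_pos.2 (sub_ne_zero.2 hx1)
  refine ⟨x / |x - 1|, by positivity, ?_⟩
  intro F A J hF hA h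
  have hsum := intervalIntegral.sum_integral_adjacent_intervals (μ := volume) (f := F) (a := fun j : ℕ => 1 - (1/2:ℝ)^j) (n := J)
    (fun j _ => hF.intervalIntegrable _ _)
  simp only [pow_zero, sub_self] at hsum
  rw [← hsum]
  calc ∑ j ∈ Finset.range J, ∫ t in (1 - (1/2:ℝ)^j)..(1 - (1/2)^(j+1)), F t
      ≤ ∑ j ∈ Finset.range J, A * x^(j+1) := by
        apply Finset.sum_le_sum
        intro j hj
        have := h j (Finset.mem_range.1 hj)
        rw [hpw] at this
        rw [show (1/2:ℝ)^j = 2*(1/2)^(j+1) by rw [pow_succ]; ring]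
        exact this
    _ = A * x * ∑ j ∈ Finset.range J, x^j := by
        rw [Finset.mul_sum]
        apply Finset.sum_congr rfl
        intro j _; rw [pow_succ]; ring
    _ ≤ A * x * ((1 + x^J) / |x-1|) := by
        apply mul_le_mul_of_nonneg_left _ (by positivity)
        rw [geom_sum_eq hx1]
        refine (le_abs_self _).trans ?_
        rw [abs_div]
        gcongr
        refine (abs_sub _ _).trans ?_
        rw [abs_of_nonneg (by positivity), abs_one]
        linarith
    _ = _ := by rw [hpw]; ring

lemma rhs_bound (κ : ℕ) (α β : ℝ) (hα : 0 ≤ α) (hβ : 0 ≤ β) (Q r : ℝ) (hQ : 1 ≤ Q) (hr : 0 ≤ r) (hr1 : r ≤ 1)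
    (he : 1/(2*Q) - κ/2 - r ≠ 0) : ∃ C > (0:ℝ), ∀ i : ℕ, 1 ≤ i → ∀ g : ℝ → ℝ,
    GoodG (κ+1) α β r (1/((2^i:ℕ):ℝ)^2) g →
    (∫ t in (-(1 - 1/((2^i:ℕ):ℝ)^2))..(1 - 1/((2^i:ℕ):ℝ)^2),
          jacobi α β t * (rho (2^i) t)^(κ + 1/Q) * iteratedDeriv (κ+1) g t)
      ≤ C * (((2^i:ℕ):ℝ)^(-(κ+1/Q)) + ((2^i:ℕ):ℝ)^(-(2/Q - 2*r))) := by
  obtain ⟨C1, hC1, hblock⟩ := block (κ+1) α β hα hβ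
  obtain ⟨K, hK, hdy⟩ := dyad _ he
  set e := 1/(2*Q) - κ/2 - r with hed
  refine ⟨2 * ((2^α*2^β) * (4:ℝ)^(κ+1/Q) * C1 * K), by positivity, ?_⟩
  intro i hi g hgood
  set m : ℝ := ((2^i:ℕ):ℝ) with hm
  have hm2 : m = 2^i := by rw [hm]; push_cast; rfl
  have hm0 : 0 < m := by rw [hm2]; positivity
  have hd : 1/m^2 = (1/2)^(2*i) := by
    rw [hm2, ← pow_mul, one_div, one_div, inv_pow, mul_comm]
  have hs1 : ∀ j : ℕ, j < 2*i → 1/m^2 ≤ (1/2:ℝ)^(j+1) ∧ (1/2:ℝ)^(j+1) ≤ 1/2 := by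
    intro j hj
    rw [hd]
    constructor
    · exact pow_le_pow_of_le_one (by norm_num) (by norm_num) (by omega)
    · calc (1/2:ℝ)^(j+1) ≤ (1/2)^1 := pow_le_pow_of_le_one (by norm_num) (by norm_num) (by omega)
        _ = 1/2 := by norm_num
  obtain ⟨hg, hnn, _⟩ := id hgood
  set d := 1/m^2 with hdd
  have hd0 : 0 < d := by positivity
  have hhc : Continuous (iteratedDeriv (κ+1) g) := hg.continuous_iteratedDeriv (κ+1) (by exact_mod_cast le_top)
  have hQ0 : 0 < Q := by linarith
  set F : ℝ → ℝ := fun t => jacobi α β t * (rho (2^i) t)^(κ + 1/Q) * iteratedDeriv (κ+1) g t with hF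
  have hFc : Continuous F := ((jacobi_cont α β hα hβ).mul ((Real.continuous_rpow_const (by positivity)).comp (rho_cont _))).mul hhc
  set A := (2^α*2^β) * (4:ℝ)^(κ+1/Q) * C1 * m^(-(κ+1/Q)) with hA
  have hA0 : 0 ≤ A := by positivity
  have hrho : ∀ s t : ℝ, d ≤ s → t ∈ Icc (-(1-d)) (1-d) → 1 - t^2 ≤ 4*s → 
      0 ≤ (rho (2^i) t)^(κ+1/Q) ∧ (rho (2^i) t)^(κ+1/Q) ≤ (4:ℝ)^(κ+1/Q) * s^((κ+1/Q)/2) * m^(-(κ+1/Q)) := by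
    intro s t hs ht hts
    obtain ⟨h0, _, _, h3⟩ := rho_facts (2^i) Nat.one_le_two_pow t ht
    have hs0 : 0 < s := by linarith
    refine ⟨by positivity, ?_⟩
    have e1 : (4:ℝ)^(κ+1/Q) * s^((κ+1/Q)/2) * m^(-(κ+1/Q)) = (4 * √s / m)^(κ+1/Q) := by
      rw [Real.div_rpow (by positivity) hm0.le, Real.mul_rpow (by norm_num) (by positivity), Real.sqrt_eq_rpow, ← Real.rpow_mul hs0.le, Real.rpow_neg hm0.le]
      rw [div_eq_mul_inv]
      congr 3
      ring
    rw [e1]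
    apply Real.rpow_le_rpow h0.le _ (by positivity)
    refine h3.trans ?_
    apply div_le_div_of_nonneg_right _ hm0.le
    have : √(1-t^2) ≤ √(4*s) := Real.sqrt_le_sqrt hts
    rw [Real.sqrt_mul (by norm_num), show (4:ℝ) = 2^2 by norm_num, Real.sqrt_sq (by norm_num)] at this
    linarith
  have hexp : ∀ s γ : ℝ, 0 < s → s^γ * s^((κ+1/Q)/2) * s^(1 - (κ+1:ℕ) - r - γ) = s^e := by
    intro s γ hs
    rw [← Real.rpow_add hs, ← Real.rpow_add hs]
    congr 1
    rw [hed]; push_cast; field_simp; ring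
  have hmain : ∀ j < 2*i, ∀ s, s = (1/2:ℝ)^(j+1) → (∫ t in (1 - 2*s)..(1 - s), F t ≤ A * s^e) ∧ (∫ t in (1 - 2*s)..(1 - s), F (-t) ≤ A * s^e) := by
    intro j hj s hs
    obtain ⟨hs1, hs2⟩ := hs1 j hj
    rw [← hs] at hs1 hs2
    have hs0 : 0 < s := by linarith
    obtain ⟨hb1, hb2⟩ := hblock r d g hr hr1 hd0 hgood s hs1 hs2
    constructor
    · calc ∫ t in (1 - 2*s)..(1 - s), F t ≤ ∫ t in (1 - 2*s)..(1 - s),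
            (2^α*2^β * s^β) * ((4:ℝ)^(κ+1/Q) * s^((κ+1/Q)/2) * m^(-(κ+1/Q))) * iteratedDeriv (κ+1) g t := by
            apply intervalIntegral.integral_mono_on (by linarith) (hFc.intervalIntegrable _ _)
              ((continuous_const.mul hhc).intervalIntegrable _ _)
            intro t ht
            obtain ⟨r1, r2⟩ := hrho s t hs1 ⟨by linarith [ht.1], by linarith [ht.2]⟩ (by nlinarith [ht.1, ht.2])
            have hh := hnn t ⟨by linarith [ht.1], by linarith [ht.2]⟩
            have hj : jacobi α β t ≤ 2^α*2^β * s^β := by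
              rw [jacobi, mul_assoc, ← Real.mul_rpow (by norm_num) hs0.le]
              exact mul_le_mul (Real.rpow_le_rpow (by linarith [ht.1]) (by linarith [ht.2]) hα)
                (Real.rpow_le_rpow (by linarith [ht.2]) (by linarith [ht.1]) hβ)
                (Real.rpow_nonneg (by linarith [ht.2]) _) (by positivity)
            exact mul_le_mul_of_nonneg_right (mul_le_mul hj r2 r1 (by positivity)) hh
        _ = (2^α*2^β * s^β) * ((4:ℝ)^(κ+1/Q) * s^((κ+1/Q)/2) * m^(-(κ+1/Q))) * ∫ t in (1 - 2*s)..(1 - s), iteratedDeriv (κ+1) g t :=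
            intervalIntegral.integral_const_mul _ _
        _ ≤ (2^α*2^β * s^β) * ((4:ℝ)^(κ+1/Q) * s^((κ+1/Q)/2) * m^(-(κ+1/Q))) * (C1 * s^(1 - (κ+1:ℕ) - r - β)) := by
            exact mul_le_mul_of_nonneg_left hb1 (by positivity)
        _ = A * s^e := by rw [← hexp s β hs0, hA]; ring
    · rw [intervalIntegral.integral_comp_neg]
      rw [show -(1 - s) = -1 + s by ring, show -(1 - 2*s) = -1+2*s by ring]
      calc ∫ t in (-1+s)..(-1 + 2*s), F t ≤ ∫ t in (-1+s)..(-1 + 2*s),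
            (2^α*2^β * s^α) * ((4:ℝ)^(κ+1/Q) * s^((κ+1/Q)/2) * m^(-(κ+1/Q))) * iteratedDeriv (κ+1) g t := by
            apply intervalIntegral.integral_mono_on (by linarith) (hFc.intervalIntegrable _ _)
              ((continuous_const.mul hhc).intervalIntegrable _ _)
            intro t ht
            obtain ⟨r1, r2⟩ := hrho s t hs1 ⟨by linarith [ht.1], by linarith [ht.2]⟩ (by nlinarith [ht.1, ht.2])
            have hh := hnn t ⟨by linarith [ht.1], by linarith [ht.2]⟩
            have hj : jacobi α β t ≤ 2^α*2^β * s^α := by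
              rw [jacobi, mul_right_comm, ← Real.mul_rpow (by norm_num) hs0.le]
              exact mul_le_mul (Real.rpow_le_rpow (by linarith [ht.1]) (by linarith [ht.2]) hα)
                (Real.rpow_le_rpow (by linarith [ht.2]) (by linarith [ht.1]) hβ)
                (Real.rpow_nonneg (by linarith [ht.2]) _) (by positivity)
            exact mul_le_mul_of_nonneg_right (mul_le_mul hj r2 r1 (by positivity)) hh
        _ = (2^α*2^β * s^α) * ((4:ℝ)^(κ+1/Q) * s^((κ+1/Q)/2) * m^(-(κ+1/Q))) * ∫ t in (-1+s)..(-1 + 2*s), iteratedDeriv (κ+1) g t :=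
            intervalIntegral.integral_const_mul _ _
        _ ≤ (2^α*2^β * s^α) * ((4:ℝ)^(κ+1/Q) * s^((κ+1/Q)/2) * m^(-(κ+1/Q))) * (C1 * s^(1 - (κ+1:ℕ) - r - α)) := by
            exact mul_le_mul_of_nonneg_left hb2 (by positivity)
        _ = A * s^e := by rw [← hexp s α hs0, hA]; ring
  have d1 := hdy F A (2*i) hFc hA0 (fun j hj => (hmain j hj _ rfl).1)
  have d2 := hdy (fun t => F (-t)) A (2*i) (hFc.comp continuous_neg) hA0 (fun j hj => (hmain j hj _ rfl).2)
  rw [← hd] at d1 d2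
  rw [intervalIntegral.integral_comp_neg, neg_zero] at d2
  rw [← intervalIntegral.integral_add_adjacent_intervals (b := 0) (hFc.intervalIntegrable _ _) (hFc.intervalIntegrable _ _)]
  have e3 : m^(-(κ+1/Q)) * (1 + d^e) = m^(-(κ+1/Q)) + m^(-(2/Q - 2*r)) := by
    have : d^e = m^(-(2*e)) := by
      rw [hdd, one_div, Real.inv_rpow (by positivity), ← Real.rpow_natCast m 2, ← Real.rpow_mul hm0.le, ← Real.rpow_neg hm0.le]
      norm_num
    rw [this, mul_add, mul_one, ← Real.rpow_add hm0]
    congr 2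
    rw [hed]; field_simp; ring
  calc _ ≤ A * K * (1 + d^e) + A * K * (1 + d^e) := add_le_add d2 d1
    _ = 2 * ((2^α*2^β) * (4:ℝ)^(κ+1/Q) * C1 * K) * (m^(-(κ+1/Q)) * (1 + d^e)) := by rw [hA]; ring
    _ = _ := by rw [e3]

lemma rhs_bound2 (m : ℕ) (hm : 2 ≤ m) (r : ℝ) (g : ℝ → ℝ) (hgood : GoodG 2 0 0 r (1/(m:ℝ)^2) g) (hg1 : ∀ x, |g x| ≤ 1) :
    (∫ t in (-(1 - 1/(m:ℝ)^2))..(1 - 1/(m:ℝ)^2),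
          jacobi 0 0 t * (rho m t)^(((1:ℕ):ℝ) + 1/(1:ℝ)) * iteratedDeriv (1+1) g t)
      ≤ 64 * (m:ℝ)^(-(2:ℝ)) := by
  obtain ⟨hg, hnn, _⟩ := hgood
  have hm0 : (0:ℝ) < m := by exact_mod_cast (by omega : 0 < m)
  have hd1 : 1/(m:ℝ)^2 ≤ 1/4 := by
    have : (2:ℝ) ≤ m := by exact_mod_cast hm
    apply one_div_le_one_div_of_le (by norm_num)
    nlinarith
  have hall : ∀ k : ℕ, Continuous (iteratedDeriv k g) := fun k => hg.continuous_iteratedDeriv k (by exact_mod_cast le_top)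
  have hhc : Continuous (iteratedDeriv 2 g) := hall 2
  have hrf := rho_facts m (by omega)
  have hdm : (m:ℝ)^(-(2:ℝ)) = 1/(m:ℝ)^2 := by
    rw [Real.rpow_neg hm0.le, one_div]; norm_num
  rw [hdm]
  set d := 1/(m:ℝ)^2 with hd
  have hd0 : 0 < d := by positivity
  set b := 1 - d/4 with hb
  have hsplit : ∀ t ∈ Icc (-(1-d)) (1-d), jacobi 0 0 t * (rho m t)^(((1:ℕ):ℝ) + 1/(1:ℝ)) * iteratedDeriv (1+1) g t
      ≤ 8 * d * ((b^2 - t^2) * iteratedDeriv 2 g t) := by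
    intro t ht
    obtain ⟨h0, _, _, h3⟩ := hrf t ht
    have hh := hnn t ⟨by linarith [ht.1], by linarith [ht.2]⟩
    have ht2 : 0 ≤ 1 - t^2 := by nlinarith [ht.1, ht.2]
    have hsq : (rho m t)^2 ≤ 4 * d * (1 - t^2) := by
      calc (rho m t)^2 ≤ (2 * √(1-t^2)/m)^2 := by gcongr
        _ = _ := by rw [div_pow, mul_pow, Real.sq_sqrt ht2, hd]; ring
    have hbt : 1 - t^2 ≤ 2 * (b^2 - t^2) := by
      rw [hb]; nlinarith [ht.1, ht.2, sq_nonneg d, mul_nonneg (sub_nonneg.2 ht.1) (sub_nonneg.2 ht.2)]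
    have e1 : (rho m t)^(((1:ℕ):ℝ) + 1/(1:ℝ)) = (rho m t)^2 := by
      rw [← Real.rpow_natCast]; norm_num
    rw [e1]
    simp only [jacobi, Real.rpow_zero, one_mul]
    calc (rho m t)^2 * iteratedDeriv 2 g t ≤ (4 * d * (1 - t^2)) * iteratedDeriv 2 g t := mul_le_mul_of_nonneg_right hsq hh
      _ ≤ (4 * d * (2 * (b^2 - t^2))) * iteratedDeriv 2 g t := by gcongr
      _ = _ := by ring
  have hc1 : Continuous (fun t => (b^2 - t^2) * iteratedDeriv 2 g t) := by fun_prop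
  have hc2 : Continuous (fun t => jacobi 0 0 t * (rho m t)^(((1:ℕ):ℝ) + 1/(1:ℝ)) * iteratedDeriv (1+1) g t) :=
    ((jacobi_cont 0 0 le_rfl le_rfl).mul ((Real.continuous_rpow_const (by norm_num)).comp (rho_cont _))).mul hhc
  have s1 : (∫ t in (-(1 - d))..(1 - d), jacobi 0 0 t * (rho m t)^(((1:ℕ):ℝ) + 1/(1:ℝ)) * iteratedDeriv (1+1) g t)
      ≤ ∫ t in (-(1 - d))..(1 - d), 8 * d * ((b^2 - t^2) * iteratedDeriv 2 g t) :=
    intervalIntegral.integral_mono_on (by linarith) (hc2.intervalIntegrable _ _) ((continuous_const.mul hc1).intervalIntegrable _ _) hsplit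
  have s2 : ∫ t in (-(1 - d))..(1 - d), (b^2 - t^2) * iteratedDeriv 2 g t ≤ ∫ t in (-b)..b, (b^2 - t^2) * iteratedDeriv 2 g t := by
    apply intervalIntegral.integral_mono_interval (by linarith) (by linarith) (by linarith)
    · rw [EventuallyLE, ae_restrict_iff' measurableSet_Ioc]
      apply ae_of_all
      intro t ht
      exact mul_nonneg (by nlinarith [ht.1, ht.2]) (hnn t ⟨ht.1.le, ht.2⟩)
    · exact hc1.intervalIntegrable _ _
  have hgd : Differentiable ℝ g := hg.differentiable (by simp)
  have hg' : ContDiff ℝ (⊤:ℕ∞) (deriv g) := (contDiff_infty_iff_deriv.1 hg).2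
  have hgd' : Differentiable ℝ (deriv g) := hg'.differentiable (by simp)
  have s3 : ∫ t in (-b)..b, (b^2 - t^2) * iteratedDeriv 2 g t = 2*b*(g b + g (-b)) - 2 * ∫ t in (-b)..b, g t := by
    have i1 := intervalIntegral.integral_mul_deriv_eq_deriv_mul (a := -b) (b := b) (u := fun t => b^2 - t^2) (u' := fun t => -(2*t)) (v := deriv g) (v' := iteratedDeriv 2 g)
      (fun t _ => by simpa using ((hasDerivAt_id t).pow 2).const_sub (b^2))
      (fun t _ => by
        rw [show (2:ℕ) = 1 + 1 by rfl, iteratedDeriv_succ, iteratedDeriv_one]; exact (hgd' t).hasDerivAt)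
      ((by fun_prop : Continuous (fun t : ℝ => -(2*t))).intervalIntegrable _ _) (hhc.intervalIntegrable _ _)
    have i2 := intervalIntegral.integral_mul_deriv_eq_deriv_mul (a := -b) (b := b) (u := fun t => -(2*t)) (u' := fun t => -2) (v := g) (v' := deriv g)
      (fun t _ => by
        have := (hasDerivAt_id t).const_mul (-2:ℝ)
        simpa [neg_mul] using this)
      (fun t _ => (hgd t).hasDerivAt)
      (continuous_const.intervalIntegrable _ _) (hg'.continuous.intervalIntegrable _ _)
    rw [i1, i2, intervalIntegral.integral_const_mul]
    ring
  have s4 : |∫ t in (-b)..b, g t| ≤ 1 * |b - (-b)| := by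
    rw [← Real.norm_eq_abs]
    exact intervalIntegral.norm_integral_le_of_norm_le_const (fun t _ => hg1 t)
  rw [abs_of_nonneg (a := b - -b) (by linarith)] at s4
  rw [intervalIntegral.integral_const_mul] at s1
  have h1 := abs_le.1 (hg1 b)
  have h2 := abs_le.1 (hg1 (-b))
  have h3 := abs_le.1 s4
  have hb0 : 0 ≤ b := by linarith
  have : ∫ t in (-(1 - d))..(1 - d), (b^2 - t^2) * iteratedDeriv 2 g t ≤ 8 := by
    rw [s3] at s2
    nlinarith
  nlinarith

open Polynomial in
lemma taylor_ex (g : ℝ → ℝ) (hg : ContDiff ℝ (⊤:ℕ∞) g) (a0 : ℝ) : ∀ κ : ℕ, ∃ T : ℝ[X], T.natDegree ≤ κ ∧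
    ∀ x, g x = T.eval x + ∫ t in a0..x, (x-t)^κ * (iteratedDeriv (κ+1) g t / κ.factorial) := by
  have hc : ∀ k, Continuous (iteratedDeriv k g) := fun k => hg.continuous_iteratedDeriv k (by exact_mod_cast le_top)
  have hd : ∀ k t, HasDerivAt (iteratedDeriv k g) (iteratedDeriv (k+1) g t) t := by
    intro k t
    have h := (hg.differentiable_iteratedDeriv k (by exact_mod_cast (WithTop.coe_lt_top k))).differentiableAt (x := t)
    rw [iteratedDeriv_succ]
    exact h.hasDerivAt
  intro κ
  induction κ with
  | zero =>
    refine ⟨C (g a0), by simp, fun x => ?_⟩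
    have := intervalIntegral.integral_eq_sub_of_hasDerivAt (f := g) (f' := iteratedDeriv 1 g) (a := a0) (b := x)
      (fun t _ => by simpa using hd 0 t) ((hc 1).intervalIntegrable _ _)
    rw [iteratedDeriv_one] at this
    simp [this]
  | succ κ ih =>
    obtain ⟨T, hT, hTx⟩ := ih
    refine ⟨T + C (iteratedDeriv (κ+1) g a0 / (κ+1).factorial) * (X - C a0)^(κ+1), ?_, ?_⟩
    · refine (natDegree_add_le _ _).trans (max_le (by omega) ?_)
      refine (natDegree_C_mul_le _ _).trans ?_
      refine natDegree_pow_le.trans ?_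
      rw [natDegree_X_sub_C]; omega
    · intro x
      rw [hTx x]
      have hv : ∀ t, HasDerivAt (fun t : ℝ => -((x-t)^(κ+1) / ((κ+1).factorial : ℝ))) ((x-t)^κ / (κ.factorial : ℝ)) t := by
        intro t
        have h1 : HasDerivAt (fun t : ℝ => x - t) (-1) t := by simpa using (hasDerivAt_id t).const_sub x
        have h2 := ((h1.pow (κ+1)).div_const ((κ+1).factorial : ℝ)).neg
        refine h2.congr_deriv ?_
        have : (κ.factorial : ℝ) ≠ 0 := by positivity
        rw [Nat.factorial_succ]; push_cast
        simp
        field_simp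
      have := intervalIntegral.integral_mul_deriv_eq_deriv_mul (a := a0) (b := x)
        (u := iteratedDeriv (κ+1) g) (u' := iteratedDeriv (κ+2) g)
        (v := fun t : ℝ => -((x-t)^(κ+1) / ((κ+1).factorial : ℝ))) (v' := fun t : ℝ => (x-t)^κ / (κ.factorial : ℝ))
        (fun t _ => hd (κ+1) t) (fun t _ => hv t) ((hc _).intervalIntegrable _ _)
        ((by fun_prop : Continuous (fun t : ℝ => (x-t)^κ / (κ.factorial : ℝ))).intervalIntegrable _ _)
      have e1 : (∫ t in a0..x, (x-t)^κ * (iteratedDeriv (κ+1) g t / κ.factorial))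
          = ∫ t in a0..x, iteratedDeriv (κ+1) g t * ((x-t)^κ / (κ.factorial : ℝ)) :=
        intervalIntegral.integral_congr (fun t _ => by ring)
      have e2 : (∫ t in a0..x, (x-t)^(κ+1) * (iteratedDeriv (κ+1+1) g t / (κ+1).factorial))
          = -∫ t in a0..x, iteratedDeriv (κ+2) g t * (-((x-t)^(κ+1) / ((κ+1).factorial : ℝ))) := by
        rw [← intervalIntegral.integral_neg]
        exact intervalIntegral.integral_congr (fun t _ => by ring)
      rw [e1, e2, this]
      simp
      ring

lemma Gf_mid (κ : ℕ) (a : ℝ) (g : ℝ → ℝ) (hg : ContDiff ℝ (⊤:ℕ∞) g) (T : Polynomial ℝ)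
    (hT : ∀ x, g x = T.eval x + ∫ t in (-a)..x, (x-t)^κ * (iteratedDeriv (κ+1) g t / κ.factorial))
    (x : ℝ) (hx : x ∈ Icc (-a) a) : Gf κ a g T x = g x := by
  have hc : Continuous (iteratedDeriv (κ+1) g) := hg.continuous_iteratedDeriv (κ+1) (by exact_mod_cast le_top)
  have hF : Continuous (fun t => (x-t)^κ * (iteratedDeriv (κ+1) g t / κ.factorial)) := by fun_prop
  have e1 : (∫ t in (-a)..x, (if t ≤ x then (x-t)^κ else 0) * (iteratedDeriv (κ+1) g t / κ.factorial))
      = ∫ t in (-a)..x, (x-t)^κ * (iteratedDeriv (κ+1) g t / κ.factorial) := by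
    apply intervalIntegral.integral_congr
    intro t ht
    rw [uIcc_of_le hx.1] at ht
    simp [ht.2]
  have i1 : IntervalIntegrable (fun t => (if t ≤ x then (x-t)^κ else 0) * (iteratedDeriv (κ+1) g t / κ.factorial)) volume (-a) x := by
    refine (hF.intervalIntegrable (-a) x).congr_ae ?_
    refine (ae_restrict_iff' measurableSet_uIoc).2 (Eventually.of_forall ?_)
    intro t ht
    rw [uIoc_of_le hx.1] at ht
    simp [ht.2]
  have h0 : ∀ t ∈ uIoc x a, (if t ≤ x then (x-t)^κ else 0) * (iteratedDeriv (κ+1) g t / κ.factorial) = 0 := by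
    intro t ht
    rw [uIoc_of_le hx.2] at ht
    simp [not_le.2 ht.1]
  have i2 : IntervalIntegrable (fun t => (if t ≤ x then (x-t)^κ else 0) * (iteratedDeriv (κ+1) g t / κ.factorial)) volume x a := by
    refine (intervalIntegrable_const (c := (0:ℝ))).congr_ae ?_
    refine (ae_restrict_iff' measurableSet_uIoc).2 (Eventually.of_forall ?_)
    intro t ht
    exact (h0 t ht).symm
  have e2 : (∫ t in x..a, (if t ≤ x then (x-t)^κ else 0) * (iteratedDeriv (κ+1) g t / κ.factorial)) = 0 := by
    apply intervalIntegral.integral_zero_ae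
    exact Eventually.of_forall h0
  unfold Gf
  rw [← intervalIntegral.integral_add_adjacent_intervals i1 i2, e1, e2, add_zero, hT x]

lemma Gf_left (κ : ℕ) (a : ℝ) (ha : 0 ≤ a) (g : ℝ → ℝ) (T : Polynomial ℝ) (x : ℝ) (hx : x ≤ -a) :
    Gf κ a g T x = T.eval x := by
  unfold Gf
  rw [intervalIntegral.integral_zero_ae, add_zero]
  refine Eventually.of_forall ?_
  intro t ht
  rw [uIoc_of_le (by linarith)] at ht
  simp [not_le.2 (lt_of_le_of_lt hx ht.1)]

open Polynomial in
lemma Gf_right (κ : ℕ) (a : ℝ) (ha : 0 ≤ a) (g : ℝ → ℝ) (hg : ContDiff ℝ (⊤:ℕ∞) g) (T : ℝ[X]) (hT : T.natDegree ≤ κ)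
    (hTx : ∀ x, g x = T.eval x + ∫ t in (-a)..x, (x-t)^κ * (iteratedDeriv (κ+1) g t / κ.factorial)) :
    ∃ U : ℝ[X], U.natDegree ≤ κ ∧ (∀ x, a ≤ x → Gf κ a g T x = U.eval x) ∧
      ∀ x, U.eval x - g x = ∫ t in x..a, (x-t)^κ * (iteratedDeriv (κ+1) g t / κ.factorial) := by
  have hc : Continuous (iteratedDeriv (κ+1) g) := hg.continuous_iteratedDeriv (κ+1) (by exact_mod_cast le_top)
  have hF : ∀ x, Continuous (fun t => (x-t)^κ * (iteratedDeriv (κ+1) g t / κ.factorial)) := by intro x; fun_prop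
  obtain ⟨P, hP, hPx⟩ := core_poly κ 0 a (fun _ _ => 1) (fun _ => continuous_const)
    (fun t => iteratedDeriv (κ+1) g t / κ.factorial) (by fun_prop)
  have hPx' : ∀ x, P.eval x = ∫ t in (-a)..a, (x-t)^κ * (iteratedDeriv (κ+1) g t / κ.factorial) := by
    intro x; rw [hPx x]; simp
  refine ⟨T + P, (natDegree_add_le _ _).trans (max_le hT (by omega)), ?_, ?_⟩
  · intro x hx
    rw [eval_add, hPx' x]
    unfold Gf
    congr 1
    apply intervalIntegral.integral_congr
    intro t ht
    rw [uIcc_of_le (by linarith)] at ht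
    simp [ht.2.trans hx]
  · intro x
    rw [eval_add, hPx' x, hTx x, ← intervalIntegral.integral_add_adjacent_intervals
      ((hF x).intervalIntegrable (-a) x) ((hF x).intervalIntegrable x a)]
    ring

open Polynomial in
lemma poly_shift (κ : ℕ) (U : ℝ[X]) (hU : U.natDegree ≤ κ) (x τ : ℝ) :
    U.eval x = ∑ i ∈ Finset.range (κ+1), (-1)^i * ((κ+1).choose (i+1) : ℝ) * U.eval (x + (i+1)*τ) := by
  have h := Polynomial.fwdDiff_iter_eq_zero_of_degree_lt (P := U.comp (C x + C τ * X)) (n := κ+1) (by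
    refine lt_of_le_of_lt natDegree_comp_le ?_
    have : (C x + C τ * X : ℝ[X]).natDegree ≤ 1 := by
      refine (natDegree_add_le _ _).trans (max_le (by simp) ?_)
      exact (natDegree_C_mul_le _ _).trans natDegree_X_le
    nlinarith)
  have h2 := congrFun h 0
  rw [fwdDiff_iter_eq_sum_shift, Finset.sum_range_succ'] at h2
  simp only [Pi.zero_apply, zero_add, nsmul_eq_mul, mul_one, eval_comp, eval_add, eval_C, eval_mul, eval_X, zsmul_eq_mul] at h2
  simp only [Nat.cast_zero, mul_zero, add_zero, Nat.choose_zero_right, Nat.sub_zero] at h2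
  push_cast at h2
  have h3 : ((-1:ℝ)^(κ+1)) * ((-1:ℝ)^(κ+1)) = 1 := by rw [← mul_pow]; simp
  have h4 : U.eval x = -((-1:ℝ)^(κ+1)) * ∑ i ∈ Finset.range (κ+1), (-1:ℝ)^(κ-i) * ((κ+1).choose (i+1)) * U.eval (x + τ*((i:ℝ)+1)) := by
    have : ∑ i ∈ Finset.range (κ+1), (-1:ℝ)^(κ-i) * ((κ+1).choose (i+1)) * U.eval (x + τ*((i:ℝ)+1)) = -((-1:ℝ)^(κ+1)) * U.eval x := by
      linarith
    rw [this]; linear_combination (-U.eval x) * h3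
  rw [h4, Finset.mul_sum]
  apply Finset.sum_congr rfl
  intro i hi
  have hi' := Finset.mem_range.1 hi
  rw [mul_comm τ]
  have : -((-1:ℝ)^(κ+1)) * (-1:ℝ)^(κ-i) = (-1)^i := by
    obtain ⟨j, hj⟩ : ∃ j, κ = i + j := ⟨κ - i, by omega⟩
    subst hj
    have : i + j - i = j := by omega
    rw [this, pow_succ, pow_add]
    have h5 : ((-1:ℝ)^j) * ((-1:ℝ)^j) = 1 := by rw [← mul_pow]; simp
    linear_combination ((-1:ℝ)^i) * h5
  rw [← this]; ring

lemma eLp_shift (q : ℝ≥0∞) (E R : Set ℝ) (hE : MeasurableSet E) (hR : MeasurableSet R) (s : ℝ) (h : ∀ x ∈ E, x + s ∈ R)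
    (g : ℝ → ℝ) (hg : Measurable g) :
    eLpNorm (fun x => g (x + s)) q (volume.restrict E) ≤ eLpNorm g q (volume.restrict R) := by
  rw [← eLpNorm_indicator_eq_eLpNorm_restrict hE, ← eLpNorm_indicator_eq_eLpNorm_restrict hR]
  have h1 := eLpNorm_comp_measurePreserving (p := q) (hg.indicator hR).aestronglyMeasurable
    (measurePreserving_add_right (volume : Measure ℝ) s)
  rw [← h1]
  apply eLpNorm_mono
  intro x
  by_cases hx : x ∈ E
  · simp [hx, h x hx]
  · simp [hx]

open Polynomial in
lemma end_est (q : ℝ≥0∞) (hq : 1 ≤ q) (hqt : q ≠ ∞) (κ : ℕ) (U : ℝ[X]) (hU : U.natDegree ≤ κ)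
    (w f g : ℝ → ℝ) (hw : Measurable w) (hf : Measurable f) (hg : Measurable g) (e0 d τ W D A1 A2 : ℝ) (hd : 0 ≤ d)
    (hD : 0 ≤ D) (hW : 0 ≤ W) (hA1 : 0 ≤ A1) (hA2 : 0 ≤ A2)
    (R : Set ℝ) (hR : MeasurableSet R) (hER : ∀ x ∈ Icc e0 (e0+d), ∀ i ∈ Finset.range (κ+1), x + ((i:ℝ)+1)*τ ∈ R)
    (hUg : ∀ x ∈ R, |U.eval x - g x| ≤ D)
    (h1 : eLpNorm (fun x => w x * f x) q (volume.restrict (Icc e0 (e0+d))) ≤ ENNReal.ofReal A1)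
    (h2 : eLpNorm g q (volume.restrict R) ≤ ENNReal.ofReal A2)
    (hwW : ∀ x ∈ Icc e0 (e0+d), |w x| ≤ W) :
    eLpNorm (fun x => w x * (f x - U.eval x)) q (volume.restrict (Icc e0 (e0+d))) ≤
      ENNReal.ofReal (A1 + W * ((κ+1) * 2^(κ+1) * (A2 + D * d^(1/q.toReal)))) := by
  have hUm : Measurable (fun x => U.eval x) := U.continuous.measurable
  have hdq : 0 ≤ d^(1/q.toReal) := Real.rpow_nonneg hd _
  set E := Icc e0 (e0+d) with hE
  have hEm : MeasurableSet E := measurableSet_Icc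
  have s1 : ∀ i ∈ Finset.range (κ+1), eLpNorm (fun x => (-1)^i * ((κ+1).choose (i+1) : ℝ) * U.eval (x + ((i:ℝ)+1)*τ)) q (volume.restrict E)
      ≤ ENNReal.ofReal (2^(κ+1) * (A2 + D * d^(1/q.toReal))) := by
    intro i hi
    have hs : eLpNorm (fun x => U.eval (x + ((i:ℝ)+1)*τ)) q (volume.restrict E) ≤ ENNReal.ofReal (A2 + D * d^(1/q.toReal)) := by
      have e : (fun x => U.eval (x + ((i:ℝ)+1)*τ)) = (fun x => g (x + ((i:ℝ)+1)*τ)) + (fun x => U.eval (x + ((i:ℝ)+1)*τ) - g (x + ((i:ℝ)+1)*τ)) := by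
        ext x; simp
      rw [e]
      refine (eLpNorm_add_le ?_ ?_ hq).trans ?_
      · exact (hg.comp (measurable_id.add_const _)).aestronglyMeasurable
      · exact ((hUm.comp (measurable_id.add_const _)).sub (hg.comp (measurable_id.add_const _))).aestronglyMeasurable
      · rw [ENNReal.ofReal_add hA2 (by positivity)]
        refine add_le_add ((eLp_shift q E R hEm hR _ (fun x hx => hER x hx i hi) g hg).trans h2) ?_
        have := eLp_upper_const q hq hqt e0 (e0+d) D (by linarith) hD (fun x => U.eval (x + ((i:ℝ)+1)*τ) - g (x + ((i:ℝ)+1)*τ))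
          (fun x hx => hUg _ (hER x hx i hi))
        simpa using this
    have := eLpNorm_const_smul ((-1)^i * ((κ+1).choose (i+1) : ℝ)) (fun x => U.eval (x + ((i:ℝ)+1)*τ)) q (volume.restrict E)
    have e2 : (fun x => (-1)^i * ((κ+1).choose (i+1) : ℝ) * U.eval (x + ((i:ℝ)+1)*τ)) = ((-1)^i * ((κ+1).choose (i+1) : ℝ)) • (fun x => U.eval (x + ((i:ℝ)+1)*τ)) := by
      ext x; simp
    rw [e2, this, ENNReal.ofReal_mul (by positivity)]
    refine mul_le_mul' ?_ hs
    rw [← ofReal_norm]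
    apply ENNReal.ofReal_le_ofReal
    rw [norm_mul, norm_pow]
    simp
    exact_mod_cast Nat.choose_le_two_pow _ _
  have s2 : eLpNorm (fun x => U.eval x) q (volume.restrict E) ≤ ENNReal.ofReal ((κ+1) * 2^(κ+1) * (A2 + D * d^(1/q.toReal))) := by
    have e : (fun x => U.eval x) = ∑ i ∈ Finset.range (κ+1), (fun x => (-1)^i * ((κ+1).choose (i+1) : ℝ) * U.eval (x + ((i:ℝ)+1)*τ)) := by
      ext x
      rw [Finset.sum_apply]
      exact poly_shift κ U hU x τ
    rw [e]
    refine (eLpNorm_sum_le ?_ hq).trans ?_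
    · intro i _
      exact ((hUm.comp (measurable_id.add_const _)).const_mul _).aestronglyMeasurable
    · refine (Finset.sum_le_sum s1).trans ?_
      rw [Finset.sum_const, Finset.card_range, nsmul_eq_mul, ← ENNReal.ofReal_natCast, ← ENNReal.ofReal_mul (by positivity)]
      apply ENNReal.ofReal_le_ofReal
      push_cast
      exact le_of_eq (by ring)
  have e : (fun x => w x * (f x - U.eval x)) = (fun x => w x * f x) - (fun x => w x * U.eval x) := by
    ext x; simp; ring
  rw [e, ENNReal.ofReal_add hA1 (by positivity)]
  refine (eLpNorm_sub_le (hw.mul hf).aestronglyMeasurable (hw.mul hUm).aestronglyMeasurable hq).trans (add_le_add h1 ?_)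
  rw [ENNReal.ofReal_mul hW]
  have h3 : eLpNorm (fun x => w x * U.eval x) q (volume.restrict E) ≤ eLpNorm (W • fun x => U.eval x) q (volume.restrict E) := by
    apply eLpNorm_mono_ae
    refine (ae_restrict_iff' hEm).2 (Eventually.of_forall ?_)
    intro x hx
    simp only [Pi.smul_apply, smul_eq_mul, norm_mul, Real.norm_eq_abs]
    rw [abs_of_nonneg hW]
    exact mul_le_mul_of_nonneg_right (hwW x hx) (abs_nonneg _)
  refine h3.trans ?_
  rw [eLpNorm_const_smul]
  refine mul_le_mul' ?_ s2
  rw [← ofReal_norm, Real.norm_eq_abs, abs_of_nonneg hW]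

lemma eLp_split (q : ℝ≥0∞) (hq : 1 ≤ q) (F : ℝ → ℝ) (hF : Measurable F) (a b c : ℝ) (hab : a ≤ b) (hbc : b ≤ c) :
    eLpNorm F q (volume.restrict (Icc a c)) ≤ eLpNorm F q (volume.restrict (Icc a b)) + eLpNorm F q (volume.restrict (Icc b c)) := by
  rw [← eLpNorm_indicator_eq_eLpNorm_restrict measurableSet_Icc, ← eLpNorm_indicator_eq_eLpNorm_restrict measurableSet_Icc,
    ← eLpNorm_indicator_eq_eLpNorm_restrict measurableSet_Icc]
  have h0 : eLpNorm ((Ioc b c).indicator F) q volume ≤ eLpNorm ((Icc b c).indicator F) q volume := by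
    apply eLpNorm_mono
    intro x
    by_cases hx : x ∈ Ioc b c
    · simp [hx, Ioc_subset_Icc_self hx]
    · simp [hx]
  refine le_trans ?_ (add_le_add_right h0 _)
  refine le_trans (le_of_eq ?_) (eLpNorm_add_le (hF.indicator measurableSet_Icc).aestronglyMeasurable (hF.indicator measurableSet_Ioc).aestronglyMeasurable hq)
  congr 1
  rw [← Icc_union_Ioc_eq_Icc hab hbc]
  exact indicator_union_of_disjoint (Set.disjoint_left.2 (fun x h1 h2 => by have := h1.2; have := h2.1; linarith)) F

lemma jacobi_lb (α β : ℝ) (hα : 0 ≤ α) (hβ : 0 ≤ β) (u v x : ℝ) (hu : 0 ≤ u) (hv : 0 ≤ v) (h1 : u ≤ 1 + x) (h2 : v ≤ 1 - x) :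
    u^α * v^β ≤ jacobi α β x := by
  unfold jacobi
  exact mul_le_mul (Real.rpow_le_rpow hu h1 hα) (Real.rpow_le_rpow hv h2 hβ) (Real.rpow_nonneg hv _)
    (Real.rpow_nonneg (hu.trans h1) _)

lemma jacobi_ub (α β : ℝ) (hα : 0 ≤ α) (hβ : 0 ≤ β) (u v x : ℝ) (hx : x ∈ Icc (-1:ℝ) 1) (h1 : 1 + x ≤ u) (h2 : 1 - x ≤ v) :
    jacobi α β x ≤ u^α * v^β := by
  have := hx.1
  have := hx.2
  unfold jacobi
  exact mul_le_mul (Real.rpow_le_rpow (by linarith) h1 hα) (Real.rpow_le_rpow (by linarith) h2 hβ)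
    (Real.rpow_nonneg (by linarith) _) (Real.rpow_nonneg (by linarith) _)

lemma holder1 (q p : ℝ≥0∞) (hqp : q ≤ p) (α β : ℝ) (f : ℝ → ℝ) (hf : f ∈ BSet p α β) (A B : ℝ) (hA : -1 ≤ A) (hAB : A ≤ B)
    (hB : B ≤ 1) (hexp : 0 ≤ 1/q.toReal - 1/p.toReal) :
    eLpNorm (fun x => jacobi α β x * f x) q (volume.restrict (Icc A B)) ≤ ENNReal.ofReal ((B-A)^(1/q.toReal - 1/p.toReal)) := by
  refine (eLpNorm_le_eLpNorm_mul_rpow_measure_univ hqp ((jacobi_meas α β).mul hf.1).aestronglyMeasurable).trans ?_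
  have h1 : eLpNorm (fun x => jacobi α β x * f x) p (volume.restrict (Icc A B)) ≤ 1 := by
    refine (eLpNorm_mono_measure _ (Measure.restrict_mono (Icc_subset_Icc hA hB) le_rfl)).trans ?_
    exact le_of_eq hf.2
  refine (mul_le_mul_left h1 _).trans ?_
  rw [one_mul, Measure.restrict_apply_univ, Real.volume_Icc, ENNReal.ofReal_rpow_of_nonneg (by linarith) hexp]

lemma holder2 (q p : ℝ≥0∞) (hqp : q ≤ p) (α β : ℝ) (f : ℝ → ℝ) (hf : f ∈ BSet p α β) (A B : ℝ) (hA : -1 ≤ A) (hAB : A ≤ B)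
    (hB : B ≤ 1) (hexp : 0 ≤ 1/q.toReal - 1/p.toReal) (W : ℝ) (hW : 0 < W) (hw : ∀ t ∈ Icc A B, W ≤ jacobi α β t) :
    eLpNorm f q (volume.restrict (Icc A B)) ≤ ENNReal.ofReal (W⁻¹ * (B-A)^(1/q.toReal - 1/p.toReal)) := by
  have h1 : eLpNorm f q (volume.restrict (Icc A B)) ≤ eLpNorm (W⁻¹ • fun x => jacobi α β x * f x) q (volume.restrict (Icc A B)) := by
    apply eLpNorm_mono_ae
    refine (ae_restrict_iff' measurableSet_Icc).2 (Eventually.of_forall ?_)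
    intro x hx
    simp only [Pi.smul_apply, smul_eq_mul, norm_mul, Real.norm_eq_abs]
    rw [abs_of_pos (inv_pos.2 hW), ← mul_assoc]
    have h2 : W ≤ |jacobi α β x| := (hw x hx).trans (le_abs_self _)
    have h3 : 1 ≤ W⁻¹ * |jacobi α β x| := by
      rw [inv_mul_eq_div, le_div_iff₀ hW]; linarith
    nlinarith [abs_nonneg (f x)]
  refine h1.trans ?_
  rw [eLpNorm_const_smul, ENNReal.ofReal_mul (inv_nonneg.2 hW.le)]
  refine mul_le_mul' ?_ (holder1 q p hqp α β f hf A B hA hAB hB hexp)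
  rw [← ofReal_norm, Real.norm_eq_abs, abs_of_pos (inv_pos.2 hW)]

lemma exists_good (k : ℕ) (q p : ℝ≥0∞) (hq : 1 ≤ q) (hqp : q < p) (α β : ℝ) (hα : 0 ≤ α) (hβ : 0 ≤ β)
    (f : ℝ → ℝ) (hf : f ∈ MSet k ∩ BSet p α β) (d : ℝ) (hd : 0 < d) (hd1 : d ≤ 1) :
    ∃ g, GoodG k α β (1/p.toReal) d g ∧
      eLpNorm (fun x => f x - g x) q (volume.restrict (Icc (-(1-d/4)) (1-d/4))) ≤ ENNReal.ofReal ((2^α*2^β)⁻¹ * (d/4)) ∧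
      (∀ M, 0 ≤ M → (∀ᵐ x, x ∈ Icc (-1:ℝ) 1 → |f x| ≤ M) → ∀ x, |g x| ≤ M) := by
  have hqt : q ≠ ∞ := ne_top_of_lt hqp
  have hQ : 1 ≤ q.toReal := by
    have := ENNReal.toReal_mono hqt hq
    simpa using this
  have hp1 : (1:ℝ≥0∞) ≤ p := hq.trans hqp.le
  have hexp : 0 ≤ 1/q.toReal - 1/p.toReal := by
    by_cases hp : p = ∞
    · subst hp; simp
    · have := ENNReal.toReal_mono hp hqp.le
      have := one_div_le_one_div_of_le (by linarith) this
      linarith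
  have hr0 : 0 ≤ 1/p.toReal := by positivity
  have hQ1 : 1/q.toReal ≤ 1 := by rw [div_le_one (by linarith)]; exact hQ
  have hr1 : 1/p.toReal ≤ 1 := by linarith
  set r := 1/p.toReal with hr
  have hfm : Measurable f := hf.2.1
  have h2 : (0:ℝ) < 2^α*2^β := by positivity
  set ε := (2^α*2^β)⁻¹ * (d/4) with hε
  have hεp : 0 < ε := by positivity
  have hmem : MemLp f q (volume.restrict (Icc (-(1-d/16)) (1-d/16))) := by
    refine ⟨hfm.aestronglyMeasurable, ?_⟩
    refine lt_of_le_of_lt (holder2 q p hqp.le α β f hf.2 (-(1-d/16)) (1-d/16) (by linarith) (by linarith) (by linarith) hexp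
      ((d/16)^α*(d/16)^β) (by positivity) ?_) ENNReal.ofReal_lt_top
    intro t ht
    exact jacobi_lb α β hα hβ _ _ t (by positivity) (by positivity) (by linarith [ht.1]) (by linarith [ht.2])
  obtain ⟨g, hg, hgk, hfg, hM⟩ := mollify k f hfm hf.1 q hq hqt (1-d/8) (1-d/16) (by linarith) (by linarith) (by linarith) hmem ε hεp
  refine ⟨g, ⟨hg, ?_, ?_⟩, ?_, hM⟩
  · intro t ht
    exact hgk t ⟨by linarith [ht.1], by linarith [ht.2]⟩
  · intro A B W hA hAB hB hdAB hW hw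
    have hgm : Measurable g := hg.continuous.measurable
    have n1 : eLpNorm f 1 (volume.restrict (Icc A B)) ≤ ENNReal.ofReal (W⁻¹ * (B-A)^(1 - r)) := by
      have := holder2 1 p hp1 α β f hf.2 A B (by linarith) hAB.le (by linarith) (by simp only [ENNReal.toReal_one]; linarith) W hW hw
      simpa [hr] using this
    have n2 : eLpNorm (fun x => f x - g x) 1 (volume.restrict (Icc A B)) ≤ ENNReal.ofReal (2*ε) := by
      refine (eLpNorm_le_eLpNorm_mul_rpow_measure_univ hq (hfm.sub hgm).aestronglyMeasurable).trans ?_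
      rw [Measure.restrict_apply_univ, Real.volume_Icc, mul_comm, ENNReal.ofReal_mul (by norm_num)]
      refine mul_le_mul' ?_ ?_
      · rw [ENNReal.ofReal_rpow_of_nonneg (by linarith) (by simpa using hQ1)]
        apply ENNReal.ofReal_le_ofReal
        have e0 : 0 ≤ 1/(1:ℝ≥0∞).toReal - 1/q.toReal := by simpa [hr] using hQ1
        have e1 : 1/(1:ℝ≥0∞).toReal - 1/q.toReal ≤ 1 := by simp
        calc (B-A)^(1/(1:ℝ≥0∞).toReal - 1/q.toReal) ≤ 2^(1/(1:ℝ≥0∞).toReal - 1/q.toReal) :=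
              Real.rpow_le_rpow (by linarith) (by linarith) e0
          _ ≤ 2^(1:ℝ) := Real.rpow_le_rpow_of_exponent_le (by norm_num) e1
          _ = 2 := by simp
      · refine (eLpNorm_mono_measure _ (Measure.restrict_mono (Icc_subset_Icc (by linarith) (by linarith)) le_rfl)).trans hfg
    have n3 : 2*ε ≤ W⁻¹ * (B-A)^(1-r) := by
      have hW2 : W ≤ 2^α*2^β := (hw A ⟨le_rfl, hAB.le⟩).trans (jacobi_upper α β hα hβ A ⟨by linarith, by linarith⟩)
      have hb : d/2 ≤ (B-A)^(1-r) := by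
        by_cases h : B - A ≤ 1
        · have := Real.rpow_le_rpow_of_exponent_ge (by linarith : 0 < B-A) h (by linarith : 1-r ≤ 1)
          rw [Real.rpow_one] at this
          linarith
        · have := Real.one_le_rpow (by linarith : 1 ≤ B-A) (by linarith : 0 ≤ 1-r)
          linarith
      have := inv_anti₀ hW hW2
      have h3 := mul_le_mul this hb (by positivity) (inv_nonneg.2 hW.le)
      rw [hε]; linarith
    have n4 : eLpNorm g 1 (volume.restrict (Icc A B)) ≤ ENNReal.ofReal (2 * W⁻¹ * (B-A)^(1-r)) := by
      have e : g = f - (fun x => f x - g x) := by ext x; simp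
      rw [e]
      refine (eLpNorm_sub_le hfm.aestronglyMeasurable (hfm.sub hgm).aestronglyMeasurable le_rfl).trans ?_
      refine (add_le_add n1 n2).trans ?_
      rw [← ENNReal.ofReal_add (mul_nonneg (inv_nonneg.2 hW.le) (Real.rpow_nonneg (by linarith) _)) (by positivity)]
      apply ENNReal.ofReal_le_ofReal
      linarith
    rw [eLpNorm_one_eq_lintegral_enorm, ← ofReal_integral_norm_eq_lintegral_enorm
      (hg.continuous.continuousOn.integrableOn_compact isCompact_Icc)] at n4
    rw [intervalIntegral.integral_of_le hAB.le, ← integral_Icc_eq_integral_Ioc]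
    refine (ENNReal.ofReal_le_ofReal_iff ?_).1 n4
    exact mul_nonneg (by positivity) (Real.rpow_nonneg (by linarith) _)
  · exact (eLpNorm_mono_measure _ (Measure.restrict_mono (Icc_subset_Icc (by linarith) (by linarith)) le_rfl)).trans hfg

lemma D_gen (κ : ℕ) (H : ℝ → ℝ) (hH : Continuous H) (u v L x y xx : ℝ) (hux : u ≤ x) (hxy : x ≤ y) (hyv : y ≤ v)
    (h0 : ∀ t ∈ Icc u v, 0 ≤ H t) (hL : ∀ t ∈ Icc x y, |xx - t| ≤ L) :
    |∫ t in x..y, (xx - t)^κ * (H t / κ.factorial)| ≤ L^κ * ∫ t in u..v, H t := by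
  have hL0 : 0 ≤ L := (abs_nonneg _).trans (hL x ⟨le_rfl, hxy⟩)
  have h1 : ‖∫ t in x..y, (xx - t)^κ * (H t / κ.factorial)‖ ≤ ∫ t in x..y, L^κ * H t := by
    refine intervalIntegral.norm_integral_le_of_norm_le hxy ?_ ((by fun_prop : Continuous (fun t => L^κ * H t)).intervalIntegrable _ _)
    refine Eventually.of_forall ?_
    intro t ht
    have ht' : t ∈ Icc x y := ⟨ht.1.le, ht.2⟩
    have hHt : 0 ≤ H t := h0 t ⟨hux.trans ht'.1, ht'.2.trans hyv⟩
    rw [norm_mul, norm_pow, Real.norm_eq_abs, Real.norm_eq_abs, abs_of_nonneg (by positivity : 0 ≤ H t / κ.factorial)]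
    refine mul_le_mul (pow_le_pow_left₀ (abs_nonneg _) (hL t ht') _) ?_ (by positivity) (by positivity)
    apply div_le_self hHt
    exact_mod_cast Nat.factorial_pos κ
  rw [Real.norm_eq_abs, intervalIntegral.integral_const_mul] at h1
  refine h1.trans (mul_le_mul_of_nonneg_left ?_ (by positivity))
  refine intervalIntegral.integral_mono_interval hux hxy hyv ?_ (hH.intervalIntegrable _ _)
  refine (ae_restrict_iff' measurableSet_Ioc).2 (Eventually.of_forall ?_)
  intro t ht
  exact h0 t ⟨ht.1.le, ht.2⟩

lemma D_sum (k : ℕ) (α β C r d : ℝ) (hα : 0 ≤ α) (hβ : 0 ≤ β) (hk : 1 ≤ k) (hC : 0 < C) (hr : 0 ≤ r) (hd : 0 < d) (H : ℝ → ℝ) (hH : Continuous H)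
    (hb : ∀ s, d ≤ s → s ≤ 1/2 → (∫ t in (1-2*s)..(1-s), H t ≤ C*s^(1 - k - r - β)) ∧
      (∫ t in (-1+s)..(-1+2*s), H t ≤ C*s^(1 - k - r - α))) :
    ∀ j : ℕ, 2^j * d ≤ 1 → (∫ t in (1-2^j*d)..(1-d), H t ≤ j * C * d^(1-k-r-β)) ∧
      (∫ t in (-1+d)..(-1+2^j*d), H t ≤ j * C * d^(1-k-r-α)) := by
  have hk' : (1:ℝ) ≤ k := by exact_mod_cast hk
  intro j
  induction j with
  | zero => intro _; simp
  | succ j ih =>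
    intro hj
    have hj2 : 2^j * d ≤ 1/2 := by rw [pow_succ] at hj; linarith
    have h1j : (1:ℝ) ≤ 2^j := one_le_pow₀ (by norm_num)
    have hdj : d ≤ 2^j*d := by nlinarith
    obtain ⟨i1, i2⟩ := ih (by linarith)
    obtain ⟨b1, b2⟩ := hb (2^j*d) hdj hj2
    have e : 2*(2^j*d) = 2^(j+1)*d := by ring
    rw [e] at b1 b2
    have m : ∀ γ, 0 ≤ γ → C*(2^j*d)^(1-k-r-γ) ≤ C * d^(1-k-r-γ) := by
      intro γ hγ
      apply mul_le_mul_of_nonneg_left _ hC.le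
      exact Real.rpow_le_rpow_of_nonpos hd hdj (by linarith)
    have m1 := m β hβ
    have m2 := m α hα
    constructor
    · rw [← intervalIntegral.integral_add_adjacent_intervals (hH.intervalIntegrable _ (1-2^j*d)) (hH.intervalIntegrable _ _)]
      push_cast
      linarith
    · rw [← intervalIntegral.integral_add_adjacent_intervals (hH.intervalIntegrable _ (-1+2^j*d)) (hH.intervalIntegrable _ _)]
      push_cast
      linarith

open Polynomial in
lemma end_use (q p : ℝ≥0∞) (hq : 1 ≤ q) (hqp : q < p) (κ : ℕ) (α β γ δ C d τ e0 r0 : ℝ)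
    (hα : 0 ≤ α) (hβ : 0 ≤ β) (hγ : 0 ≤ γ) (hC : 0 ≤ C) (hd : 0 < d) (hd1 : d ≤ 1)
    (f g : ℝ → ℝ) (hf : f ∈ BSet p α β) (hg : Measurable g)
    (hfg : eLpNorm (fun x => f x - g x) q (volume.restrict (Icc (-(1-d/4)) (1-d/4))) ≤ ENNReal.ofReal ((2^α*2^β)⁻¹ * (d/4)))
    (U : ℝ[X]) (hU : U.natDegree ≤ κ)
    (he0 : -1 ≤ e0) (he1 : e0 + d ≤ 1) (hr0 : -(1-d/4) ≤ r0) (hr1 : r0 + (κ+1)*d ≤ 1-d/4)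
    (hER : ∀ x ∈ Icc e0 (e0+d), ∀ i ∈ Finset.range (κ+1), x + ((i:ℝ)+1)*τ ∈ Icc r0 (r0 + (κ+1)*d))
    (hUg : ∀ x ∈ Icc r0 (r0 + (κ+1)*d), |U.eval x - g x| ≤ C * d^(-(1/p.toReal)-γ))
    (hwR : ∀ x ∈ Icc r0 (r0 + (κ+1)*d), d^γ ≤ jacobi α β x)
    (hwE : ∀ x ∈ Icc e0 (e0+d), |jacobi α β x| ≤ 2^δ * d^γ) :
    eLpNorm (fun x => jacobi α β x * (f x - U.eval x)) q (volume.restrict (Icc e0 (e0+d))) ≤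
      ENNReal.ofReal ((1 + 2^δ * ((κ+1) * 2^(κ+1) * ((κ+2) + C))) * d^(1/q.toReal - 1/p.toReal)) := by
  have hqt : q ≠ ∞ := ne_top_of_lt hqp
  have hQ : 1 ≤ q.toReal := by
    have := ENNReal.toReal_mono hqt hq
    simpa using this
  have hexp : 0 ≤ 1/q.toReal - 1/p.toReal := by
    by_cases hp : p = ∞
    · subst hp; simp
    · have := ENNReal.toReal_mono hp hqp.le
      have := one_div_le_one_div_of_le (by linarith) this
      linarith
  have hr0' : 0 ≤ 1/p.toReal := by positivity
  have hQ1 : 1/q.toReal ≤ 1 := by rw [div_le_one (by linarith)]; exact hQ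
  set r := 1/p.toReal with hr
  set s := 1/q.toReal - r with hs
  have hfm : Measurable f := hf.1
  have hκ : (0:ℝ) ≤ κ := by positivity
  have hκd : 0 < ((κ:ℝ)+1)*d := by positivity
  have hds : 0 < d^s := by positivity
  have hdg : 0 < d^γ := by positivity
  have A1 := holder1 q p hqp.le α β f hf e0 (e0+d) he0 (by linarith) he1 hexp
  rw [add_sub_cancel_left] at A1
  have A2 : eLpNorm g q (volume.restrict (Icc r0 (r0 + (κ+1)*d))) ≤ ENNReal.ofReal ((κ+2) * ((d^γ)⁻¹ * d^s)) := by
    have e : g = f - (fun x => f x - g x) := by ext x; simp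
    rw [e]
    refine (eLpNorm_sub_le hfm.aestronglyMeasurable (hfm.sub hg).aestronglyMeasurable hq).trans ?_
    have n1 := holder2 q p hqp.le α β f hf r0 (r0 + (κ+1)*d) (by linarith) (by linarith) (by linarith) hexp (d^γ) hdg hwR
    rw [add_sub_cancel_left] at n1
    have n2 := (eLpNorm_mono_measure (p := q) (fun x => f x - g x) (Measure.restrict_mono (μ := volume) (Icc_subset_Icc hr0 hr1) le_rfl)).trans hfg
    refine (add_le_add n1 n2).trans ?_
    rw [← ENNReal.ofReal_add (by positivity) (by positivity)]
    apply ENNReal.ofReal_le_ofReal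
    have m1 : (((κ:ℝ)+1)*d)^(1/q.toReal - 1/p.toReal) ≤ (κ+1) * d^s := by
      rw [Real.mul_rpow (by positivity) hd.le]
      apply mul_le_mul_of_nonneg_right _ hds.le
      calc ((κ:ℝ)+1)^s ≤ ((κ:ℝ)+1)^(1:ℝ) := Real.rpow_le_rpow_of_exponent_le (by linarith) (by linarith)
        _ = _ := Real.rpow_one _
    have m2 : ((2:ℝ)^α*2^β)⁻¹ * (d/4) ≤ (d^γ)⁻¹ * d^s := by
      have h1 : ((2:ℝ)^α*2^β)⁻¹ ≤ 1 := by
        apply inv_le_one_of_one_le₀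
        exact one_le_mul_of_one_le_of_one_le (Real.one_le_rpow (by norm_num) hα) (Real.one_le_rpow (by norm_num) hβ)
      have h2 : 1 ≤ (d^γ)⁻¹ := (one_le_inv₀ hdg).2 (Real.rpow_le_one hd.le hd1 hγ)
      have h3 : d ≤ d^s := by
        have := Real.rpow_le_rpow_of_exponent_ge hd hd1 (by linarith : s ≤ 1)
        rwa [Real.rpow_one] at this
      calc ((2:ℝ)^α*2^β)⁻¹ * (d/4) ≤ 1 * d^s := mul_le_mul h1 (by linarith) (by positivity) (by norm_num)
        _ ≤ _ := mul_le_mul_of_nonneg_right h2 hds.le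
    have m3 := mul_le_mul_of_nonneg_left m1 (inv_nonneg.2 hdg.le)
    have : (κ+2) * ((d^γ)⁻¹ * d^s) = (d^γ)⁻¹ * ((κ+1) * d^s) + (d^γ)⁻¹ * d^s := by ring
    linarith
  refine (end_est q hq hqt κ U hU (jacobi α β) f g (jacobi_meas α β) hfm hg e0 d τ (2^δ * d^γ) (C * d^(-r-γ)) (d^s)
    ((κ+2) * ((d^γ)⁻¹ * d^s)) hd.le (by positivity) (by positivity) hds.le (by positivity) _ measurableSet_Icc hER hUg A1 A2 hwE).trans ?_
  apply ENNReal.ofReal_le_ofReal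
  have e1 : C * d^(-r-γ) * d^(1/q.toReal) = C * ((d^γ)⁻¹ * d^s) := by
    rw [mul_assoc, ← Real.rpow_add hd, ← Real.rpow_neg hd.le, ← Real.rpow_add hd]
    congr 2; rw [hs]; ring
  rw [e1]
  apply le_of_eq
  field_simp

set_option maxHeartbeats 2000000 in
open Polynomial in
lemma ends (κ : ℕ) (q p : ℝ≥0∞) (hq : 1 ≤ q) (hqp : q < p) (α β : ℝ) (hα : 0 ≤ α) (hβ : 0 ≤ β) :
    ∃ C > (0:ℝ), ∀ m : ℕ, 2 ≤ m → 2^(κ+1) ≤ m^2 → ∀ f ∈ MSet (κ+1) ∩ BSet p α β, ∃ (g : ℝ → ℝ) (T : ℝ[X]), T.natDegree ≤ κ ∧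
      GoodG (κ+1) α β (1/p.toReal) (1/(m:ℝ)^2) g ∧
      (∀ M, 0 ≤ M → (∀ᵐ x, x ∈ Icc (-1:ℝ) 1 → |f x| ≤ M) → ∀ x, |g x| ≤ M) ∧
      Measurable (Gf κ (1 - 1/(m:ℝ)^2) g T) ∧
      eLpNorm (fun x => jacobi α β x * (f x - Gf κ (1 - 1/(m:ℝ)^2) g T x)) q (volume.restrict (Icc (-1) 1)) ≤
        ENNReal.ofReal (C * (1/(m:ℝ)^2)^(1/q.toReal - 1/p.toReal)) := by
  obtain ⟨Cb, hCb, hblock⟩ := block (κ+1) α β hα hβ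
  have hqt : q ≠ ∞ := ne_top_of_lt hqp
  have hQ : 1 ≤ q.toReal := by
    have := ENNReal.toReal_mono hqt hq
    simpa using this
  have hexp : 0 ≤ 1/q.toReal - 1/p.toReal := by
    by_cases hp : p = ∞
    · subst hp; simp
    · have := ENNReal.toReal_mono hp hqp.le
      have := one_div_le_one_div_of_le (by linarith) this
      linarith
  have hr0' : 0 ≤ 1/p.toReal := by positivity
  have hQ1 : 1/q.toReal ≤ 1 := by rw [div_le_one (by linarith)]; exact hQ
  set r := 1/p.toReal with hr
  set s := 1/q.toReal - r with hs
  set CD : ℝ := ((κ:ℝ)+1)^κ * ((κ+1) * Cb) with hCD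
  have hCDp : 0 < CD := by positivity
  set K1 : ℝ := 1 + 2^α * (((κ:ℝ)+1) * 2^(κ+1) * ((κ+2) + CD)) with hK1
  set K2 : ℝ := 1 + 2^β * (((κ:ℝ)+1) * 2^(κ+1) * ((κ+2) + CD)) with hK2
  have hK1p : 0 < K1 := by positivity
  have hK2p : 0 < K2 := by positivity
  refine ⟨K2 + (1 + K1), by positivity, ?_⟩
  intro m hm hkm f hf
  have hm' : (2:ℝ) ≤ m := by exact_mod_cast hm
  have hkm' : (2:ℝ)^(κ+1) ≤ (m:ℝ)^2 := by exact_mod_cast hkm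
  have hd : 0 < 1/(m:ℝ)^2 := by positivity
  have hd4 : 1/(m:ℝ)^2 ≤ 1/4 := one_div_le_one_div_of_le (by norm_num) (by nlinarith)
  have hkd : 2^(κ+1) * (1/(m:ℝ)^2) ≤ 1 := by
    rw [mul_one_div, div_le_one (by positivity)]; exact hkm'
  have hk2 : ((κ:ℝ)+2) ≤ 2^(κ+1) := by
    have := Nat.lt_two_pow_self (n := κ+1)
    exact_mod_cast this
  set d := 1/(m:ℝ)^2 with hdd
  have hκ : (0:ℝ) ≤ κ := by positivity
  have hk2d : ((κ:ℝ)+2)*d ≤ 1 := by nlinarith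
  have hκd : 0 ≤ (κ:ℝ)*d := by positivity
  obtain ⟨g, hgood, hfg, hM⟩ := exists_good (κ+1) q p hq hqp α β hα hβ f hf d hd (by linarith)
  have hgs := hgood.1
  have hfm : Measurable f := hf.2.1
  have hgm : Measurable g := hgs.continuous.measurable
  have hH : Continuous (iteratedDeriv (κ+1) g) := hgs.continuous_iteratedDeriv (κ+1) (by exact_mod_cast le_top)
  have hDs := D_sum (κ+1) α β Cb r d hα hβ (by omega) hCb hr0' hd (iteratedDeriv (κ+1) g) hH
    (fun s h1 h2 => hblock r d g hr0' (by linarith) hd hgood s h1 h2) (κ+1) hkd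
  push_cast at hDs
  obtain ⟨T, hT, hTx⟩ := taylor_ex g hgs (-(1-d)) κ
  obtain ⟨U, hU, hUx, hUg⟩ := Gf_right κ (1-d) (by linarith) g hgs T hT hTx
  have hds : 0 < d^s := by positivity
  have hdsd : d ≤ d^s := by
    have := Real.rpow_le_rpow_of_exponent_ge hd (by linarith) (by linarith : s ≤ 1)
    rwa [Real.rpow_one] at this
  have hpw : ∀ γ, (((κ:ℝ)+1)*d)^κ * ((κ+1) * Cb * d^(1-((κ:ℝ)+1)-r-γ)) = CD * d^(-r-γ) := by
    intro γ
    have : d^(-r-γ) = d^κ * d^(1-((κ:ℝ)+1)-r-γ) := by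
      rw [← Real.rpow_natCast, ← Real.rpow_add hd]; congr 1; ring
    rw [this, mul_pow, hCD]; ring
  -- right
  have R : eLpNorm (fun x => jacobi α β x * (f x - U.eval x)) q (volume.restrict (Icc (1-d) 1)) ≤ ENNReal.ofReal (K1 * d^s) := by
    have e1 : 1 - ((κ:ℝ)+2)*d + (κ+1)*d = 1 - d := by ring
    have := end_use q p hq hqp κ α β β α CD d (-d) (1-d) (1-((κ:ℝ)+2)*d) hα hβ hβ hCDp.le hd (by linarith) f g hf.2 hgm hfg U hU
      (by linarith) (by linarith) (by linarith) (by linarith) ?_ ?_ ?_ ?_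
    · rwa [sub_add_cancel] at this
    · intro x hx i hi
      have hi' : (i:ℝ) ≤ κ := by exact_mod_cast Nat.lt_succ_iff.1 (Finset.mem_range.1 hi)
      have hi0 : (0:ℝ) ≤ i := by positivity
      constructor
      · nlinarith [hx.1]
      · nlinarith [hx.2]
    · intro x hx
      rw [e1] at hx
      rw [hUg x]
      refine (D_gen κ _ hH (1-2^(κ+1)*d) (1-d) (((κ:ℝ)+1)*d) x (1-d) x ?_ hx.2 le_rfl ?_ ?_).trans ?_
      · nlinarith [hx.1]
      · intro t ht
        exact hgood.2.1 t ⟨by linarith [ht.1], by linarith [ht.2]⟩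
      · intro t ht
        rw [abs_le]; constructor
        · linarith [ht.2, hx.1]
        · linarith [ht.1, hx.1]
      · rw [← hpw]
        exact mul_le_mul_of_nonneg_left hDs.1 (by positivity)
    · intro x hx
      rw [e1] at hx
      have := jacobi_lb α β hα hβ 1 d x (by norm_num) hd.le (by linarith [hx.1]) (by linarith [hx.2])
      simpa using this
    · intro x hx
      have hx1 : x ∈ Icc (-1:ℝ) 1 := ⟨by linarith [hx.1], by linarith [hx.2]⟩
      rw [abs_of_nonneg (jacobi_nonneg α β hx1)]
      exact jacobi_ub α β hα hβ 2 d x hx1 (by linarith [hx.2]) (by linarith [hx.1])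
  have L : eLpNorm (fun x => jacobi α β x * (f x - T.eval x)) q (volume.restrict (Icc (-1) (-(1-d)))) ≤ ENNReal.ofReal (K2 * d^s) := by
    have e1 : -1 + d + ((κ:ℝ)+1)*d = -1 + ((κ:ℝ)+2)*d := by ring
    have := end_use q p hq hqp κ α β α β CD d d (-1) (-1+d) hα hβ hα hCDp.le hd (by linarith) f g hf.2 hgm hfg T hT
      (by linarith) (by linarith) (by linarith) (by linarith) ?_ ?_ ?_ ?_
    · rwa [show -1 + d = -(1-d) by ring] at this
    · intro x hx i hi
      have hi' : (i:ℝ) ≤ κ := by exact_mod_cast Nat.lt_succ_iff.1 (Finset.mem_range.1 hi)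
      have hi0 : (0:ℝ) ≤ i := by positivity
      constructor
      · nlinarith [hx.1]
      · nlinarith [hx.2]
    · intro x hx
      rw [e1] at hx
      have e2 : T.eval x - g x = -∫ t in (-(1-d))..x, (x-t)^κ * (iteratedDeriv (κ+1) g t / κ.factorial) := by
        rw [hTx x]; ring
      rw [e2, abs_neg]
      refine (D_gen κ _ hH (-1+d) (-1+2^(κ+1)*d) (((κ:ℝ)+1)*d) (-(1-d)) x x (by linarith) (by linarith [hx.1]) ?_ ?_ ?_).trans ?_
      · nlinarith [hx.2]
      · intro t ht
        exact hgood.2.1 t ⟨by linarith [ht.1], by linarith [ht.2]⟩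
      · intro t ht
        rw [abs_le]; constructor
        · linarith [ht.2, hx.1]
        · linarith [ht.1, hx.2]
      · rw [← hpw]
        exact mul_le_mul_of_nonneg_left hDs.2 (by positivity)
    · intro x hx
      rw [e1] at hx
      have := jacobi_lb α β hα hβ d 1 x hd.le (by norm_num) (by linarith [hx.1]) (by linarith [hx.2])
      simpa using this
    · intro x hx
      have hx1 : x ∈ Icc (-1:ℝ) 1 := ⟨by linarith [hx.1], by linarith [hx.2]⟩
      rw [abs_of_nonneg (jacobi_nonneg α β hx1), mul_comm]
      exact jacobi_ub α β hα hβ d 2 x hx1 (by linarith [hx.2]) (by linarith [hx.1])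
  have hGl : ∀ x, x ≤ -(1-d) → Gf κ (1-d) g T x = T.eval x := fun x hx => Gf_left κ (1-d) (by linarith) g T x hx
  have hGm : ∀ x ∈ Icc (-(1-d)) (1-d), Gf κ (1-d) g T x = g x := fun x hx => Gf_mid κ (1-d) g hgs T hTx x hx
  have hGmeas : Measurable (Gf κ (1-d) g T) := by
    have e : Gf κ (1-d) g T = fun x => if x ≤ -(1-d) then T.eval x else if 1-d ≤ x then U.eval x else g x := by
      ext x
      split_ifs with h1 h2
      · exact hGl x h1
      · exact hUx x h2
      · exact hGm x ⟨by linarith, by linarith⟩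
    rw [e]
    exact Measurable.ite measurableSet_Iic T.continuous.measurable (Measurable.ite measurableSet_Ici U.continuous.measurable hgm)
  have Mid : eLpNorm (fun x => jacobi α β x * (f x - Gf κ (1-d) g T x)) q (volume.restrict (Icc (-(1-d)) (1-d))) ≤ ENNReal.ofReal (1 * d^s) := by
    have h1 : eLpNorm (fun x => jacobi α β x * (f x - Gf κ (1-d) g T x)) q (volume.restrict (Icc (-(1-d)) (1-d))) ≤
        eLpNorm (((2:ℝ)^α*2^β) • (fun x => f x - g x)) q (volume.restrict (Icc (-(1-d)) (1-d))) := by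
      apply eLpNorm_mono_ae
      refine (ae_restrict_iff' measurableSet_Icc).2 (Eventually.of_forall ?_)
      intro x hx
      have hx1 : x ∈ Icc (-1:ℝ) 1 := ⟨by linarith [hx.1], by linarith [hx.2]⟩
      rw [hGm x hx]
      simp only [Pi.smul_apply, smul_eq_mul, norm_mul, Real.norm_eq_abs]
      rw [abs_of_nonneg (jacobi_nonneg α β hx1), ← abs_mul, abs_of_nonneg (by positivity : 0 ≤ (2:ℝ)^α*2^β)]
      exact mul_le_mul_of_nonneg_right (jacobi_upper α β hα hβ x hx1) (abs_nonneg _)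
    refine h1.trans ?_
    rw [eLpNorm_const_smul]
    have h2 := (eLpNorm_mono_measure (p := q) (fun x => f x - g x) (Measure.restrict_mono (μ := volume)
      (Icc_subset_Icc (by linarith : -(1-d/4) ≤ -(1-d)) (by linarith : 1-d ≤ 1-d/4)) le_rfl)).trans hfg
    refine (mul_le_mul_right h2 _).trans ?_
    rw [← ofReal_norm, Real.norm_eq_abs, abs_of_pos (by positivity), ← ENNReal.ofReal_mul (by positivity)]
    apply ENNReal.ofReal_le_ofReal
    rw [mul_inv_cancel_left₀ (by positivity)]
    linarith
  refine ⟨g, T, hT, hgood, hM, hGmeas, ?_⟩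
  have hFm : Measurable (fun x => jacobi α β x * (f x - Gf κ (1-d) g T x)) := (jacobi_meas α β).mul (hfm.sub hGmeas)
  refine (eLp_split q hq _ hFm (-1) (-(1-d)) 1 (by linarith) (by linarith)).trans ?_
  rw [add_mul, ENNReal.ofReal_add (by positivity) (by positivity)]
  refine add_le_add ?_ ((eLp_split q hq _ hFm (-(1-d)) (1-d) 1 (by linarith) (by linarith)).trans ?_)
  · refine le_trans (eLpNorm_mono_ae ?_) L
    refine (ae_restrict_iff' measurableSet_Icc).2 (Eventually.of_forall ?_)
    intro x hx
    rw [hGl x hx.2]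
  · rw [add_mul, ENNReal.ofReal_add (by positivity) (by positivity)]
    refine add_le_add Mid (le_trans (eLpNorm_mono_ae ?_) R)
    refine (ae_restrict_iff' measurableSet_Icc).2 (Eventually.of_forall ?_)
    intro x hx
    rw [hUx x hx.1]

lemma en_le (n : ℕ) (f w : ℝ → ℝ) (q : ℝ≥0∞) (P : Polynomial ℝ) (hP : P.natDegree ≤ n) :
    En n f w q ≤ eLpNorm (fun x => w x * (f x - P.eval x)) q (volume.restrict (Icc (-1) 1)) :=
  iInf₂_le P hP

set_option maxHeartbeats 1000000 in
lemma upper_gen (κ : ℕ) (q p : ℝ≥0∞) (hq : 1 ≤ q) (hqp : q < p) (α β : ℝ) (hα : 0 ≤ α) (hβ : 0 ≤ β)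
    (θ CR : ℝ) (hθ0 : 0 ≤ θ) (hθ : θ ≤ 2 / q.toReal - 2 / p.toReal) (hCR : 0 < CR)
    (hR : ∀ i : ℕ, 1 ≤ i → ∀ g, GoodG (κ+1) α β (1/p.toReal) (1/((2^i:ℕ):ℝ)^2) g →
      (p = ∞ → α = 0 → β = 0 → ∀ x, |g x| ≤ 1) →
      (∫ t in (-(1 - 1/((2^i:ℕ):ℝ)^2))..(1 - 1/((2^i:ℕ):ℝ)^2), jacobi α β t * (rho (2^i) t)^(κ + 1/q.toReal) * iteratedDeriv (κ+1) g t)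
        ≤ CR * ((2^i:ℕ):ℝ)^(-θ)) :
    ∃ c > (0:ℝ), ∀ n : ℕ, 1 ≤ n → EClass (MSet (κ+1) ∩ BSet p α β) n (jacobi α β) q ≤ ENNReal.ofReal (c * (n:ℝ)^(-θ)) := by
  have hqt : q ≠ ∞ := ne_top_of_lt hqp
  have hQ : 1 ≤ q.toReal := by
    have := ENNReal.toReal_mono hqt hq
    simpa using this
  have hexp : 0 ≤ 1/q.toReal - 1/p.toReal := by
    by_cases hp : p = ∞
    · subst hp; simp
    · have := ENNReal.toReal_mono hp hqp.le
      have := one_div_le_one_div_of_le (by linarith) this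
      linarith
  have hr0 : 0 ≤ 1/p.toReal := by positivity
  have hQ1 : 1/q.toReal ≤ 1 := by rw [div_le_one (by linarith)]; exact hQ
  have hθs : θ ≤ 2 * (1/q.toReal - 1/p.toReal) := by
    refine hθ.trans (le_of_eq ?_); ring
  obtain ⟨C1, hC1, hends⟩ := ends κ q p hq hqp α β hα hβ
  obtain ⟨C2, hC2, N0, hN0, hcore⟩ := core κ α β hα hβ q hq hqt
  set K : ℝ := C1 + (C2 * CR + 2) with hK
  have hKp : 0 < K := by positivity
  have main : ∀ i : ℕ, κ + 1 ≤ i → ∀ f ∈ MSet (κ+1) ∩ BSet p α β, ∀ n, N0 * 2^i + κ ≤ n →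
      En n f (jacobi α β) q ≤ ENNReal.ofReal (K * ((2^i:ℕ):ℝ)^(-θ)) := by
    intro i hi f hf n hn
    have hm : 2 ≤ 2^i := by
      calc 2 = 2^1 := by norm_num
        _ ≤ 2^i := Nat.pow_le_pow_right (by norm_num) (by omega)
    have hkm : 2^(κ+1) ≤ (2^i)^2 := by
      rw [← pow_mul]; exact Nat.pow_le_pow_right (by norm_num) (by omega)
    obtain ⟨g, T, hT, hgood, hM, hGm, hbd⟩ := hends (2^i) hm hkm f hf
    obtain ⟨P, hP, hPb⟩ := hcore (2^i) hm (1/p.toReal) g T hT hgood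
    have hg1 : p = ∞ → α = 0 → β = 0 → ∀ x, |g x| ≤ 1 := by
      rintro rfl rfl rfl
      apply hM 1 zero_le_one
      have h1 : eLpNorm (fun x => jacobi 0 0 x * f x) ∞ (volume.restrict (Icc (-1) 1)) = 1 := hf.2.2
      have h2 := ae_le_eLpNormEssSup (f := fun x => jacobi 0 0 x * f x) (μ := volume.restrict (Icc (-1:ℝ) 1))
      rw [← eLpNorm_exponent_top, h1] at h2
      have h3 := (ae_restrict_iff' measurableSet_Icc).1 h2
      filter_upwards [h3] with x hx hx1
      have := hx hx1
      rw [← ofReal_norm, ENNReal.ofReal_le_one] at this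
      simpa [jacobi] using this
    have hint := hR i (by omega) g hgood hg1
    set m : ℝ := ((2^i:ℕ):ℝ) with hmdef
    have hm1 : 1 ≤ m := by rw [hmdef]; exact_mod_cast (by omega : 1 ≤ 2^i)
    have hm0 : 0 < m := by linarith
    have e1 : ∀ y : ℝ, (1/m^2)^y = m^(-(2*y)) := by
      intro y
      rw [one_div, ← Real.rpow_natCast, ← Real.rpow_neg hm0.le, ← Real.rpow_mul hm0.le]
      congr 1; push_cast; ring
    have d1 : (1/m^2)^(1/q.toReal - 1/p.toReal) ≤ m^(-θ) := by
      rw [e1]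
      exact Real.rpow_le_rpow_of_exponent_le hm1 (by linarith)
    have d2 : 1/m^2 ≤ m^(-θ) := by
      have := e1 1
      rw [Real.rpow_one] at this
      rw [this]
      exact Real.rpow_le_rpow_of_exponent_le hm1 (by linarith)
    have hmt : 0 < m^(-θ) := by positivity
    refine (en_le n f _ q P (hP.trans hn)).trans ?_
    have e : (fun x => jacobi α β x * (f x - P.eval x)) = (fun x => jacobi α β x * (f x - Gf κ (1 - 1/m^2) g T x))
        + (fun x => jacobi α β x * (Gf κ (1 - 1/m^2) g T x - P.eval x)) := by
      ext x; simp; ring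
    rw [e]
    refine (eLpNorm_add_le ((jacobi_meas α β).mul (hf.2.1.sub hGm)).aestronglyMeasurable
      ((jacobi_meas α β).mul (hGm.sub P.continuous.measurable)).aestronglyMeasurable hq).trans ?_
    have f1 : eLpNorm (fun x => jacobi α β x * (f x - Gf κ (1 - 1/m^2) g T x)) q (volume.restrict (Icc (-1) 1)) ≤ ENNReal.ofReal (C1 * m^(-θ)) :=
      hbd.trans (ENNReal.ofReal_le_ofReal (mul_le_mul_of_nonneg_left d1 hC1.le))
    have f2 : eLpNorm (fun x => jacobi α β x * (Gf κ (1 - 1/m^2) g T x - P.eval x)) q (volume.restrict (Icc (-1) 1)) ≤ ENNReal.ofReal ((C2*CR+2) * m^(-θ)) := by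
      refine hPb.trans (ENNReal.ofReal_le_ofReal ?_)
      have := mul_le_mul_of_nonneg_left hint hC2.le
      rw [add_mul, mul_assoc]
      linarith
    refine (add_le_add f1 f2).trans ?_
    rw [← ENNReal.ofReal_add (by positivity) (by positivity), hK, add_mul C1]
  set L := N0 + κ with hL
  have hL1 : 1 ≤ L := by omega
  have hLr : (1:ℝ) ≤ L := by exact_mod_cast hL1
  refine ⟨K * (2*L)^θ + 2 * ((L*2^(κ+1) : ℕ):ℝ)^θ, by positivity, ?_⟩
  intro n hn
  have hnr : (1:ℝ) ≤ n := by exact_mod_cast hn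
  have hn0 : (0:ℝ) < n := by linarith
  have hnt : 0 < (n:ℝ)^(-θ) := by positivity
  refine iSup₂_le ?_
  intro f hf
  by_cases hc : L * 2^(κ+1) ≤ n
  · have hdiv : 2^(κ+1) ≤ n / L := (Nat.le_div_iff_mul_le (by omega)).2 (by rw [mul_comm]; exact hc)
    have hne : n / L ≠ 0 := by have := Nat.one_le_two_pow (n := κ+1); omega
    set i := Nat.log 2 (n/L) with hi
    have h1 : 2^i ≤ n/L := Nat.pow_log_le_self 2 hne
    have h2 : n/L < 2^(i+1) := Nat.lt_pow_succ_log_self (by norm_num) _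
    have h3 : κ + 1 ≤ i := Nat.le_log_of_pow_le (by norm_num) hdiv
    have h4 : 2^i * L ≤ n := (Nat.le_div_iff_mul_le (by omega)).1 h1
    have h5 : n < 2^(i+1) * L := (Nat.div_lt_iff_lt_mul (by omega)).1 h2
    have h6 : N0 * 2^i + κ ≤ n := by
      have := Nat.one_le_two_pow (n := i)
      have : κ ≤ κ * 2^i := Nat.le_mul_of_pos_right _ (by omega)
      have : 2^i * L = N0 * 2^i + κ * 2^i := by rw [hL]; ring
      omega
    refine (main i h3 f hf n h6).trans (ENNReal.ofReal_le_ofReal ?_)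
    have h7 : (n:ℝ)/(2*L) ≤ ((2^i:ℕ):ℝ) := by
      rw [div_le_iff₀ (by positivity)]
      have : (n:ℝ) ≤ ((2^(i+1) * L : ℕ):ℝ) := by exact_mod_cast h5.le
      refine this.trans (le_of_eq ?_)
      push_cast; ring
    have h8 : ((2^i:ℕ):ℝ)^(-θ) ≤ (2*L)^θ * (n:ℝ)^(-θ) := by
      refine (Real.rpow_le_rpow_of_nonpos (by positivity) h7 (by linarith)).trans (le_of_eq ?_)
      rw [Real.div_rpow hn0.le (by positivity), Real.rpow_neg (by positivity : (0:ℝ) ≤ 2*L), div_inv_eq_mul, mul_comm]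
    have := mul_le_mul_of_nonneg_left h8 hKp.le
    have h9 : 0 ≤ 2 * ((L*2^(κ+1) : ℕ):ℝ)^θ * (n:ℝ)^(-θ) := by positivity
    refine this.trans ?_
    rw [add_mul (K * _), mul_assoc K]
    linarith
  · push Not at hc
    refine (en_le n f _ q 0 (by simp)).trans ?_
    simp only [Polynomial.eval_zero, sub_zero]
    refine (holder1 q p hqp.le α β f hf.2 (-1) 1 le_rfl (by norm_num) le_rfl hexp).trans (ENNReal.ofReal_le_ofReal ?_)
    have h1 : ((1:ℝ) - -1)^(1/q.toReal - 1/p.toReal) ≤ 2 := by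
      calc ((1:ℝ) - -1)^(1/q.toReal - 1/p.toReal) ≤ ((1:ℝ) - -1)^(1:ℝ) :=
            Real.rpow_le_rpow_of_exponent_le (by norm_num) (by linarith)
        _ = 2 := by norm_num
    have h2 : (n:ℝ)^θ ≤ ((L*2^(κ+1) : ℕ):ℝ)^θ := Real.rpow_le_rpow hn0.le (by exact_mod_cast hc.le) hθ0
    have h3 : (n:ℝ)^θ * (n:ℝ)^(-θ) = 1 := by rw [← Real.rpow_add hn0]; simp
    have h4 := mul_le_mul_of_nonneg_right h2 hnt.le
    have h5 : 0 ≤ K * (2*L)^θ * (n:ℝ)^(-θ) := by positivity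
    rw [add_mul, mul_assoc 2]
    linarith

theorem statement5 (k : ℕ) (hk : 1 ≤ k) (q p : ℝ≥0∞) (hq : 1 ≤ q) (hqp : q < p)
    (α β : ℝ) (hα : 0 ≤ α) (hβ : 0 ≤ β) :
    ∃ c₁ > (0 : ℝ), ∃ c₂ > (0 : ℝ), ∀ n : ℕ, 1 ≤ n →
      ((2 ≤ k ∧ ¬(k = 2 ∧ q = 1 ∧ p = ∞)) →
        ENNReal.ofReal (c₁ * (n : ℝ) ^ (-(2 / q.toReal - 2 / p.toReal))) ≤
          EClass (MSet k ∩ BSet p α β) n (jacobi α β) q ∧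
        EClass (MSet k ∩ BSet p α β) n (jacobi α β) q ≤
          ENNReal.ofReal (c₂ * (n : ℝ) ^ (-(2 / q.toReal - 2 / p.toReal)))) ∧
      ((k = 2 ∧ q = 1 ∧ p = ∞ ∧ α = 0 ∧ β = 0) →
        ENNReal.ofReal (c₁ * (n : ℝ) ^ (-2 : ℝ)) ≤
          EClass (MSet k ∩ BSet p α β) n (jacobi α β) q ∧
        EClass (MSet k ∩ BSet p α β) n (jacobi α β) q ≤
          ENNReal.ofReal (c₂ * (n : ℝ) ^ (-2 : ℝ))) ∧
      ((k = 1 ∧ p ≠ 2 * q) →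
        ENNReal.ofReal (c₁ * (n : ℝ) ^ (-(min (2 / q.toReal - 2 / p.toReal) (1 / q.toReal)))) ≤
          EClass (MSet k ∩ BSet p α β) n (jacobi α β) q ∧
        EClass (MSet k ∩ BSet p α β) n (jacobi α β) q ≤
          ENNReal.ofReal (c₂ * (n : ℝ) ^ (-(min (2 / q.toReal - 2 / p.toReal) (1 / q.toReal))))) := by
  have hqt : q ≠ ∞ := ne_top_of_lt hqp
  have hQ : 1 ≤ q.toReal := by
    have := ENNReal.toReal_mono hqt hq
    simpa using this
  have hexp : 0 ≤ 1/q.toReal - 1/p.toReal := by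
    by_cases hp : p = ∞
    · subst hp; simp
    · have := ENNReal.toReal_mono hp hqp.le
      have := one_div_le_one_div_of_le (by linarith) this
      linarith
  have hr0 : 0 ≤ 1/p.toReal := by positivity
  have hQ1 : 1/q.toReal ≤ 1 := by rw [div_le_one (by linarith)]; exact hQ
  have e2q : 2/q.toReal = 2 * (1/q.toReal) := by ring
  have e2p : 2/p.toReal = 2 * (1/p.toReal) := by ring
  obtain ⟨a1, ha1, hl1⟩ := lower1 k q p hq hqp α β hα hβ
  obtain ⟨κ, rfl⟩ : ∃ κ, k = κ + 1 := ⟨k - 1, by omega⟩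
  -- upper bound away from the exceptional exponent
  have up : ∀ θ, 0 ≤ θ → θ ≤ 2/q.toReal - 2/p.toReal → θ ≤ κ + 1/q.toReal → 1/(2*q.toReal) - κ/2 - 1/p.toReal ≠ 0 →
      ∃ c > (0:ℝ), ∀ n : ℕ, 1 ≤ n → EClass (MSet (κ+1) ∩ BSet p α β) n (jacobi α β) q ≤ ENNReal.ofReal (c * (n:ℝ)^(-θ)) := by
    intro θ h0 h1 h2 he
    obtain ⟨C, hC, hb⟩ := rhs_bound κ α β hα hβ q.toReal (1/p.toReal) hQ hr0 (by linarith) he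
    refine upper_gen κ q p hq hqp α β hα hβ θ (2*C) h0 h1 (by positivity) ?_
    intro i hi g hg _
    refine (hb i hi g hg).trans ?_
    have hm1 : (1:ℝ) ≤ ((2^i:ℕ):ℝ) := by exact_mod_cast Nat.one_le_two_pow
    have t1 : ((2^i:ℕ):ℝ)^(-(κ+1/q.toReal)) ≤ ((2^i:ℕ):ℝ)^(-θ) := Real.rpow_le_rpow_of_exponent_le hm1 (by linarith)
    have t2 : ((2^i:ℕ):ℝ)^(-(2/q.toReal - 2*(1/p.toReal))) ≤ ((2^i:ℕ):ℝ)^(-θ) :=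
      Real.rpow_le_rpow_of_exponent_le hm1 (by linarith)
    nlinarith
  have eh : 1/(2*q.toReal) = (1/q.toReal)/2 := by field_simp
  rcases Nat.eq_zero_or_pos κ with hκ | hκ
  · -- k = 1
    subst hκ
    by_cases hp2 : p = 2 * q
    · refine ⟨1, one_pos, 1, one_pos, fun n hn => ⟨fun h => absurd h.1 (by norm_num), fun h => absurd h.1 (by norm_num), fun h => absurd hp2 h.2⟩⟩
    obtain ⟨a2, ha2, hl2⟩ := lower2 q p hq hqp α β hα hβ
    have he : 1/(2*q.toReal) - ((0:ℕ):ℝ)/2 - 1/p.toReal ≠ 0 := by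
      intro h
      rw [Nat.cast_zero, zero_div, sub_zero] at h
      by_cases hp : p = ∞
      · subst hp
        simp at h
        linarith
      · have hpp : q.toReal < p.toReal := (ENNReal.toReal_lt_toReal hqt hp).2 hqp
        have h' : 2 * q.toReal = p.toReal := by
          have := sub_eq_zero.1 h
          rw [one_div, one_div] at this
          exact inv_injective this
        apply hp2
        rw [← ENNReal.toReal_eq_toReal_iff' hp (ENNReal.mul_ne_top (by norm_num) hqt), ENNReal.toReal_mul]
        simpa using h'.symm
    obtain ⟨c, hc, hup⟩ := up (min (2 / q.toReal - 2 / p.toReal) (1 / q.toReal)) (le_min (by linarith) (by positivity)) (min_le_left _ _)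
      (by simp) he
    refine ⟨min a1 a2, lt_min ha1 ha2, c, hc, fun n hn => ⟨fun h => absurd h.1 (by norm_num), fun h => absurd h.1 (by norm_num), fun _ => ⟨?_, hup n hn⟩⟩⟩
    rcases min_choice (2 / q.toReal - 2 / p.toReal) (1 / q.toReal) with h | h
    · rw [h]
      exact (ENNReal.ofReal_le_ofReal (mul_le_mul_of_nonneg_right (min_le_left _ _) (by positivity))).trans (hl1 n hn)
    · rw [h]
      exact (ENNReal.ofReal_le_ofReal (mul_le_mul_of_nonneg_right (min_le_right _ _) (by positivity))).trans (hl2 n hn)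
  · have hκ1 : (1:ℝ) ≤ κ := by exact_mod_cast hκ
    by_cases hex : κ + 1 = 2 ∧ q = 1 ∧ p = ∞
    · obtain ⟨h1, rfl, rfl⟩ := hex
      obtain rfl : κ = 1 := by omega
      by_cases hab : α = 0 ∧ β = 0
      · obtain ⟨rfl, rfl⟩ := hab
        obtain ⟨c, hc, hup⟩ := upper_gen 1 1 ∞ le_rfl hqp 0 0 le_rfl le_rfl 2 64 (by norm_num) (by simp) (by norm_num) (by
          intro i hi g hg hg1
          have hm : 2 ≤ 2^i := by
            calc 2 = 2^1 := by norm_num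
              _ ≤ 2^i := Nat.pow_le_pow_right (by norm_num) (by omega)
          have := rhs_bound2 (2^i) hm _ g hg (hg1 rfl rfl rfl)
          rw [ENNReal.toReal_one]
          exact this)
        refine ⟨a1, ha1, c, hc, fun n hn => ⟨fun h => absurd ⟨rfl, rfl, rfl⟩ h.2, fun _ => ⟨?_, hup n hn⟩, fun h => absurd h.1 (by norm_num)⟩⟩
        have := hl1 n hn
        simpa using this
      · exact ⟨1, one_pos, 1, one_pos, fun n hn => ⟨fun h => absurd ⟨rfl, rfl, rfl⟩ h.2, fun h => absurd ⟨h.2.2.2.1, h.2.2.2.2⟩ hab, fun h => absurd h.1 (by norm_num)⟩⟩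
    · have he : 1/(2*q.toReal) - (κ:ℝ)/2 - 1/p.toReal ≠ 0 := by
        intro h
        rw [eh] at h
        have k1 : (κ:ℝ) = 1 := by linarith
        have q1 : 1/q.toReal = 1 := by linarith
        have p1 : 1/p.toReal = 0 := by linarith
        apply hex
        refine ⟨by have : κ = 1 := by exact_mod_cast k1
                   omega, ?_, ?_⟩
        · have : q.toReal = 1 := by field_simp at q1; linarith
          rw [← ENNReal.ofReal_toReal hqt, this, ENNReal.ofReal_one]
        · by_contra hp
          have hpp : q.toReal < p.toReal := (ENNReal.toReal_lt_toReal hqt hp).2 hqp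
          have : 0 < 1/p.toReal := one_div_pos.2 (by linarith)
          linarith
      obtain ⟨c, hc, hup⟩ := up (2/q.toReal - 2/p.toReal) (by linarith) le_rfl (by linarith) he
      refine ⟨a1, ha1, c, hc, fun n hn => ⟨fun _ => ⟨hl1 n hn, hup n hn⟩, fun h => absurd ⟨h.1, h.2.1, h.2.2.1⟩ hex, fun h => absurd h.1 (by omega)⟩⟩
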